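/- Let Ω ⊂ ℝ² be a simply connected bounded Lipschitz domain containing the origin that is invariant under the rotation by angle π/2 about the origin and under the reflection τ(x,y) = (x,−y). Let Ω⁺ = Ω ∩ {y > 0} with ∂_SΩ⁺ = ∂Ω ∩ {y > 0} and ∂_*Ω⁺ = Ω ∩ {y = 0}. Then σ_1^N(Ω⁺) = σ_0^D(Ω⁺) = σ_1(Ω), and consequently σ_1^N(Ω⁺) · L(∂_SΩ⁺) = σ_0^D(Ω⁺) · L(∂_SΩ⁺) ≤ π. (Planar case of Example 3.12(a) of the paper.) -/

import Mathlib

open Set MeasureTheory Metric Filter Asymptotics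
open scoped ENNReal Topology NNReal

noncomputable section

abbrev E2 : Type := EuclideanSpace ℝ (Fin 2)

def IsLipschitzDomain (Ω : Set E2) : Prop :=
  IsOpen Ω ∧ IsConnected Ω ∧ Bornology.IsBounded Ω ∧
    ∀ p ∈ frontier Ω, ∃ (e : E2 ≃ₗᵢ[ℝ] E2) (K : ℝ≥0) (φ : ℝ → ℝ) (U : Set E2),
      LipschitzWith K φ ∧ IsOpen U ∧ p ∈ U ∧
      ∀ x ∈ U, (x ∈ Ω ↔ φ (e x 0) < e x 1)

def dirEnergy (Ω : Set E2) (f : E2 → ℝ) : ℝ≥0∞ :=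
  ∫⁻ x in Ω, (‖fderiv ℝ f x‖₊ : ℝ≥0∞) ^ 2

def bdryInt (Γ : Set E2) (ρ f : E2 → ℝ) : ℝ≥0∞ :=
  ∫⁻ x in Γ, ENNReal.ofReal (ρ x * (f x) ^ 2) ∂μH[1]

def rayleigh (Ω Γ : Set E2) (ρ f : E2 → ℝ) : ℝ≥0∞ :=
  dirEnergy Ω f / bdryInt Γ ρ f

def steklovMixed (Ω ΓS ΓD : Set E2) (ρ : E2 → ℝ) (k : ℕ) : ℝ≥0∞ :=
  ⨅ (V : Submodule ℝ (E2 → ℝ))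
    (_ : Module.finrank ℝ V = k + 1)
    (_ : ∀ f ∈ V, ContDiff ℝ (⊤ : ℕ∞) f)
    (_ : ∀ f ∈ V, ∀ᶠ x in nhdsSet ΓD, f x = 0)
    (_ : ∀ f ∈ V, Set.EqOn f 0 (closure Ω) → f = 0),
    ⨆ f ∈ V, ⨆ (_ : ¬ Set.EqOn f 0 (closure Ω)), rayleigh Ω ΓS ρ f

def steklovN (Ω ΓS : Set E2) (k : ℕ) : ℝ≥0∞ :=
  steklovMixed Ω ΓS ∅ (fun _ => 1) k

def steklovD (Ω ΓS ΓD : Set E2) (k : ℕ) : ℝ≥0∞ :=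
  steklovMixed Ω ΓS ΓD (fun _ => 1) k

def steklovW (Ω : Set E2) (ρ : E2 → ℝ) (k : ℕ) : ℝ≥0∞ :=
  steklovMixed Ω (frontier Ω) ∅ ρ k

def steklov (Ω : Set E2) (k : ℕ) : ℝ≥0∞ := steklovW Ω (fun _ => 1) k

def IsArc (A : Set E2) : Prop :=
  ∃ γ : ℝ → E2, ContinuousOn γ (Icc 0 1) ∧ InjOn γ (Icc 0 1) ∧ A = γ '' Icc 0 1

def IsLoop (A : Set E2) : Prop :=
  ∃ γ : ℝ → E2, ContinuousOn γ (Icc 0 1) ∧ InjOn γ (Ico 0 1) ∧ γ 0 = γ 1 ∧ A = γ '' Icc 0 1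

def IsBoundaryPart (Γ : Set E2) : Prop :=
  ∃ F : Finset (Set E2), (∀ A ∈ F, IsArc A ∨ IsLoop A) ∧ Γ = ⋃₀ ↑F

structure SteklovDecomp (Ω ΓS Γstar : Set E2) : Prop where
  partS : IsBoundaryPart ΓS
  partStar : IsBoundaryPart Γstar
  union_eq : ΓS ∪ Γstar = frontier Ω
  inter_finite : (ΓS ∩ Γstar).Finite
  nonemptyS : ΓS.Nonempty

/-- Rotation of the plane by angle π/2 about the origin. -/
def rotQuarter : E2 → E2 := fun x => (WithLp.equiv 2 (Fin 2 → ℝ)).symm ![-(x 1), x 0]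

/-- The reflection τ(x,y) = (x,−y). -/
def reflX : E2 → E2 := fun x => (WithLp.equiv 2 (Fin 2 → ℝ)).symm ![x 0, -(x 1)]

open scoped ContDiff

/-! ### Continuous logarithms on compact sets and symmetric connected sets in the plane -/

/-- `z ↦ z - p` has a continuous logarithm on `K`. -/
def HasLogOn (K : Set ℂ) (p : ℂ) : Prop :=
  ∃ l : ℂ → ℂ, ContinuousOn l K ∧ ∀ z ∈ K, Complex.exp (l z) = z - p

lemma HasLogOn.of_norm_lt {K : Set ℂ} {p q : ℂ} (h : HasLogOn K p)
    (hq : ∀ z ∈ K, ‖q - p‖ < ‖z - p‖) : HasLogOn K q := by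
  obtain ⟨l, hl, hexp⟩ := h
  have hz : ∀ z ∈ K, z - p ≠ 0 := fun z hz h => by
    have := hq z hz
    rw [h, norm_zero] at this
    exact absurd this (not_lt.2 (norm_nonneg _))
  have hs : ∀ z ∈ K, (z - q) / (z - p) ∈ Complex.slitPlane := by
    intro z hzK
    have h1 : (z - q) / (z - p) = 1 + (p - q) / (z - p) := by
      field_simp [hz z hzK]
      ring
    rw [h1]
    apply Complex.mem_slitPlane_of_norm_lt_one
    rw [norm_div, div_lt_one (norm_pos_iff.2 (hz z hzK)), norm_sub_rev]
    exact hq z hzK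
  refine ⟨fun z => l z + Complex.log ((z - q) / (z - p)), ?_, fun z hzK => ?_⟩
  · refine hl.add (ContinuousOn.clog ?_ hs)
    exact ContinuousOn.div (by fun_prop) (by fun_prop) hz
  · rw [Complex.exp_add, hexp z hzK, Complex.exp_log (Complex.slitPlane_ne_zero (hs z hzK))]
    field_simp [hz z hzK]

lemma HasLogOn.of_isPreconnected {K C : Set ℂ} (hK : IsCompact K) (hC : IsPreconnected C)
    (hd : Disjoint C K) {p q : ℂ} (hp : p ∈ C) (hq : q ∈ C) (h : HasLogOn K p) :
    HasLogOn K q := by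
  revert h
  refine hC.induction₂' (fun x y => HasLogOn K x → HasLogOn K y) (fun x hx => ?_)
    (fun x y z _ _ _ h1 h2 h => h2 (h1 h)) hp hq
  have hxK : x ∈ Kᶜ := fun h => hd.le_bot ⟨hx, h⟩
  obtain ⟨r, hr, hball⟩ := Metric.isOpen_iff.1 hK.isClosed.isOpen_compl x hxK
  have hev : ∀ᶠ y in 𝓝[C] x, ‖y - x‖ < r / 2 := by
    apply mem_nhdsWithin_of_mem_nhds
    filter_upwards [Metric.ball_mem_nhds x (half_pos hr)] with y hy
    simpa [dist_eq_norm] using hy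
  filter_upwards [hev] with y hy
  have hz : ∀ z ∈ K, r ≤ ‖z - x‖ := fun z hz => by
    by_contra hlt
    exact hball (by simpa [dist_eq_norm] using hlt) hz
  refine ⟨fun h => h.of_norm_lt fun z hzK => by linarith [hz z hzK],
    fun h => h.of_norm_lt fun z hzK => ?_⟩
  have := norm_sub_norm_le (z - x) (y - x)
  rw [show z - x - (y - x) = z - y by ring] at this
  rw [norm_sub_rev]
  linarith [hz z hzK]

lemma not_hasLogOn_zero {K : Set ℂ} (hK : IsPreconnected K) (hne : K.Nonempty)
    (hsymm : ∀ z ∈ K, -z ∈ K) : ¬ HasLogOn K 0 := by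
  rintro ⟨l, hl, hexp⟩
  let m : ℂ → ℝ := fun z => (l (-z) - l z).im
  have hm : ContinuousOn m K := by
    refine Complex.continuous_im.comp_continuousOn (ContinuousOn.sub ?_ hl)
    exact hl.comp continuousOn_neg hsymm
  obtain ⟨z, hz⟩ := hne
  have hodd : m (-z) = - m z := by simp [m]
  obtain ⟨w, hw, hw0⟩ : ∃ w ∈ K, m w = 0 := by
    rcases le_total (m z) 0 with h | h
    · obtain ⟨w, hw, h0⟩ := hK.intermediate_value hz (hsymm z hz) hm
        ⟨h, by rw [hodd]; linarith⟩
      exact ⟨w, hw, h0⟩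
    · obtain ⟨w, hw, h0⟩ := hK.intermediate_value (hsymm z hz) hz hm
        ⟨by rw [hodd]; linarith, h⟩
      exact ⟨w, hw, h0⟩
  have h1 : Complex.exp (l (-w) - l w) = -1 := by
    have hw1 := hexp w hw
    have hw2 := hexp (-w) (hsymm w hw)
    rw [sub_zero] at hw1 hw2
    have hne : w ≠ 0 := by rw [← hw1]; exact Complex.exp_ne_zero _
    rw [Complex.exp_sub, hw1, hw2, neg_div, div_self hne]
  have h2 : l (-w) - l w = ((l (-w) - l w).re : ℂ) := by
    apply Complex.ext
    · simp
    · simpa [m] using hw0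
  rw [h2, ← Complex.ofReal_exp] at h1
  have h3 : Real.exp (l (-w) - l w).re = -1 := by exact_mod_cast h1
  linarith [Real.exp_pos (l (-w) - l w).re]

lemma hasLogOn_of_notMem {Ω K : Set ℂ} (hΩ : IsOpen Ω) (hsc : IsSimplyConnected Ω) (hK : K ⊆ Ω)
    {p : ℂ} (hp : p ∉ Ω) : HasLogOn K p := by
  obtain ⟨l, hl, hexp⟩ := Complex.exists_continuousOn_eqOn_exp_comp hsc hΩ
    (g := fun z => z - p) (by fun_prop) (by
      rintro ⟨z, hz, h⟩
      rw [sub_eq_zero] at h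
      exact hp (h ▸ hz))
  exact ⟨l, hl.mono hK, fun z hz => hexp (hK hz)⟩

lemma exists_symmetric_compact_connected {U : Set ℂ} (hU : IsOpen U) (hUc : IsConnected U)
    (hsymm : ∀ z ∈ U, -z ∈ U) :
    ∃ K ⊆ U, IsCompact K ∧ IsPreconnected K ∧ K.Nonempty ∧ ∀ z ∈ K, -z ∈ K := by
  have hpath := (hU.isConnected_iff_isPathConnected).1 hUc
  obtain ⟨p, hp⟩ := hUc.nonempty
  have hJ := hpath.joinedIn p hp (-p) (hsymm p hp)
  let γ := hJ.somePath
  have hγ : range γ ⊆ U := by rintro _ ⟨t, rfl⟩; exact hJ.somePath_mem t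
  have hc : IsPreconnected (range γ) := isPreconnected_range γ.continuous
  have hk : IsCompact (range γ) := isCompact_range γ.continuous
  refine ⟨range γ ∪ (fun z => -z) '' range γ, ?_, ?_, ?_, ?_, ?_⟩
  · rintro z (hz | ⟨w, hw, rfl⟩)
    · exact hγ hz
    · exact hsymm _ (hγ hw)
  · exact hk.union (hk.image continuous_neg)
  · refine IsPreconnected.union p ⟨0, by simp⟩ ⟨-p, ⟨1, by simp⟩, by simp⟩ hc
      (hc.image _ continuous_neg.continuousOn)
  · exact ⟨p, Or.inl ⟨0, by simp⟩⟩
  · rintro z (hz | ⟨w, hw, rfl⟩)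
    · exact Or.inr ⟨z, hz, rfl⟩
    · exact Or.inl (by simpa using hw)

lemma hasLogOn_of_touches {Ω K W : Set ℂ} (hΩ : IsOpen Ω) (hsc : IsSimplyConnected Ω)
    (hK : K ⊆ Ω) (hKc : IsCompact K) (hW : IsPreconnected W) (hKW : Disjoint W K)
    (hWt : (closure W ∩ frontier Ω).Nonempty) {q : ℂ} (hq : q ∈ W) : HasLogOn K q := by
  obtain ⟨p, hpW, hpΩ⟩ := hWt
  have hp : p ∉ Ω := fun h => by
    rw [hΩ.frontier_eq] at hpΩ
    exact hpΩ.2 h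
  have h1 : HasLogOn K p := hasLogOn_of_notMem hΩ hsc hK hp
  obtain ⟨r, hr, hball⟩ := Metric.isOpen_iff.1 hKc.isClosed.isOpen_compl p (fun h => hp (hK h))
  obtain ⟨w, hw, hwr⟩ := Metric.mem_closure_iff.1 hpW r hr
  have h2 : HasLogOn K w :=
    h1.of_isPreconnected hKc (convex_ball p r).isPreconnected
      (disjoint_left.2 fun x hx hxK => hball hx hxK) (mem_ball_self hr)
      (by rwa [mem_ball, dist_comm])
  exact h2.of_isPreconnected hKc hW hKW hw hq

/-- In a simply connected plane domain, two disjoint connected open sets which are both symmetric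
about the origin cannot both accumulate at the boundary. -/
lemma not_both_touch {Ω U W : Set ℂ} (hΩ : IsOpen Ω) (hsc : IsSimplyConnected Ω)
    (hU : IsOpen U) (hUc : IsConnected U) (hUs : ∀ z ∈ U, -z ∈ U) (hUΩ : U ⊆ Ω)
    (hUt : (closure U ∩ frontier Ω).Nonempty)
    (hW : IsOpen W) (hWc : IsConnected W) (hWs : ∀ z ∈ W, -z ∈ W) (hWΩ : W ⊆ Ω)
    (hWt : (closure W ∩ frontier Ω).Nonempty) (hd : Disjoint U W) : False := by
  obtain ⟨K, hKU, hKc, hKp, hKn, hKs⟩ := exists_symmetric_compact_connected hU hUc hUs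
  obtain ⟨L, hLW, hLc, hLp, hLn, hLs⟩ := exists_symmetric_compact_connected hW hWc hWs
  have hWK : ∀ q ∈ W, HasLogOn K q := fun q hq =>
    hasLogOn_of_touches hΩ hsc (hKU.trans hUΩ) hKc hWc.isPreconnected
      (hd.symm.mono_right hKU) hWt hq
  have hUL : ∀ q ∈ U, HasLogOn L q := fun q hq =>
    hasLogOn_of_touches hΩ hsc (hLW.trans hWΩ) hLc hUc.isPreconnected
      (hd.mono_right hLW) hUt hq
  obtain ⟨q, hq, hmin⟩ := (hKc.union hLc).exists_isMinOn (hKn.mono subset_union_left)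
    continuous_norm.continuousOn
  have hmin' : ∀ z ∈ K ∪ L, ‖q‖ ≤ ‖z‖ := fun z hz => hmin hz
  have key : ∀ M ⊆ K ∪ L, IsCompact M → IsPreconnected M → M.Nonempty → (∀ z ∈ M, -z ∈ M) →
      q ∉ M → HasLogOn M q → False := by
    intro M hMsub hMc hMp hMn hMs hqM hlog
    refine not_hasLogOn_zero hMp hMn hMs ?_
    refine hlog.of_isPreconnected hMc (convex_segment (𝕜 := ℝ) q 0).isPreconnected ?_
      (left_mem_segment ℝ q 0) (right_mem_segment ℝ q 0)
    rw [disjoint_left]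
    intro z hz hzM
    obtain ⟨a, b, ha, hb, hab, rfl⟩ := hz
    have h1 := hmin' _ (hMsub hzM)
    simp only [smul_zero, add_zero, norm_smul, Real.norm_of_nonneg ha] at h1
    rcases eq_or_ne q 0 with h0 | h0
    · apply hqM; simpa [h0] using hzM
    · have : 0 < ‖q‖ := norm_pos_iff.2 h0
      have ha1 : a = 1 := by nlinarith
      apply hqM; simpa [ha1] using hzM
  rcases hq with hq | hq
  · exact key L subset_union_right hLc hLp hLn hLs
      (fun h => hd.le_bot ⟨hKU hq, hLW h⟩) (hUL q (hKU hq))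
  · exact key K subset_union_left hKc hKp hKn hKs
      (fun h => hd.le_bot ⟨hKU h, hLW hq⟩) (hWK q (hLW hq))

/-! ### The symmetries as linear isometries -/

lemma E2.norm_sq (x : E2) : ‖x‖ ^ 2 = x 0 ^ 2 + x 1 ^ 2 := by
  rw [EuclideanSpace.norm_eq, Real.sq_sqrt (by positivity)]
  simp [Fin.sum_univ_two]

lemma E2.ext' {x y : E2} (h0 : x 0 = y 0) (h1 : x 1 = y 1) : x = y := by
  ext i; fin_cases i
  · exact h0
  · exact h1

lemma E2.norm_eq_of {x y : E2} (h : x 0 ^ 2 + x 1 ^ 2 = y 0 ^ 2 + y 1 ^ 2) : ‖x‖ = ‖y‖ := by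
  rw [← sq_eq_sq₀ (norm_nonneg _) (norm_nonneg _), E2.norm_sq, E2.norm_sq, h]

/-- The reflection in the horizontal axis as a linear isometry. -/
def tauE : E2 ≃ₗᵢ[ℝ] E2 where
  toFun := reflX
  invFun := reflX
  map_add' x y := by apply E2.ext' <;> simp [reflX]; ring
  map_smul' c x := by apply E2.ext' <;> simp [reflX]
  left_inv x := by apply E2.ext' <;> simp [reflX]
  right_inv x := by apply E2.ext' <;> simp [reflX]
  norm_map' x := by apply E2.norm_eq_of; simp [reflX]

/-- The quarter turn as a linear isometry. -/
def rotE : E2 ≃ₗᵢ[ℝ] E2 where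
  toFun := rotQuarter
  invFun x := -rotQuarter x
  map_add' x y := by apply E2.ext' <;> simp [rotQuarter]; ring
  map_smul' c x := by apply E2.ext' <;> simp [rotQuarter]
  left_inv x := by apply E2.ext' <;> simp [rotQuarter]
  right_inv x := by apply E2.ext' <;> simp [rotQuarter]
  norm_map' x := by apply E2.norm_eq_of; simp [rotQuarter]; ring

@[simp] lemma tauE_zero (x : E2) : tauE x 0 = x 0 := rfl
@[simp] lemma tauE_one (x : E2) : tauE x 1 = -x 1 := rfl
@[simp] lemma rotE_zero (x : E2) : rotE x 0 = -x 1 := rfl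
@[simp] lemma rotE_one (x : E2) : rotE x 1 = x 0 := rfl
@[simp] lemma tauE_tauE (x : E2) : tauE (tauE x) = x := by apply E2.ext' <;> simp
@[simp] lemma rotE_rotE (x : E2) : rotE (rotE x) = -x := by apply E2.ext' <;> simp
@[simp] lemma tauE_symm : tauE.symm = tauE := rfl
@[simp] lemma rotE_symm (x : E2) : rotE.symm x = - rotE x := rfl
lemma tauE_rotE (x : E2) : tauE (rotE x) = -rotE (tauE x) := by apply E2.ext' <;> simp

/-! ### Interior directions -/

/-- `v` points uniformly into `Ω` from all points of the closure of `Ω` near `x`. -/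
def InDir (Ω : Set E2) (x v : E2) : Prop :=
  ∃ δ > 0, ∀ y ∈ closure Ω, dist y x < δ → ∀ w, dist w v < δ → ∀ s : ℝ, 0 < s → s < δ →
    y + s • w ∈ Ω

lemma InDir.add {Ω : Set E2} {x v v' : E2} (h : InDir Ω x v) (h' : InDir Ω x v') :
    InDir Ω x (v + v') := by
  obtain ⟨a, ha, h⟩ := h
  obtain ⟨b, hb, h'⟩ := h'
  have hv := norm_nonneg v
  refine ⟨min (min a (b / 2)) (b / (2 * (‖v‖ + 1))), by positivity, ?_⟩
  intro y hy hyx w hw s hs hs'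
  simp only [lt_min_iff] at hyx hw hs'
  have h1 : y + s • v ∈ Ω := h y hy hyx.1.1 v (by simpa using ha) s hs hs'.1.1
  have h2 : y + s • w = (y + s • v) + s • (w - v) := by module
  rw [h2]
  refine h' _ (subset_closure h1) ?_ _ ?_ s hs (by linarith [hs'.1.2])
  · have h3 : dist (y + s • v) y ≤ b / 2 := by
      rw [dist_eq_norm, add_sub_cancel_left, norm_smul, Real.norm_of_nonneg hs.le]
      have := hs'.2
      rw [lt_div_iff₀ (by positivity)] at this
      nlinarith
    linarith [dist_triangle (y + s • v) y x, hyx.1.2]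
  · have : dist (w - v) v' = dist w (v + v') := by
      rw [dist_eq_norm, dist_eq_norm]; congr 1; abel
    rw [this]; linarith [hw.1.2]

lemma InDir.smul {Ω : Set E2} {x v : E2} (h : InDir Ω x v) {c : ℝ} (hc : 0 < c) :
    InDir Ω x (c • v) := by
  obtain ⟨a, ha, h⟩ := h
  refine ⟨min a (min (c * a) (a / c)), by positivity, ?_⟩
  intro y hy hyx w hw s hs hs'
  simp only [lt_min_iff] at hyx hw hs'
  have h2 : y + s • w = y + (s * c) • (c⁻¹ • w) := by
    rw [smul_smul, mul_assoc, mul_inv_cancel₀ hc.ne', mul_one]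
  rw [h2]
  refine h y hy hyx.1 _ ?_ _ (by positivity) ?_
  · have : c⁻¹ • w - v = c⁻¹ • (w - c • v) := by
      rw [smul_sub, smul_smul, inv_mul_cancel₀ hc.ne', one_smul]
    rw [dist_eq_norm, this, norm_smul, norm_inv, Real.norm_of_nonneg hc.le,
      inv_mul_lt_iff₀ hc, ← dist_eq_norm]
    exact hw.2.1
  · exact (lt_div_iff₀ hc).1 hs'.2.2

lemma convex_inDir (Ω : Set E2) (x : E2) : Convex ℝ {v | InDir Ω x v} := by
  rw [convex_iff_forall_pos]
  intro v hv w hw a b ha hb _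
  exact InDir.add (hv.smul ha) (hw.smul hb)

lemma InDir.eventually {Ω : Set E2} {x v : E2} (h : InDir Ω x v) : ∀ᶠ y in 𝓝 x, InDir Ω y v := by
  obtain ⟨a, ha, h⟩ := h
  filter_upwards [ball_mem_nhds x (half_pos ha)] with y hy
  refine ⟨a / 2, half_pos ha, fun z hz hzy w hw s hs hs' => ?_⟩
  refine h z hz ?_ w (by linarith) s hs (by linarith)
  rw [mem_ball] at hy
  linarith [dist_triangle z y x]

lemma InDir.map {Ω : Set E2} (g : E2 ≃ₗᵢ[ℝ] E2) (hg : g '' Ω = Ω) {x v : E2}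
    (h : InDir Ω (g x) v) : InDir Ω x (g.symm v) := by
  obtain ⟨a, ha, h⟩ := h
  refine ⟨a, ha, fun y hy hyx w hw s hs hs' => ?_⟩
  have h1 : g (y + s • w) ∈ Ω := by
    rw [map_add, map_smul]
    refine h _ ?_ (by rwa [g.dist_map]) _ ?_ s hs hs'
    · have : g '' closure Ω = closure Ω := by
        conv_rhs => rw [← hg]
        exact g.toHomeomorph.image_closure Ω
      rw [← this]; exact mem_image_of_mem _ hy
    · rwa [← g.symm.dist_map, g.symm_apply_apply]
  rw [← hg] at h1
  obtain ⟨z, hz, hzz⟩ := h1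
  rwa [← g.injective hzz]

lemma InDir.ne_zero {Ω : Set E2} (hΩ : IsOpen Ω) {x v : E2} (hx : x ∈ frontier Ω)
    (h : InDir Ω x v) : v ≠ 0 := by
  rintro rfl
  obtain ⟨a, ha, h⟩ := h
  have := h x (frontier_subset_closure hx) (by simpa using ha) 0 (by simpa using ha) (a / 2)
    (by positivity) (by linarith)
  rw [hΩ.frontier_eq] at hx
  exact hx.2 (by simpa using this)

lemma exists_inDir {Ω : Set E2} (hΩ : IsLipschitzDomain Ω) (x : E2) : ∃ v, InDir Ω x v := by
  by_cases hxc : x ∈ closure Ω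
  swap
  · obtain ⟨r, hr, hb⟩ := Metric.isOpen_iff.1 isClosed_closure.isOpen_compl x hxc
    exact ⟨0, r, hr, fun y hy hyx => absurd hy (hb hyx)⟩
  by_cases hx : x ∈ Ω
  · obtain ⟨r, hr, hb⟩ := Metric.isOpen_iff.1 hΩ.1 x hx
    refine ⟨0, min 1 (r / 2), by positivity, fun y _ hyx w hw s hs hs' => hb ?_⟩
    simp only [lt_min_iff, dist_zero_right] at hyx hw hs'
    have : dist (y + s • w) y ≤ r / 2 := by
      rw [dist_eq_norm, add_sub_cancel_left, norm_smul, Real.norm_of_nonneg hs.le]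
      nlinarith [norm_nonneg w]
    rw [mem_ball]
    linarith [dist_triangle (y + s • w) y x]
  have hxf : x ∈ frontier Ω := by rw [hΩ.1.frontier_eq]; exact ⟨hxc, hx⟩
  obtain ⟨e, K, φ, U, hφ, hU, hxU, hiff⟩ := hΩ.2.2.2 x hxf
  obtain ⟨r, hr, hb⟩ := Metric.isOpen_iff.1 hU x hxU
  refine ⟨e.symm (EuclideanSpace.single 1 1), min (min 1 (r / 4)) (1 / (2 * (K + 1))),
    by positivity, fun y hy hyx w hw s hs hs' => ?_⟩
  simp only [lt_min_iff] at hyx hw hs'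
  have hew : dist (e w) (EuclideanSpace.single 1 1)
      = dist w (e.symm (EuclideanSpace.single 1 1)) := by
    rw [← e.dist_map w, e.apply_symm_apply]
  have hwn : ‖w‖ ≤ 2 := by
    have h1 : ‖e.symm (EuclideanSpace.single (1 : Fin 2) (1 : ℝ))‖ = 1 := by simp
    have h2 := norm_le_norm_add_norm_sub' w (e.symm (EuclideanSpace.single 1 1))
    rw [← dist_eq_norm] at h2
    linarith [hw.1.1]
  set d := dist w (e.symm (EuclideanSpace.single 1 1)) with hd
  have hc : ∀ i, |e w i - (EuclideanSpace.single (1 : Fin 2) (1 : ℝ)) i| ≤ d := by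
    intro i
    rw [← hew, dist_eq_norm, ← Real.norm_eq_abs]
    exact PiLp.norm_apply_le (e w - EuclideanSpace.single 1 1) i
  have hc0 := hc 0
  have hc1 := hc 1
  simp at hc0 hc1
  have hyU : ∀ z, dist z x < r → z ∈ U := fun z hz => hb hz
  have hy1 : φ (e y 0) ≤ e y 1 := by
    have hyU' : y ∈ U := hyU y (by linarith [hyx.1.2])
    have hcl : IsClosed {z : E2 | φ (e z 0) ≤ e z 1} := by
      refine isClosed_le (hφ.continuous.comp ?_) ?_ <;> fun_prop
    have h1 : y ∈ closure (Ω ∩ U) := hU.closure_inter ⟨hy, hyU'⟩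
    exact closure_minimal (fun z hz => ((hiff z hz.2).1 hz.1).le) hcl h1
  have hzU : y + s • w ∈ U := by
    apply hyU
    have : dist (y + s • w) y ≤ r / 2 := by
      rw [dist_eq_norm, add_sub_cancel_left, norm_smul, Real.norm_of_nonneg hs.le]
      nlinarith [norm_nonneg w, hs'.1.2]
    linarith [dist_triangle (y + s • w) y x, hyx.1.2]
  rw [hiff _ hzU]
  have hl : |φ (e (y + s • w) 0) - φ (e y 0)| ≤ K * (s * d) := by
    have := hφ.dist_le_mul (e (y + s • w) 0) (e y 0)
    rw [Real.dist_eq, Real.dist_eq] at this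
    refine this.trans ?_
    gcongr
    simp only [map_add, map_smul, PiLp.add_apply, PiLp.smul_apply, smul_eq_mul,
      add_sub_cancel_left, abs_mul, abs_of_pos hs]
    gcongr
  have h1 : e (y + s • w) 1 = e y 1 + s * e w 1 := by simp
  rw [h1]
  have h2 := (abs_le.1 hl).2
  have h3 := (abs_le.1 hc1).1
  have h4 : d * (2 * (K + 1)) < 1 := by
    rw [← lt_div_iff₀ (by positivity)]; exact hw.2
  have h5 : (0 : ℝ) ≤ K := K.2
  have h6 : 0 ≤ d := dist_nonneg
  have : K * (s * d) < s * e w 1 := by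
    have : K * d < e w 1 := by nlinarith
    nlinarith
  linarith

/-! ### A symmetric vector field pushing the closure of the domain into the domain -/

lemma LinearIsometryEquiv.image_closure_eq {Ω : Set E2} (g : E2 ≃ₗᵢ[ℝ] E2) (hg : g '' Ω = Ω) :
    g '' closure Ω = closure Ω := by
  conv_rhs => rw [← hg]
  exact g.toHomeomorph.image_closure Ω

lemma LinearIsometryEquiv.mem_iff_of_image_eq {Ω : Set E2} (g : E2 ≃ₗᵢ[ℝ] E2) (hg : g '' Ω = Ω)
    {x : E2} : g x ∈ Ω ↔ x ∈ Ω := by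
  conv_lhs => rw [← hg]
  exact g.injective.mem_set_image

/-- A vector field which is smooth, Lipschitz, compatible with the symmetries, and points into
`Ω` along its closure. -/
structure PushField (Ω : Set E2) (X : E2 → E2) (K : ℝ≥0) : Prop where
  smooth : ContDiff ℝ ∞ X
  lip : LipschitzWith K X
  inDir : ∀ x ∈ closure Ω, InDir Ω x (X x)
  tau : ∀ x, X (tauE x) = tauE (X x)
  rot : ∀ x, X (rotE x) = rotE (X x)

lemma exists_symmetrization {Ω : Set E2} {X : E2 → E2} (g : E2 ≃ₗᵢ[ℝ] E2) (hg : g '' Ω = Ω)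
    (h1 : ContDiff ℝ ∞ X) (h2 : HasCompactSupport X) (h3 : ∀ x ∈ closure Ω, InDir Ω x (X x)) :
    ContDiff ℝ ∞ (fun x => X x + g.symm (X (g x))) ∧
      HasCompactSupport (fun x => X x + g.symm (X (g x))) ∧
      ∀ x ∈ closure Ω, InDir Ω x (X x + g.symm (X (g x))) := by
  refine ⟨?_, ?_, ?_⟩
  · exact h1.add (g.symm.contDiff.comp (h1.comp g.contDiff))
  · refine h2.add ?_
    have : HasCompactSupport (X ∘ g) := h2.comp_homeomorph g.toHomeomorph
    exact this.comp_left (g := g.symm) (map_zero _)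
  · intro x hx
    refine (h3 x hx).add (InDir.map g hg (h3 _ ?_))
    rwa [g.mem_iff_of_image_eq (g.image_closure_eq hg)]

lemma exists_pushField {Ω : Set E2} (hΩ : IsLipschitzDomain Ω)
    (hrot : rotQuarter '' Ω = Ω) (hrefl : reflX '' Ω = Ω) :
    ∃ X K, PushField Ω X K := by
  have hrot' : rotE '' Ω = Ω := hrot
  have hrefl' : tauE '' Ω = Ω := hrefl
  obtain ⟨Y, hY⟩ := exists_contMDiffMap_forall_mem_convex_of_local_const (n := ⊤)
    (modelWithCornersSelf ℝ E2) (F := E2) (t := fun x => {v | InDir Ω x v})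
    (fun x => convex_inDir Ω x) (fun x => by
      obtain ⟨v, hv⟩ := exists_inDir hΩ x
      exact ⟨v, hv.eventually⟩)
  have hYs : ContDiff ℝ ∞ (Y : E2 → E2) := contMDiff_iff_contDiff.1 Y.contMDiff
  have hcomp : IsCompact (closure Ω) := hΩ.2.2.1.isCompact_closure
  obtain ⟨r, hr⟩ := hcomp.isBounded.subset_ball (0 : E2)
  have hr' : closure Ω ⊆ ball 0 (max r 1) := hr.trans (ball_subset_ball (le_max_left _ _))
  let χ : ContDiffBump (0 : E2) := ⟨max r 1, max r 1 + 1, by positivity, by linarith⟩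
  have hneg : LinearIsometryEquiv.neg ℝ '' Ω = Ω := by
    have : ⇑(LinearIsometryEquiv.neg ℝ (E := E2)) = rotE ∘ rotE := by ext1 x; simp
    rw [this, image_comp, hrot', hrot']
  let X0 : E2 → E2 := fun x => χ x • Y x
  have a1 : ContDiff ℝ ∞ X0 := χ.contDiff.smul hYs
  have a2 : HasCompactSupport X0 := χ.hasCompactSupport.smul_right
  have a3 : ∀ x ∈ closure Ω, InDir Ω x (X0 x) := fun x hx => by
    have : χ x = 1 := χ.one_of_mem_closedBall (ball_subset_closedBall (hr' hx))
    simp only [X0, this, one_smul]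
    exact hY x
  obtain ⟨b1, b2, b3⟩ := exists_symmetrization _ hneg a1 a2 a3
  set X1 : E2 → E2 := fun x =>
    X0 x + (LinearIsometryEquiv.neg ℝ).symm (X0 (LinearIsometryEquiv.neg ℝ x))
    with hX1
  have e1 : ∀ x, X1 (-x) = - X1 x := fun x => by simp [hX1]
  obtain ⟨c1, c2, c3⟩ := exists_symmetrization _ hrot' b1 b2 b3
  set X2 : E2 → E2 := fun x => X1 x + rotE.symm (X1 (rotE x)) with hX2
  have e2 : ∀ x, X2 (rotE x) = rotE (X2 x) := fun x => by
    simp only [hX2, rotE_symm, rotE_rotE, e1, map_neg, map_add, neg_neg]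
    abel
  have e2' : ∀ x, X2 (-x) = - X2 x := fun x => by
    simp only [hX2, rotE_symm, e1, map_neg, neg_neg]; abel
  obtain ⟨d1, d2, d3⟩ := exists_symmetrization _ hrefl' c1 c2 c3
  set X3 : E2 → E2 := fun x => X2 x + tauE.symm (X2 (tauE x)) with hX3
  obtain ⟨K, hK⟩ := d1.lipschitzWith_of_hasCompactSupport d2 (by simp)
  refine ⟨X3, K, d1, hK, d3, fun x => ?_, fun x => ?_⟩
  · simp only [hX3, tauE_symm, tauE_tauE, map_add]; abel
  · simp only [hX3, e2, tauE_symm, tauE_rotE, e2', map_add, map_neg, neg_neg]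

/-- The map displacing each point along the vector field `X` for time `t`. -/
def push (X : E2 → E2) (t : ℝ) (x : E2) : E2 := x + t • X x

namespace PushField

variable {Ω : Set E2} {X : E2 → E2} {K : ℝ≥0}

lemma neg (h : PushField Ω X K) (x : E2) : X (-x) = - X x := by
  rw [← rotE_rotE, h.rot, h.rot, rotE_rotE]

lemma push_tau (h : PushField Ω X K) (t : ℝ) (x : E2) : push X t (tauE x) = tauE (push X t x) := by
  simp [push, h.tau]

lemma push_rot (h : PushField Ω X K) (t : ℝ) (x : E2) : push X t (rotE x) = rotE (push X t x) := by
  simp [push, h.rot]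

lemma push_neg (h : PushField Ω X K) (t : ℝ) (x : E2) : push X t (-x) = -push X t x := by
  simp [push, h.neg]; abel

lemma contDiff_push (h : PushField Ω X K) (t : ℝ) : ContDiff ℝ ∞ (push X t) :=
  contDiff_id.add (h.smooth.const_smul t)

lemma tendsto_push (x : E2) : Tendsto (fun t => push X t x) (𝓝[>] 0) (𝓝 x) := by
  have : Continuous (fun t : ℝ => push X t x) := by unfold push; fun_prop
  have h := this.tendsto 0
  simp only [push, zero_smul, add_zero] at h
  exact h.mono_left nhdsWithin_le_nhds

lemma eventually_mapsTo (h : PushField Ω X K) (hΩ : Bornology.IsBounded Ω) :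
    ∀ᶠ t in 𝓝[>] (0 : ℝ), MapsTo (push X t) (closure Ω) Ω := by
  refine hΩ.isCompact_closure.induction_on (p := fun S => ∀ᶠ t in 𝓝[>] (0 : ℝ),
    MapsTo (push X t) S Ω) (Eventually.of_forall fun t => mapsTo_empty _ _) ?_ ?_ ?_
  · intro s t hst ht
    filter_upwards [ht] with r hr using hr.mono_left hst
  · intro s t hs ht
    filter_upwards [hs, ht] with r h1 h2 using h1.union h2
  · intro x hx
    obtain ⟨δ, hδ, hd⟩ := h.inDir x hx
    have hX : ∀ᶠ y in 𝓝 x, dist y x < δ ∧ dist (X y) (X x) < δ :=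
      Filter.Eventually.and (Metric.ball_mem_nhds x hδ)
        ((h.smooth.continuous.tendsto x).eventually (Metric.ball_mem_nhds _ hδ))
    refine ⟨_, inter_mem_nhdsWithin _ hX, ?_⟩
    filter_upwards [Ioo_mem_nhdsGT hδ] with t ht y hy
    exact hd y hy.1 hy.2.1 _ hy.2.2 t ht.1 ht.2

lemma antilipschitz_push (h : PushField Ω X K) {t : ℝ} (ht : 0 < t) (htK : t * K < 1) :
    AntilipschitzWith (Real.toNNReal (1 - t * K))⁻¹ (push X t) := by
  refine AntilipschitzWith.of_le_mul_dist fun x y => ?_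
  have h1 : 0 < 1 - t * K := by linarith
  rw [NNReal.coe_inv, Real.coe_toNNReal _ h1.le, inv_mul_eq_div, le_div_iff₀ h1]
  have h2 := h.lip.dist_le_mul x y
  have h3 : dist x y ≤ dist (push X t x) (push X t y) + t * dist (X x) (X y) := by
    rw [dist_eq_norm, dist_eq_norm, dist_eq_norm, ← Real.norm_of_nonneg ht.le, ← norm_smul,
      Real.norm_of_nonneg ht.le]
    have : x - y = (push X t x - push X t y) - t • (X x - X y) := by simp only [push]; module
    conv_lhs => rw [this]
    exact norm_sub_le _ _
  nlinarith

lemma push_one_pos (h : PushField Ω X K) {t : ℝ} (ht : 0 < t) (htK : t * K < 1) {x : E2}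
    (hx : 0 < x 1) : 0 < push X t x 1 := by
  have h1 : |X x 1| ≤ K * x 1 := by
    have h2 := h.lip.dist_le_mul x (tauE x)
    have h3 : ∀ z : E2, dist z (tauE z) = 2 * |z 1| := by
      intro z
      rw [dist_eq_norm, ← sq_eq_sq₀ (norm_nonneg _) (by positivity), E2.norm_sq]
      simp [mul_pow]; ring
    rw [h.tau, h3, h3, abs_of_pos hx] at h2
    linarith
  have := (abs_le.1 h1).1
  simp only [push, PiLp.add_apply, PiLp.smul_apply, smul_eq_mul]
  nlinarith

end PushField

/-! ### Fatou's lemma for weighted bounds, and the energy of a pushed function -/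

lemma mul_lintegral_le_of_liminf {α ι : Type*} [MeasurableSpace α] {μ : Measure α} {u : Filter ι}
    [u.NeBot] [u.IsCountablyGenerated] {F : ι → α → ℝ≥0∞} {G : α → ℝ≥0∞} {b M₀ : ℝ≥0∞}
    {M : ι → ℝ≥0∞} (hF : ∀ᶠ i in u, AEMeasurable (F i) μ)
    (hlim : ∀ᵐ a ∂μ, G a ≤ liminf (fun i => F i a) u)
    (hle : ∀ᶠ i in u, b * ∫⁻ a, F i a ∂μ ≤ M i) (hM : Tendsto M u (𝓝 M₀)) :
    b * ∫⁻ a, G a ∂μ ≤ M₀ := by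
  classical
  let F' : ι → α → ℝ≥0∞ := fun i => if AEMeasurable (F i) μ then F i else 0
  have hF' : ∀ i, AEMeasurable (F' i) μ := fun i => by
    by_cases h : AEMeasurable (F i) μ
    · simp [F', h]
    · simp only [F', h, if_false]; exact aemeasurable_const
  have heq : ∀ᶠ i in u, F' i = F i := by
    filter_upwards [hF] with i hi using by simp [F', hi]
  calc b * ∫⁻ a, G a ∂μ ≤ b * ∫⁻ a, liminf (fun i => F' i a) u ∂μ := by
        refine mul_le_mul_right (lintegral_mono_ae ?_) b
        filter_upwards [hlim] with a ha
        refine ha.trans (le_of_eq (liminf_congr ?_))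
        filter_upwards [heq] with i hi using by rw [hi]
    _ ≤ b * liminf (fun i => ∫⁻ a, F' i a ∂μ) u := by
        gcongr; exact lintegral_liminf_le' hF'
    _ = liminf (fun _ => b) u * liminf (fun i => ∫⁻ a, F' i a ∂μ) u := by rw [liminf_const]
    _ ≤ liminf (fun i => b * ∫⁻ a, F' i a ∂μ) u := ENNReal.le_liminf_mul
    _ ≤ liminf M u := by
        refine liminf_le_liminf ?_
        filter_upwards [heq, hle] with i h1 h2 using by rw [h1]; exact h2
    _ = M₀ := hM.liminf_eq

lemma mul_lintegral_le_of_tendsto {α ι : Type*} [MeasurableSpace α] {μ : Measure α} {u : Filter ι}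
    [u.NeBot] [u.IsCountablyGenerated] {F : ι → α → ℝ≥0∞} {G : α → ℝ≥0∞} {b M₀ : ℝ≥0∞}
    {M : ι → ℝ≥0∞} (hF : ∀ᶠ i in u, AEMeasurable (F i) μ)
    (hlim : ∀ᵐ a ∂μ, Tendsto (fun i => F i a) u (𝓝 (G a)))
    (hle : ∀ᶠ i in u, b * ∫⁻ a, F i a ∂μ ≤ M i) (hM : Tendsto M u (𝓝 M₀)) :
    b * ∫⁻ a, G a ∂μ ≤ M₀ :=
  mul_lintegral_le_of_liminf hF (hlim.mono fun _ h => h.liminf_eq.ge) hle hM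

/-- A smooth function on an open set agrees near a compact subset with a globally smooth one. -/
lemma exists_contDiff_eventuallyEq {O K : Set E2} (hO : IsOpen O) (hK : IsCompact K)
    (hKO : K ⊆ O) {w : E2 → ℝ} (hw : ContDiffOn ℝ ∞ w O) :
    ∃ v : E2 → ℝ, ContDiff ℝ ∞ v ∧ ∀ᶠ x in 𝓝ˢ K, v x = w x := by
  obtain ⟨C, hC, hKC, hCO⟩ := exists_compact_between hK hO hKO
  obtain ⟨χ, h1, h2, -⟩ := exists_contMDiffMap_one_nhds_of_subset_interior (n := ⊤)
    (modelWithCornersSelf ℝ E2) hK.isClosed hKC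
  have hχ : ContDiff ℝ ∞ (χ : E2 → ℝ) := contMDiff_iff_contDiff.1 χ.contMDiff
  refine ⟨fun x => χ x * w x, contDiff_iff_contDiffAt.2 fun x => ?_, ?_⟩
  · by_cases hx : x ∈ O
    · exact hχ.contDiffAt.mul (hw.contDiffAt (hO.mem_nhds hx))
    · have : (fun x => χ x * w x) =ᶠ[𝓝 x] fun _ => 0 := by
        filter_upwards [hC.isClosed.isOpen_compl.mem_nhds (fun h => hx (hCO h))] with y hy
        rw [h2 y hy, zero_mul]
      exact contDiffAt_const.congr_of_eventuallyEq this
  · filter_upwards [h1] with x hx using by rw [hx, one_mul]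

lemma dirEnergy_congr {W : Set E2} {u v : E2 → ℝ} (hW : MeasurableSet W)
    (h : ∀ x ∈ W, u =ᶠ[𝓝 x] v) : dirEnergy W u = dirEnergy W v :=
  setLIntegral_congr_fun hW fun x hx => by simp only [(h x hx).fderiv_eq]

/-- The factor by which pushing for time `t` along a `K`-Lipschitz field can increase energy. -/
def pushFactor (K : ℝ≥0) (t : ℝ) : ℝ≥0∞ :=
  ENNReal.ofReal ((1 + t * K) ^ 2) * ENNReal.ofReal (((1 - t * K)⁻¹) ^ 2)

lemma tendsto_pushFactor (K : ℝ≥0) : Tendsto (pushFactor K) (𝓝[>] 0) (𝓝 1) := by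
  have h1 : Tendsto (fun t : ℝ => ENNReal.ofReal ((1 + t * K) ^ 2)) (𝓝[>] 0) (𝓝 1) := by
    have : ContinuousAt (fun t : ℝ => (1 + t * K) ^ 2) 0 := by fun_prop
    have := (ENNReal.continuous_ofReal.continuousAt.comp this).tendsto
    simp only [Function.comp_def, zero_mul, add_zero, one_pow, ENNReal.ofReal_one] at this
    exact this.mono_left nhdsWithin_le_nhds
  have h2 : Tendsto (fun t : ℝ => ENNReal.ofReal (((1 - t * K)⁻¹) ^ 2)) (𝓝[>] 0) (𝓝 1) := by
    have : ContinuousAt (fun t : ℝ => ((1 - t * K)⁻¹) ^ 2) 0 :=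
      ((continuousAt_const.sub (continuousAt_id.mul continuousAt_const)).inv₀ (by simp)).pow 2
    have := (ENNReal.continuous_ofReal.continuousAt.comp this).tendsto
    simp only [Function.comp_def, zero_mul, sub_zero, inv_one, one_pow, ENNReal.ofReal_one] at this
    exact this.mono_left nhdsWithin_le_nhds
  have := ENNReal.Tendsto.mul h1 (by simp) h2 (by simp)
  rw [mul_one] at this
  exact this

lemma eventually_mul_lt_one (K : ℝ≥0) : ∀ᶠ t : ℝ in 𝓝[>] 0, 0 < t ∧ t * K < 1 := by
  have : ∀ᶠ t : ℝ in 𝓝 0, t * K < 1 := by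
    have : ContinuousAt (fun t : ℝ => t * K) 0 := by fun_prop
    exact this.tendsto.eventually_lt_const (by simp)
  exact (eventually_mem_nhdsWithin).and (this.filter_mono nhdsWithin_le_nhds)

namespace PushField

variable {Ω : Set E2} {X : E2 → E2} {K : ℝ≥0}

lemma volume_preimage_push_le (h : PushField Ω X K) {t : ℝ} (ht : 0 < t) (htK : t * K < 1)
    (S : Set E2) :
    volume (push X t ⁻¹' S) ≤ ENNReal.ofReal (((1 - t * K)⁻¹) ^ 2) * volume S := by
  have h1 : 0 < 1 - t * K := by linarith
  have hv := Measure.isAddLeftInvariant_eq_smul (volume : Measure E2) (μH[(2 : ℕ)] : Measure E2)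
  set c := Measure.addHaarScalarFactor (volume : Measure E2) (μH[(2 : ℕ)] : Measure E2)
  rw [hv]
  simp only [Measure.smul_apply]
  have h2 := (h.antilipschitz_push ht htK).hausdorffMeasure_preimage_le
    (Nat.cast_nonneg 2 : (0 : ℝ) ≤ (2 : ℕ)) S
  have h3 : (((1 - t * K).toNNReal⁻¹ : ℝ≥0) : ℝ≥0∞) ^ ((2 : ℕ) : ℝ)
      = ENNReal.ofReal (((1 - t * K)⁻¹) ^ 2) := by
    rw [ENNReal.rpow_natCast, ENNReal.ofReal_pow (by positivity), ← Real.toNNReal_inv]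
    rfl
  rw [h3] at h2
  calc c • μH[(2 : ℕ)] (push X t ⁻¹' S)
      ≤ c • (ENNReal.ofReal (((1 - t * K)⁻¹) ^ 2) * μH[(2 : ℕ)] S) := by gcongr
    _ = _ := by rw [mul_smul_comm]

lemma dirEnergy_comp_push_le (h : PushField Ω X K) {t : ℝ} (ht : 0 < t) (htK : t * K < 1)
    {W : Set E2} (hW : MeasurableSet W) (hmaps : MapsTo (push X t) W W) {u : E2 → ℝ}
    (hu : ∀ x ∈ W, DifferentiableAt ℝ u x) :
    dirEnergy W (u ∘ push X t) ≤ pushFactor K t * dirEnergy W u := by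
  have hpush := h.contDiff_push t
  have hmeas : Measurable (push X t) := hpush.continuous.measurable
  let F : E2 → ℝ≥0∞ := W.indicator fun x => (‖fderiv ℝ u x‖₊ : ℝ≥0∞) ^ 2
  have hF : Measurable F := by
    refine Measurable.indicator ?_ hW
    exact (measurable_fderiv ℝ u).nnnorm.coe_nnreal_ennreal.pow_const 2
  have hderiv : ∀ x, ‖fderiv ℝ (push X t) x‖ ≤ 1 + t * K := by
    intro x
    have h1 : LipschitzWith (1 + t * K).toNNReal (push X t) := by
      refine LipschitzWith.of_dist_le_mul fun x y => ?_
      rw [Real.coe_toNNReal _ (by positivity)]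
      have h2 := h.lip.dist_le_mul x y
      have h3 : dist (push X t x) (push X t y) ≤ dist x y + t * dist (X x) (X y) := by
        rw [dist_eq_norm, dist_eq_norm, dist_eq_norm, ← Real.norm_of_nonneg ht.le, ← norm_smul,
          Real.norm_of_nonneg ht.le]
        have : push X t x - push X t y = (x - y) + t • (X x - X y) := by simp only [push]; module
        rw [this]
        exact norm_add_le _ _
      nlinarith
    have := norm_fderiv_le_of_lipschitz ℝ h1 (x₀ := x)
    rwa [Real.coe_toNNReal _ (by positivity)] at this
  have hpt : ∀ x ∈ W, (‖fderiv ℝ (u ∘ push X t) x‖₊ : ℝ≥0∞) ^ 2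
      ≤ ENNReal.ofReal ((1 + t * K) ^ 2) * F (push X t x) := by
    intro x hx
    have h1 := hmaps hx
    simp only [F, indicator_of_mem h1]
    rw [fderiv_comp x (hu _ h1) (hpush.differentiable (by simp) x),
      ENNReal.ofReal_pow (by positivity), ← mul_pow]
    gcongr
    rw [← ENNReal.ofReal_coe_nnreal (p := ‖fderiv ℝ u (push X t x)‖₊),
      ← ENNReal.ofReal_mul (by positivity), ← ENNReal.ofReal_coe_nnreal]
    refine ENNReal.ofReal_le_ofReal ?_
    refine (ContinuousLinearMap.opNorm_comp_le _ _).trans ?_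
    rw [mul_comm]
    exact mul_le_mul_of_nonneg_right (hderiv x) (norm_nonneg _)
  calc dirEnergy W (u ∘ push X t)
      ≤ ∫⁻ x in W, ENNReal.ofReal ((1 + t * K) ^ 2) * F (push X t x) :=
        setLIntegral_mono' hW hpt
    _ ≤ ∫⁻ x, ENNReal.ofReal ((1 + t * K) ^ 2) * F (push X t x) := setLIntegral_le_lintegral _ _
    _ = ENNReal.ofReal ((1 + t * K) ^ 2) * ∫⁻ x, F x ∂(Measure.map (push X t) volume) := by
        rw [lintegral_map hF hmeas]
        exact lintegral_const_mul _ (hF.comp hmeas)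
    _ ≤ ENNReal.ofReal ((1 + t * K) ^ 2) *
        ∫⁻ x, F x ∂(ENNReal.ofReal (((1 - t * K)⁻¹) ^ 2) • (volume : Measure E2)) := by
        refine mul_le_mul_right (lintegral_mono' (Measure.le_iff.2 fun S hS => ?_) le_rfl) _
        rw [Measure.map_apply hmeas hS]
        exact h.volume_preimage_push_le ht htK S
    _ = pushFactor K t * dirEnergy W u := by
        rw [lintegral_smul_measure, lintegral_indicator hW, smul_eq_mul, ← mul_assoc]
        rfl

/-- Pushing a function which is smooth on `Ω` gives a function smooth up to the boundary. -/
lemma exists_smooth_push (h : PushField Ω X K) (hΩ : IsOpen Ω) (hb : Bornology.IsBounded Ω) {t : ℝ}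
    (hmaps : MapsTo (push X t) (closure Ω) Ω) {u : E2 → ℝ} (hu : ContDiffOn ℝ ∞ u Ω) :
    ∃ v : E2 → ℝ, ContDiff ℝ ∞ v ∧ ∀ᶠ x in 𝓝ˢ (closure Ω), v x = u (push X t x) :=
  exists_contDiff_eventuallyEq (hΩ.preimage (h.contDiff_push t).continuous)
    hb.isCompact_closure hmaps
    (hu.comp (h.contDiff_push t).contDiffOn (fun _ hx => hx))

end PushField

/-! ### Variational characterization through mean-zero functions -/

/-- The set `Γ` carries finite length and lies in a bounded region. -/
structure FiniteBdry (Γ : Set E2) : Prop where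
  meas : MeasurableSet Γ
  bdd : Bornology.IsBounded Γ
  fin : μH[1] Γ ≠ ⊤

/-- The boundary integral of the square of a function. -/
abbrev bdrySq (Γ : Set E2) (f : E2 → ℝ) : ℝ≥0∞ := bdryInt Γ (fun _ => 1) f

lemma bdrySq_eq (Γ : Set E2) (f : E2 → ℝ) :
    bdrySq Γ f = ∫⁻ x in Γ, ENNReal.ofReal (f x ^ 2) ∂μH[1] := by
  simp [bdrySq, bdryInt]

namespace FiniteBdry

variable {Γ : Set E2}

lemma integrableOn (h : FiniteBdry Γ) {f : E2 → ℝ} (hf : Continuous f) :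
    IntegrableOn f Γ μH[1] := by
  obtain ⟨C, hC⟩ := h.bdd.isCompact_closure.exists_bound_of_continuousOn hf.continuousOn
  exact Measure.integrableOn_of_bounded h.fin hf.aestronglyMeasurable
    (ae_restrict_of_forall_mem h.meas fun x hx => hC x (subset_closure hx))

lemma bdrySq_eq_ofReal (h : FiniteBdry Γ) {f : E2 → ℝ} (hf : Continuous f) :
    bdrySq Γ f = ENNReal.ofReal (∫ x in Γ, f x ^ 2 ∂μH[1]) := by
  have i : IntegrableOn (fun x => f x ^ 2) Γ μH[1] := h.integrableOn (hf.pow 2)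
  rw [bdrySq_eq, ofReal_integral_eq_lintegral_ofReal i (Eventually.of_forall fun x => sq_nonneg _)]

lemma integral_affine_sq (h : FiniteBdry Γ) {f : E2 → ℝ} (hf : Continuous f)
    (h0 : ∫ x in Γ, f x ∂μH[1] = 0) (a b : ℝ) :
    ∫ x in Γ, (a + b * f x) ^ 2 ∂μH[1]
      = a ^ 2 * (μH[1] Γ).toReal + b ^ 2 * ∫ x in Γ, f x ^ 2 ∂μH[1] := by
  have h1 : ∀ x, (a + b * f x) ^ 2 = (a ^ 2 + (2 * a * b) * f x) + b ^ 2 * f x ^ 2 := fun x => by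
    ring
  simp only [h1]
  have i0 : IntegrableOn (fun _ : E2 => a ^ 2) Γ μH[1] := h.integrableOn continuous_const
  have i1 : IntegrableOn (fun x => (2 * a * b) * f x) Γ μH[1] :=
    h.integrableOn (by fun_prop)
  have i2 : IntegrableOn (fun x => b ^ 2 * f x ^ 2) Γ μH[1] := h.integrableOn (by fun_prop)
  have i3 : IntegrableOn (fun x => a ^ 2 + (2 * a * b) * f x) Γ μH[1] :=
    h.integrableOn (by fun_prop)
  rw [integral_add i3 i2, integral_add i0 i1, integral_const_mul, integral_const_mul, h0,
    setIntegral_const, smul_eq_mul, measureReal_def]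
  ring

lemma bdrySq_le_sub_const (h : FiniteBdry Γ) {f : E2 → ℝ} (hf : Continuous f)
    (h0 : ∫ x in Γ, f x ∂μH[1] = 0) (c : ℝ) :
    bdrySq Γ f ≤ bdrySq Γ (fun x => f x - c) := by
  rw [h.bdrySq_eq_ofReal hf, h.bdrySq_eq_ofReal (by fun_prop)]
  apply ENNReal.ofReal_le_ofReal
  have := h.integral_affine_sq hf h0 (-c) 1
  have h1 : ∀ x, (f x - c) ^ 2 = (-c + 1 * f x) ^ 2 := fun x => by ring
  simp only [h1, this]
  have : 0 ≤ (μH[1] Γ).toReal := ENNReal.toReal_nonneg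
  nlinarith [sq_nonneg c]

end FiniteBdry

lemma bdrySq_of_eqOn_zero {Γ : Set E2} (hΓ : MeasurableSet Γ) {f : E2 → ℝ} (hf : EqOn f 0 Γ) :
    bdrySq Γ f = 0 := by
  rw [bdrySq_eq, setLIntegral_congr_fun (g := fun _ => 0) hΓ (fun x hx => by simp [hf hx])]
  simp

lemma dirEnergy_affine (W : Set E2) {f : E2 → ℝ} (hf : Differentiable ℝ f) (a b : ℝ) :
    dirEnergy W (fun x => a + b * f x) = ENNReal.ofReal (b ^ 2) * dirEnergy W f := by
  have h1 : ∀ x, fderiv ℝ (fun x => a + b * f x) x = b • fderiv ℝ f x := fun x => by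
    rw [fderiv_const_add, fderiv_const_mul (hf x)]
  simp only [dirEnergy, h1]
  rw [← lintegral_const_mul' _ _ ENNReal.ofReal_ne_top]
  refine lintegral_congr fun x => ?_
  rw [nnnorm_smul, ENNReal.coe_mul, mul_pow, ← sq_abs, ENNReal.ofReal_pow (abs_nonneg _)]
  congr 2
  rw [← Real.norm_eq_abs, ofReal_norm]; rfl

lemma steklovMixed_mul_le_of_integral_eq_zero {W Γ : Set E2} (hΓ : FiniteBdry Γ)
    (hΓ0 : μH[1] Γ ≠ 0) (hΓW : Γ ⊆ closure W) {f : E2 → ℝ} (hf : ContDiff ℝ ∞ f)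
    (h0 : ∫ x in Γ, f x ∂μH[1] = 0) :
    steklovMixed W Γ ∅ (fun _ => 1) 1 * bdrySq Γ f ≤ dirEnergy W f := by
  rcases eq_or_ne (bdrySq Γ f) 0 with hI | hI
  · simp [hI]
  have hfc := hf.continuous
  have hIr := hΓ.bdrySq_eq_ofReal hfc
  have hItop : bdrySq Γ f ≠ ⊤ := by rw [hIr]; exact ENNReal.ofReal_ne_top
  have hpos : 0 < ∫ x in Γ, f x ^ 2 ∂μH[1] := by
    rw [hIr] at hI; simpa using hI
  have hm : 0 < (μH[1] Γ).toReal := ENNReal.toReal_pos hΓ0 hΓ.fin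
  have haff := hΓ.integral_affine_sq hfc h0
  have hzero : ∀ a b : ℝ, EqOn (fun x => a + b * f x) 0 Γ → a = 0 ∧ b = 0 := by
    intro a b h
    have h1 : ∫ x in Γ, (a + b * f x) ^ 2 ∂μH[1] = 0 := by
      rw [setIntegral_congr_fun (g := fun _ => 0) hΓ.meas (fun x hx => by
        have := h hx; simp only [Pi.zero_apply] at this; simp [this])]
      simp
    rw [haff] at h1
    have h2 : 0 ≤ a ^ 2 * (μH[1] Γ).toReal := by positivity
    have h3 : 0 ≤ b ^ 2 * ∫ x in Γ, f x ^ 2 ∂μH[1] := by positivity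
    have h4 : a ^ 2 * (μH[1] Γ).toReal = 0 := by linarith
    have h5 : b ^ 2 * ∫ x in Γ, f x ^ 2 ∂μH[1] = 0 := by linarith
    exact ⟨by simpa [hm.ne'] using h4, by simpa [hpos.ne'] using h5⟩
  let w : Fin 2 → (E2 → ℝ) := ![1, f]
  have hw : LinearIndependent ℝ w := by
    rw [LinearIndependent.pair_iff]
    intro a b hab
    refine hzero a b fun x _ => ?_
    simpa using congrFun hab x
  have hV : ∀ g ∈ Submodule.span ℝ (range w), ∃ a b : ℝ, g = fun x => a + b * f x := by
    intro g hg
    have : range w = {1, f} := by simp [w, Matrix.range_cons, pair_comm]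
    rw [this, Submodule.mem_span_pair] at hg
    obtain ⟨a, b, rfl⟩ := hg
    exact ⟨a, b, by ext x; simp⟩
  rw [← ENNReal.le_div_iff_mul_le (Or.inl hI) (Or.inl hItop)]
  unfold steklovMixed
  refine iInf_le_of_le (Submodule.span ℝ (range w)) ?_
  refine iInf_le_of_le (by rw [finrank_span_eq_card hw]; simp) ?_
  refine iInf_le_of_le (fun g hg => ?_) ?_
  · obtain ⟨a, b, rfl⟩ := hV g hg
    exact contDiff_const.add (contDiff_const.mul hf)
  refine iInf_le_of_le (fun g hg => by simp) ?_
  refine iInf_le_of_le (fun g hg h => ?_) ?_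
  · obtain ⟨a, b, rfl⟩ := hV g hg
    obtain ⟨rfl, rfl⟩ := hzero a b (h.mono hΓW)
    ext x; simp
  refine iSup₂_le fun g hg => iSup_le fun _ => ?_
  obtain ⟨a, b, rfl⟩ := hV g hg
  rw [rayleigh, dirEnergy_affine W (hf.differentiable (by simp))]
  rcases eq_or_ne b 0 with rfl | hb
  · simp
  have hb2 : ENNReal.ofReal (b ^ 2) ≠ 0 := by
    simpa using hb
  have : ENNReal.ofReal (b ^ 2) * bdrySq Γ f ≤ bdrySq Γ (fun x => a + b * f x) := by
    rw [hIr, hΓ.bdrySq_eq_ofReal (by fun_prop), ← ENNReal.ofReal_mul (sq_nonneg _), haff]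
    apply ENNReal.ofReal_le_ofReal
    nlinarith [mul_nonneg (sq_nonneg a) hm.le]
  calc ENNReal.ofReal (b ^ 2) * dirEnergy W f / bdrySq Γ (fun x => a + b * f x)
      ≤ ENNReal.ofReal (b ^ 2) * dirEnergy W f / (ENNReal.ofReal (b ^ 2) * bdrySq Γ f) := by
        gcongr
    _ = dirEnergy W f / bdrySq Γ f := ENNReal.mul_div_mul_left _ _ hb2 ENNReal.ofReal_ne_top

lemma le_rayleigh {W Γ : Set E2} (hΓ : FiniteBdry Γ) {f : E2 → ℝ} (hf : Continuous f) {b : ℝ≥0∞}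
    (h : b * bdrySq Γ f ≤ dirEnergy W f) (hE : dirEnergy W f ≠ 0) :
    b ≤ rayleigh W Γ (fun _ => 1) f := by
  rw [rayleigh]
  have htop : bdrySq Γ f ≠ ⊤ := by
    rw [hΓ.bdrySq_eq_ofReal hf]; exact ENNReal.ofReal_ne_top
  rwa [ENNReal.le_div_iff_mul_le (Or.inr hE) (Or.inl htop)]

lemma le_steklovMixed_one {W Γ : Set E2} (hΓ : FiniteBdry Γ) (hΓ0 : μH[1] Γ ≠ 0)
    {b : ℝ≥0∞}
    (hb : ∀ f : E2 → ℝ, ContDiff ℝ ∞ f → ∫ x in Γ, f x ∂μH[1] = 0 →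
      b * bdrySq Γ f ≤ dirEnergy W f)
    (hconst : ∀ f : E2 → ℝ, ContDiff ℝ ∞ f → dirEnergy W f = 0 →
      ∃ c, EqOn f (fun _ => c) (closure W))
    (hΓW : Γ ⊆ closure W) :
    b ≤ steklovMixed W Γ ∅ (fun _ => 1) 1 := by
  unfold steklovMixed
  refine le_iInf fun V => le_iInf fun hV => le_iInf fun hs => le_iInf fun _ => le_iInf fun hz => ?_
  let L : V →ₗ[ℝ] ℝ :=
    { toFun := fun f => ∫ x in Γ, (f : E2 → ℝ) x ∂μH[1]
      map_add' := fun f g => by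
        simp only [Submodule.coe_add, Pi.add_apply]
        exact integral_add (hΓ.integrableOn (hs _ f.2).continuous)
          (hΓ.integrableOn (hs _ g.2).continuous)
      map_smul' := fun c f => by
        simp only [Submodule.coe_smul, Pi.smul_apply, smul_eq_mul, RingHom.id_apply]
        exact integral_const_mul _ _ }
  have : FiniteDimensional ℝ V := Module.finite_of_finrank_pos (by omega)
  obtain ⟨⟨f, hfV⟩, hfL, hf0⟩ := (Submodule.ne_bot_iff _).1
    (LinearMap.ker_ne_bot_of_finrank_lt (f := L) (by simp [hV]))
  have hfL' : ∫ x in Γ, f x ∂μH[1] = 0 := hfL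
  have hne : ¬ EqOn f 0 (closure W) := fun h => hf0 (Subtype.ext (hz f hfV h))
  refine le_iSup₂_of_le f hfV (le_iSup_of_le hne ?_)
  refine le_rayleigh hΓ (hs f hfV).continuous (hb f (hs f hfV) hfL') fun hE => hne ?_
  obtain ⟨c, hc⟩ := hconst f (hs f hfV) hE
  have h1 : ∫ x in Γ, f x ∂μH[1] = (μH[1] Γ).toReal * c := by
    rw [setIntegral_congr_fun hΓ.meas (hc.mono hΓW)]
    simp [measureReal_def]
  rw [h1] at hfL'
  have hm : (μH[1] Γ).toReal ≠ 0 := (ENNReal.toReal_pos hΓ0 hΓ.fin).ne'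
  have hc0 : c = 0 := by simpa [hm] using hfL'
  intro x hx
  simpa [hc0] using hc hx

lemma steklovMixed_zero_mul_le {W Γ ΓD : Set E2} (hΓ : FiniteBdry Γ)
    (hΓW : Γ ⊆ closure W) {f : E2 → ℝ} (hf : ContDiff ℝ ∞ f)
    (hfD : ∀ᶠ x in 𝓝ˢ ΓD, f x = 0) :
    steklovMixed W Γ ΓD (fun _ => 1) 0 * bdrySq Γ f ≤ dirEnergy W f := by
  rcases eq_or_ne (bdrySq Γ f) 0 with hI | hI
  · simp [hI]
  have hIr := hΓ.bdrySq_eq_ofReal hf.continuous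
  have hItop : bdrySq Γ f ≠ ⊤ := by rw [hIr]; exact ENNReal.ofReal_ne_top
  have hne : ¬ EqOn f 0 Γ := fun h => hI (bdrySq_of_eqOn_zero hΓ.meas h)
  have hf0 : f ≠ 0 := fun h => hne (fun x _ => by rw [h])
  rw [← ENNReal.le_div_iff_mul_le (Or.inl hI) (Or.inl hItop)]
  unfold steklovMixed
  refine iInf_le_of_le (Submodule.span ℝ {f}) ?_
  refine iInf_le_of_le (by rw [finrank_span_singleton hf0]) ?_
  refine iInf_le_of_le (fun g hg => ?_) ?_
  · obtain ⟨a, rfl⟩ := Submodule.mem_span_singleton.1 hg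
    exact hf.const_smul a
  refine iInf_le_of_le (fun g hg => ?_) ?_
  · obtain ⟨a, rfl⟩ := Submodule.mem_span_singleton.1 hg
    filter_upwards [hfD] with x hx using by simp [hx]
  refine iInf_le_of_le (fun g hg h => ?_) ?_
  · obtain ⟨a, rfl⟩ := Submodule.mem_span_singleton.1 hg
    by_contra hne'
    have ha : a ≠ 0 := fun h => hne' (by simp [h])
    exact hne fun x hx => by simpa [ha] using h (hΓW hx)
  refine iSup₂_le fun g hg => iSup_le fun hg0 => ?_
  obtain ⟨a, rfl⟩ := Submodule.mem_span_singleton.1 hg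
  have ha : a ≠ 0 := fun h => hg0 fun x _ => by simp [h]
  have ha2 : ENNReal.ofReal (a ^ 2) ≠ 0 := by
    simpa using ha
  have e1 : a • f = fun x => 0 + a * f x := by ext x; simp
  rw [rayleigh, e1, dirEnergy_affine W (hf.differentiable (by simp))]
  have : bdrySq Γ (fun x => 0 + a * f x) = ENNReal.ofReal (a ^ 2) * bdrySq Γ f := by
    have hfc := hf.continuous
    rw [hIr, hΓ.bdrySq_eq_ofReal (by fun_prop), ← ENNReal.ofReal_mul (sq_nonneg _)]
    simp only [zero_add, mul_pow]
    rw [integral_const_mul]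
  change _ / bdrySq Γ (fun x => 0 + a * f x) ≤ _
  rw [this, ENNReal.mul_div_mul_left _ _ ha2 ENNReal.ofReal_ne_top]

lemma le_steklovMixed_zero {W Γ ΓD : Set E2} (hΓ : FiniteBdry Γ) {b : ℝ≥0∞}
    (hb : ∀ f : E2 → ℝ, ContDiff ℝ ∞ f → (∀ᶠ x in 𝓝ˢ ΓD, f x = 0) →
      b * bdrySq Γ f ≤ dirEnergy W f)
    (hzero : ∀ f : E2 → ℝ, ContDiff ℝ ∞ f → (∀ᶠ x in 𝓝ˢ ΓD, f x = 0) → dirEnergy W f = 0 →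
      EqOn f 0 (closure W)) :
    b ≤ steklovMixed W Γ ΓD (fun _ => 1) 0 := by
  unfold steklovMixed
  refine le_iInf fun V => le_iInf fun hV => le_iInf fun hs => le_iInf fun hD => le_iInf fun hz => ?_
  have : Nontrivial V := Module.nontrivial_of_finrank_pos (R := ℝ) (by omega)
  obtain ⟨⟨f, hfV⟩, hf0⟩ := exists_ne (0 : V)
  have hne : ¬ EqOn f 0 (closure W) := fun h => hf0 (Subtype.ext (hz f hfV h))
  refine le_iSup₂_of_le f hfV (le_iSup_of_le hne ?_)
  exact le_rayleigh hΓ (hs f hfV).continuous (hb f (hs f hfV) (hD f hfV)) fun hE =>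
    hne (hzero f (hs f hfV) (hD f hfV) hE)

/-! ### Invariance of the energy and of boundary integrals under isometries -/

lemma dirEnergy_comp_isometry (g : E2 ≃ₗᵢ[ℝ] E2) (W : Set E2) (u : E2 → ℝ) :
    dirEnergy (g ⁻¹' W) (u ∘ g) = dirEnergy W u := by
  have h1 : ∀ x, ‖fderiv ℝ (u ∘ g) x‖₊ = ‖fderiv ℝ u (g x)‖₊ := by
    intro x
    have := g.toContinuousLinearEquiv.comp_right_fderiv (f := u) (x := x)
    have h2 : fderiv ℝ (u ∘ g) x =
        (fderiv ℝ u (g x)).comp (g.toContinuousLinearEquiv : E2 →L[ℝ] E2) :=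
      this
    rw [h2]
    exact NNReal.eq ((fderiv ℝ u (g x)).opNorm_comp_linearIsometryEquiv g)
  simp only [dirEnergy, h1]
  exact g.measurePreserving.setLIntegral_comp_preimage_emb
    g.toHomeomorph.measurableEmbedding (fun y => (‖fderiv ℝ u y‖₊ : ℝ≥0∞) ^ 2) W

lemma LinearIsometryEquiv.preimage_eq_of_image_eq {S : Set E2} (g : E2 ≃ₗᵢ[ℝ] E2)
    (hg : g '' S = S) : g ⁻¹' S = S := by
  ext x; exact g.mem_iff_of_image_eq hg

lemma LinearIsometryEquiv.image_frontier_eq {Ω : Set E2} (g : E2 ≃ₗᵢ[ℝ] E2) (hg : g '' Ω = Ω) :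
    g '' frontier Ω = frontier Ω := by
  conv_rhs => rw [← hg]
  exact g.toHomeomorph.image_frontier Ω

lemma setLIntegral_hausdorff_comp_isometry (g : E2 ≃ₗᵢ[ℝ] E2) (S : Set E2) (F : E2 → ℝ≥0∞) :
    ∫⁻ x in g ⁻¹' S, F (g x) ∂μH[1] = ∫⁻ x in S, F x ∂μH[1] :=
  (g.toIsometryEquiv.measurePreserving_hausdorffMeasure 1).setLIntegral_comp_preimage_emb
    g.toHomeomorph.measurableEmbedding F S

lemma setIntegral_hausdorff_comp_isometry (g : E2 ≃ₗᵢ[ℝ] E2) (S : Set E2) (F : E2 → ℝ) :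
    ∫ x in g ⁻¹' S, F (g x) ∂μH[1] = ∫ x in S, F x ∂μH[1] :=
  (g.toIsometryEquiv.measurePreserving_hausdorffMeasure 1).setIntegral_preimage_emb
    g.toHomeomorph.measurableEmbedding F S

/-! ### The length of the boundary -/

/-- Inside a chart the boundary of a Lipschitz domain is contained in the graph. -/
lemma eq_of_mem_frontier_of_chart {Ω : Set E2} (hΩ : IsOpen Ω) {e : E2 ≃ₗᵢ[ℝ] E2} {K : ℝ≥0}
    {φ : ℝ → ℝ} {U : Set E2} (hφ : LipschitzWith K φ) (hU : IsOpen U)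
    (hiff : ∀ x ∈ U, (x ∈ Ω ↔ φ (e x 0) < e x 1)) {y : E2} (hy : y ∈ frontier Ω) (hyU : y ∈ U) :
    e y 1 = φ (e y 0) := by
  rw [hΩ.frontier_eq] at hy
  have h2 : ¬ φ (e y 0) < e y 1 := fun h => hy.2 ((hiff y hyU).2 h)
  have hcl : IsClosed {z : E2 | φ (e z 0) ≤ e z 1} := by
    refine isClosed_le (hφ.continuous.comp ?_) ?_ <;> fun_prop
  have h3 : φ (e y 0) ≤ e y 1 :=
    closure_minimal (fun z hz => ((hiff z hz.2).1 hz.1).le) hcl (hU.closure_inter ⟨hy.1, hyU⟩)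
  exact le_antisymm (not_lt.1 h2) h3

lemma E2.dist_le (x y : E2) : dist x y ≤ |x 0 - y 0| + |x 1 - y 1| := by
  rw [dist_eq_norm, ← abs_of_nonneg (norm_nonneg (x - y)),
    ← abs_of_nonneg (add_nonneg (abs_nonneg (x 0 - y 0)) (abs_nonneg (x 1 - y 1))),
    ← sq_le_sq, E2.norm_sq]
  simp only [PiLp.sub_apply]
  nlinarith [abs_nonneg (x 0 - y 0), abs_nonneg (x 1 - y 1), sq_abs (x 0 - y 0),
    sq_abs (x 1 - y 1)]

lemma E2.abs_apply_sub_le (x y : E2) (i : Fin 2) : |x i - y i| ≤ dist x y := by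
  rw [dist_eq_norm]
  exact PiLp.norm_apply_le (x - y) i

lemma hausdorff_frontier_lt_top {Ω : Set E2} (hΩ : IsLipschitzDomain Ω) :
    μH[1] (frontier Ω) < ⊤ := by
  have hcomp : IsCompact (frontier Ω) :=
    hΩ.2.2.1.isCompact_closure.of_isClosed_subset isClosed_frontier frontier_subset_closure
  refine hcomp.measure_lt_top_of_nhdsWithin fun x hx => ?_
  obtain ⟨e, K, φ, U, hφ, hU, hxU, hiff⟩ := hΩ.2.2.2 x hx
  let γ : ℝ → E2 := fun s => e.symm !₂[s, φ s]
  have hγ : LipschitzWith (1 + K) γ := by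
    refine LipschitzWith.of_dist_le_mul fun s t => ?_
    simp only [γ, e.symm.dist_map]
    refine (E2.dist_le _ _).trans ?_
    have := hφ.dist_le_mul s t
    simp only [Real.dist_eq] at this ⊢
    simp
    linarith
  refine ⟨frontier Ω ∩ (U ∩ ball x 1), inter_mem_nhdsWithin _
    ((hU.inter isOpen_ball).mem_nhds ⟨hxU, mem_ball_self one_pos⟩), ?_⟩
  have hsub : frontier Ω ∩ (U ∩ ball x 1) ⊆ γ '' Icc (e x 0 - 1) (e x 0 + 1) := by
    rintro y ⟨hy, hyU, hyx⟩
    refine ⟨e y 0, ?_, ?_⟩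
    · have h1 := E2.abs_apply_sub_le (e y) (e x) 0
      rw [e.dist_map] at h1
      have h2 := abs_le.1 (h1.trans (mem_ball.1 hyx).le)
      constructor <;> linarith [h2.1, h2.2]
    · simp only [γ]
      rw [← eq_of_mem_frontier_of_chart hΩ.1 hφ hU hiff hy hyU, e.symm_apply_eq]
      apply E2.ext' <;> simp
  refine (measure_mono hsub).trans_lt ?_
  refine (hγ.hausdorffMeasure_image_le zero_le_one _).trans_lt ?_
  rw [hausdorffMeasure_real, Real.volume_Icc]
  exact ENNReal.mul_lt_top (by simp) ENNReal.ofReal_lt_top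

lemma IsPreconnected.exists_mem_frontier {C Ω : Set E2} (hC : IsPreconnected C)
    (h1 : (C ∩ Ω).Nonempty) (h2 : (C ∩ Ωᶜ).Nonempty) : (C ∩ frontier Ω).Nonempty := by
  by_contra h
  rw [not_nonempty_iff_eq_empty] at h
  have hf : ∀ x ∈ C, x ∉ frontier Ω := fun x hx hx' => by
    have : x ∈ C ∩ frontier Ω := ⟨hx, hx'⟩
    rw [h] at this; exact this
  have hcov : C ⊆ interior Ω ∪ (closure Ω)ᶜ := by
    intro x hx
    by_cases hxc : x ∈ closure Ω
    · exact Or.inl (by_contra fun h' => hf x hx ⟨hxc, h'⟩)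
    · exact Or.inr hxc
  obtain ⟨a, haC, haΩ⟩ := h1
  obtain ⟨b, hbC, hbΩ⟩ := h2
  have ha : a ∈ interior Ω := by
    rcases hcov haC with h | h
    · exact h
    · exact absurd (subset_closure haΩ) h
  have hb : b ∈ (closure Ω)ᶜ := by
    rcases hcov hbC with h | h
    · exact absurd (interior_subset h) hbΩ
    · exact h
  obtain ⟨x, _, hx1, hx2⟩ := hC _ _ isOpen_interior isClosed_closure.isOpen_compl hcov
    ⟨a, haC, ha⟩ ⟨b, hbC, hb⟩
  exact hx2 (subset_closure (interior_subset hx1))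

lemma hausdorff_upper_frontier_ne_zero {Ω : Set E2} (hΩ : IsOpen Ω) (hb : Bornology.IsBounded Ω)
    (h0 : (0 : E2) ∈ Ω) : μH[1] (frontier Ω ∩ {x : E2 | 0 < x 1}) ≠ 0 := by
  obtain ⟨r, hr, hball⟩ := Metric.isOpen_iff.1 hΩ 0 h0
  have hsub : Ioo (-r) r ⊆ (fun x : E2 => x 0) '' (frontier Ω ∩ {x : E2 | 0 < x 1}) := by
    intro a ha
    have hγ : Continuous (fun s : ℝ => (!₂[a, s] : E2)) := by fun_prop
    have hC : IsPreconnected ((fun s : ℝ => (!₂[a, s] : E2)) '' Ici 0) :=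
      isPreconnected_Ici.image _ hγ.continuousOn
    have ha0 : (!₂[a, 0] : E2) ∈ Ω := by
      apply hball
      rw [mem_ball]
      refine (E2.dist_le _ _).trans_lt ?_
      simpa [abs_lt] using ha
    obtain ⟨R, hR⟩ := hb.subset_ball (0 : E2)
    obtain ⟨y, ⟨s, hs, rfl⟩, hy⟩ := hC.exists_mem_frontier (Ω := Ω)
      ⟨_, ⟨0, self_mem_Ici, rfl⟩, ha0⟩
      ⟨_, ⟨max R 0, mem_Ici.2 (le_max_right _ _), rfl⟩, fun h => by
        have h1 := E2.abs_apply_sub_le (!₂[a, max R 0] : E2) 0 1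
        have h2 := mem_ball.1 (hR h)
        simp only [dist_zero_right] at h1 h2
        simp at h1
        have := le_abs_self (max R 0)
        have := le_max_left R 0
        linarith⟩
    refine ⟨_, ⟨hy, ?_⟩, by simp⟩
    have : s ≠ 0 := by
      rintro rfl
      rw [hΩ.frontier_eq] at hy
      exact hy.2 ha0
    simpa using lt_of_le_of_ne hs this.symm
  intro hzero
  have hlip : LipschitzWith 1 (fun x : E2 => x 0) :=
    LipschitzWith.of_dist_le_mul fun x y => by
      simpa [Real.dist_eq] using E2.abs_apply_sub_le x y 0
  have h1 := hlip.hausdorffMeasure_image_le zero_le_one (frontier Ω ∩ {x : E2 | 0 < x 1})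
  rw [hzero, mul_zero, hausdorffMeasure_real] at h1
  have h2 := (measure_mono hsub).trans h1
  rw [Real.volume_Ioo] at h2
  simp at h2
  linarith

lemma hausdorff_frontier_axis {Ω : Set E2} (hΩ : IsLipschitzDomain Ω)
    (hrefl : tauE '' Ω = Ω) : μH[1] (frontier Ω ∩ {x : E2 | x 1 = 0}) = 0 := by
  refine measure_null_of_locally_null _ fun p hp => ⟨{p}, ?_, ?_⟩
  swap
  · have := Measure.nullSingletonClass_hausdorff E2 zero_lt_one
    exact measure_singleton p
  obtain ⟨v, hv⟩ := exists_inDir hΩ p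
  have hτp : tauE p = p := by
    apply E2.ext'
    · simp
    · have : p 1 = 0 := hp.2
      simp [this]
  have hv2 : InDir Ω p (tauE v) := by
    have h := InDir.map (x := p) (v := v) tauE hrefl (by rwa [hτp])
    simpa using h
  have hh := hv.add hv2
  have hne := hh.ne_zero hΩ.1 hp.1
  obtain ⟨δ, hδ, hd⟩ := hh
  set h : E2 := v + tauE v with hdef
  have hh1 : h 1 = 0 := by simp [hdef]
  have hh0 : h 0 ≠ 0 := fun h' => hne (E2.ext' (by simpa using h') (by simpa using hh1))
  rw [mem_nhdsWithin]
  have hc : 0 < |h 0| := abs_pos.2 hh0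
  refine ⟨ball p (min δ (δ * |h 0|)), isOpen_ball, mem_ball_self (by positivity), ?_⟩
  rintro q ⟨hq, hqf, hq1⟩
  simp only [mem_ball, lt_min_iff] at hq
  set s : ℝ := (q 0 - p 0) / h 0 with hs
  have hqp : q = p + s • h := by
    apply E2.ext'
    · simp [hs, div_mul_cancel₀ _ hh0]
    · have h1 : p 1 = 0 := hp.2
      have h2 : q 1 = 0 := hq1
      simp [hh1, h1, h2]
  have hsδ : |s| < δ := by
    rw [hs, abs_div, div_lt_iff₀ hc]
    exact (E2.abs_apply_sub_le q p 0).trans_lt hq.2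
  rcases lt_trichotomy s 0 with h1 | h1 | h1
  · exfalso
    have := hd q (frontier_subset_closure hqf) hq.1 h (by simpa using hδ) (-s) (by linarith)
      (by rwa [abs_of_neg h1] at hsδ)
    have h2 : q + (-s) • h = p := by rw [hqp]; module
    rw [h2] at this
    have hpf := hp.1
    rw [hΩ.1.frontier_eq] at hpf
    exact hpf.2 this
  · rw [hqp, h1]; simp
  · exfalso
    have := hd p (frontier_subset_closure hp.1) (by simpa using hδ) h (by simpa using hδ) s h1
      (by rwa [abs_of_pos h1] at hsδ)
    rw [← hqp] at this
    rw [hΩ.1.frontier_eq] at hqf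
    exact hqf.2 this

/-! ### Functions with vanishing energy -/

lemma fderiv_eq_zero_of_dirEnergy_eq_zero {W : Set E2} (hW : IsOpen W) {f : E2 → ℝ}
    (hf : ContDiff ℝ ∞ f) (h0 : dirEnergy W f = 0) : ∀ x ∈ closure W, fderiv ℝ f x = 0 := by
  have hc : Continuous (fderiv ℝ f) := hf.continuous_fderiv (by simp)
  have h1 : (fun x => (‖fderiv ℝ f x‖₊ : ℝ≥0∞) ^ 2) =ᵐ[volume.restrict W] 0 :=
    (lintegral_eq_zero_iff (by fun_prop)).1 h0
  have h2 := MeasureTheory.Measure.eqOn_open_of_ae_eq (U := W) h1 hW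
    (by fun_prop) continuousOn_const
  have h3 : EqOn (fderiv ℝ f) 0 W := fun x hx => by simpa using h2 hx
  exact fun x hx => h3.closure hc continuous_zero hx

lemma exists_eqOn_const_of_dirEnergy {W : Set E2} (hW : IsOpen W) (hWc : IsPreconnected W)
    {f : E2 → ℝ} (hf : ContDiff ℝ ∞ f) (h0 : dirEnergy W f = 0) :
    ∃ c, EqOn f (fun _ => c) (closure W) := by
  have h1 := fderiv_eq_zero_of_dirEnergy_eq_zero hW hf h0
  obtain ⟨c, hc⟩ := hW.exists_is_const_of_fderiv_eq_zero hWc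
    (hf.differentiable (by simp)).differentiableOn (fun x hx => h1 x (subset_closure hx))
  exact ⟨c, (show EqOn f (fun _ => c) W from hc).closure hf.continuous continuous_const⟩

lemma mem_closure_upper {Ω : Set E2} (hΩ : IsOpen Ω) {x : E2} (hx : x ∈ Ω) (hx1 : 0 ≤ x 1) :
    x ∈ closure (Ω ∩ {x : E2 | 0 < x 1}) := by
  have h1 : x ∈ closure {x : E2 | 0 < x 1} := by
    have ht : Tendsto (fun s : ℝ => x + s • EuclideanSpace.single (1 : Fin 2) (1 : ℝ))
        (𝓝[>] 0) (𝓝 x) := by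
      have : Continuous (fun s : ℝ => x + s • EuclideanSpace.single (1 : Fin 2) (1 : ℝ)) := by
        fun_prop
      have := this.tendsto 0
      simp only [zero_smul, add_zero] at this
      exact this.mono_left nhdsWithin_le_nhds
    refine mem_closure_of_tendsto ht ?_
    filter_upwards [self_mem_nhdsWithin] with s hs
    have : 0 < s := hs
    simp; linarith
  exact hΩ.inter_closure ⟨hx, h1⟩

/-- Reflecting the lower half plane onto the upper half plane. -/
def foldUp (x : E2) : E2 := !₂[x 0, |x 1|]

lemma exists_eqOn_const_upper {Ω : Set E2} (hΩ : IsOpen Ω) (hΩc : IsPreconnected Ω)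
    (hrefl : tauE '' Ω = Ω) {f : E2 → ℝ} (hf : ContDiff ℝ ∞ f)
    (h0 : dirEnergy (Ω ∩ {x : E2 | 0 < x 1}) f = 0) :
    ∃ c, EqOn f (fun _ => c) (closure (Ω ∩ {x : E2 | 0 < x 1})) := by
  have hopen : IsOpen (Ω ∩ {x : E2 | 0 < x 1}) :=
    hΩ.inter (isOpen_lt continuous_const (by fun_prop))
  have h1 := fderiv_eq_zero_of_dirEnergy_eq_zero hopen hf h0
  have hfold : Continuous foldUp := by unfold foldUp; fun_prop
  have hfoldΩ : ∀ x ∈ Ω, foldUp x ∈ Ω := by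
    intro x hx
    rcases le_total 0 (x 1) with h | h
    · have : foldUp x = x := by apply E2.ext' <;> simp [foldUp, abs_of_nonneg h]
      rwa [this]
    · have : foldUp x = tauE x := by apply E2.ext' <;> simp [foldUp, abs_of_nonpos h]
      rwa [this, tauE.mem_iff_of_image_eq hrefl]
  have hloc : ∀ p ∈ Ω, (fun x => f (foldUp x)) =ᶠ[𝓝 p] fun _ => f (foldUp p) := by
    intro p hp
    obtain ⟨r, hr, hball⟩ := Metric.isOpen_iff.1 hΩ _ (hfoldΩ p hp)
    have hconv : Convex ℝ (ball (foldUp p) r ∩ {x : E2 | 0 ≤ x 1}) := by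
      refine (convex_ball _ _).inter ?_
      intro x hx y hy a b ha hb _
      have hx' : 0 ≤ x 1 := hx
      have hy' : 0 ≤ y 1 := hy
      have : 0 ≤ a * x 1 + b * y 1 := by positivity
      simpa using this
    have hS : ∀ x ∈ ball (foldUp p) r ∩ {x : E2 | 0 ≤ x 1}, fderiv ℝ f x = 0 := fun x hx =>
      h1 x (mem_closure_upper hΩ (hball hx.1) hx.2)
    have hpos : ∀ x, foldUp x ∈ {x : E2 | 0 ≤ x 1} := fun x => by simp [foldUp]
    filter_upwards [hfold.continuousAt.preimage_mem_nhds (ball_mem_nhds (foldUp p) hr)] with x hx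
    have := hconv.norm_image_sub_le_of_norm_fderiv_le (f := f) (C := 0) (𝕜 := ℝ)
      (fun x _ => hf.differentiable (by simp) x) (fun x hx => by rw [hS x hx]; simp)
      (x := foldUp p) (y := foldUp x) (mem_inter (mem_ball_self hr) (hpos p))
      (mem_inter hx (hpos x))
    rw [zero_mul] at this
    exact sub_eq_zero.1 (norm_le_zero_iff.1 this)
  obtain ⟨c, hc⟩ := hΩ.exists_is_const_of_fderiv_eq_zero (𝕜 := ℝ) (f := fun x => f (foldUp x)) hΩc
    (fun p hp => ((differentiableAt_const _).congr_of_eventuallyEq (hloc p hp)).differentiableWithinAt)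
    (fun p hp => by rw [(hloc p hp).fderiv_eq]; simp)
  refine ⟨c, EqOn.closure (fun x hx => ?_) hf.continuous continuous_const⟩
  have hx1 : 0 < x 1 := hx.2
  have : foldUp x = x := by apply E2.ext' <;> simp [foldUp, abs_of_pos hx1]
  rw [← hc x hx.1, this]

/-! ### Domains with the symmetries of the square -/

/-- The part of a set in the open upper half plane. -/
abbrev upper (S : Set E2) : Set E2 := S ∩ {x : E2 | 0 < x 1}

/-- A Lipschitz domain containing the origin with the symmetries of the square. -/
structure SymDomain (Ω : Set E2) : Prop where
  lip : IsLipschitzDomain Ω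
  zero_mem : (0 : E2) ∈ Ω
  rot : rotE '' Ω = Ω
  refl : tauE '' Ω = Ω

lemma measurableSet_upperHalf : MeasurableSet {x : E2 | 0 < x 1} :=
  (isOpen_lt continuous_const (by fun_prop)).measurableSet

lemma lintegral_split_tau {μ : Measure E2} {S : Set E2} (hS : MeasurableSet S)
    (hτ : tauE ⁻¹' S = S)
    (hμ : ∀ (T : Set E2) (F : E2 → ℝ≥0∞), ∫⁻ x in tauE ⁻¹' T, F (tauE x) ∂μ = ∫⁻ x in T, F x ∂μ)
    (h0 : μ (S ∩ {x : E2 | x 1 = 0}) = 0) (F : E2 → ℝ≥0∞) :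
    ∫⁻ x in S, F x ∂μ = ∫⁻ x in upper S, F x ∂μ + ∫⁻ x in upper S, F (tauE x) ∂μ := by
  have hneg : MeasurableSet {x : E2 | x 1 < 0} :=
    (isOpen_lt (by fun_prop) continuous_const).measurableSet
  have e1 : (S : Set E2) = (upper S ∪ S ∩ {x : E2 | x 1 < 0}) ∪ S ∩ {x : E2 | x 1 = 0} := by
    ext x
    simp only [mem_union, mem_inter_iff, mem_ofPred_eq]
    rcases lt_trichotomy (x 1) 0 with h | h | h <;> grind
  have e2 : ∫⁻ x in S, F x ∂μ = ∫⁻ x in upper S ∪ S ∩ {x : E2 | x 1 < 0}, F x ∂μ := by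
    refine setLIntegral_congr ?_
    conv_lhs => rw [e1]
    exact union_ae_eq_left_of_ae_eq_empty (ae_eq_empty.2 h0)
  have e3 : tauE ⁻¹' (S ∩ {x : E2 | x 1 < 0}) = upper S := by
    rw [preimage_inter, hτ]; ext x; simp
  rw [e2, lintegral_union (hS.inter hneg), ← hμ (S ∩ {x : E2 | x 1 < 0}), e3]
  rw [Set.disjoint_left]
  intro x h h'
  have h1 : 0 < x 1 := h.2
  have h2 : x 1 < 0 := h'.2
  exact lt_asymm h1 h2

lemma volume_axis : volume {x : E2 | x 1 = 0} = 0 := by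
  have h1 : {x : E2 | x 1 = 0} =
      (LinearMap.ker (EuclideanSpace.proj (𝕜 := ℝ) (1 : Fin 2)).toLinearMap : Set E2) := by
    ext x; simp
  rw [h1]
  refine Measure.addHaar_submodule _ _ fun h => ?_
  have : (EuclideanSpace.single (1 : Fin 2) (1 : ℝ) : E2) ∈
      LinearMap.ker (EuclideanSpace.proj (𝕜 := ℝ) (1 : Fin 2)).toLinearMap := by
    rw [h]; trivial
  simp at this

namespace SymDomain
variable {Ω : Set E2}

lemma isOpen (h : SymDomain Ω) : IsOpen Ω := h.lip.1
lemma isConnected (h : SymDomain Ω) : IsConnected Ω := h.lip.2.1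
lemma bdd (h : SymDomain Ω) : Bornology.IsBounded Ω := h.lip.2.2.1

lemma isOpen_upper (h : SymDomain Ω) : IsOpen (upper Ω) :=
  h.isOpen.inter (isOpen_lt continuous_const (by fun_prop))

lemma tau_mem (h : SymDomain Ω) {x : E2} : tauE x ∈ Ω ↔ x ∈ Ω := tauE.mem_iff_of_image_eq h.refl
lemma rot_mem (h : SymDomain Ω) {x : E2} : rotE x ∈ Ω ↔ x ∈ Ω := rotE.mem_iff_of_image_eq h.rot
lemma neg_mem (h : SymDomain Ω) {x : E2} : -x ∈ Ω ↔ x ∈ Ω := by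
  rw [← rotE_rotE, h.rot_mem, h.rot_mem]

lemma tau_frontier (h : SymDomain Ω) : tauE ⁻¹' frontier Ω = frontier Ω :=
  tauE.preimage_eq_of_image_eq (tauE.image_frontier_eq h.refl)
lemma rot_frontier (h : SymDomain Ω) : rotE ⁻¹' frontier Ω = frontier Ω :=
  rotE.preimage_eq_of_image_eq (rotE.image_frontier_eq h.rot)

lemma finiteBdry (h : SymDomain Ω) : FiniteBdry (frontier Ω) where
  meas := isClosed_frontier.measurableSet
  bdd := h.bdd.closure.subset frontier_subset_closure
  fin := (hausdorff_frontier_lt_top h.lip).ne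

lemma finiteBdry_upper (h : SymDomain Ω) : FiniteBdry (upper (frontier Ω)) where
  meas := h.finiteBdry.meas.inter measurableSet_upperHalf
  bdd := h.finiteBdry.bdd.subset inter_subset_left
  fin := ((measure_mono inter_subset_left).trans_lt (hausdorff_frontier_lt_top h.lip)).ne

lemma hausdorff_upper_ne_zero (h : SymDomain Ω) : μH[1] (upper (frontier Ω)) ≠ 0 :=
  hausdorff_upper_frontier_ne_zero h.isOpen h.bdd h.zero_mem

lemma hausdorff_ne_zero (h : SymDomain Ω) : μH[1] (frontier Ω) ≠ 0 := fun h0 =>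
  h.hausdorff_upper_ne_zero (measure_mono_null inter_subset_left h0)

lemma upper_subset_closure : upper (frontier Ω) ⊆ closure (upper Ω) := fun x hx =>
  IsOpen.closure_inter (s := Ω) (t := {x : E2 | 0 < x 1})
    (isOpen_lt continuous_const (by fun_prop)) ⟨frontier_subset_closure hx.1, hx.2⟩

lemma lintegral_frontier_split (h : SymDomain Ω) (F : E2 → ℝ≥0∞) :
    ∫⁻ x in frontier Ω, F x ∂μH[1] =
      ∫⁻ x in upper (frontier Ω), F x ∂μH[1] + ∫⁻ x in upper (frontier Ω), F (tauE x) ∂μH[1] :=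
  lintegral_split_tau h.finiteBdry.meas h.tau_frontier
    (fun T F => setLIntegral_hausdorff_comp_isometry tauE T F)
    (hausdorff_frontier_axis h.lip h.refl) F

lemma bdrySq_split (h : SymDomain Ω) (f : E2 → ℝ) :
    bdrySq (frontier Ω) f =
      bdrySq (upper (frontier Ω)) f + bdrySq (upper (frontier Ω)) (f ∘ tauE) := by
  simp only [bdrySq_eq]
  exact h.lintegral_frontier_split _

lemma hausdorff_frontier_eq (h : SymDomain Ω) :
    μH[1] (frontier Ω) = 2 * μH[1] (upper (frontier Ω)) := by
  have := h.lintegral_frontier_split 1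
  simpa [two_mul] using this

lemma dirEnergy_split (h : SymDomain Ω) (u : E2 → ℝ) :
    dirEnergy Ω u = dirEnergy (upper Ω) u + dirEnergy (upper Ω) (u ∘ tauE) := by
  have hτ : tauE ⁻¹' Ω = Ω := tauE.preimage_eq_of_image_eq h.refl
  have h1 := lintegral_split_tau (μ := volume) h.isOpen.measurableSet hτ
    (fun T F => tauE.measurePreserving.setLIntegral_comp_preimage_emb
      tauE.toHomeomorph.measurableEmbedding F T)
    (measure_mono_null inter_subset_right volume_axis) (fun x => (‖fderiv ℝ u x‖₊ : ℝ≥0∞) ^ 2)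
  have h2 : ∀ x, ‖fderiv ℝ (u ∘ tauE) x‖₊ = ‖fderiv ℝ u (tauE x)‖₊ := by
    intro x
    have h2 : fderiv ℝ (u ∘ tauE) x = (fderiv ℝ u (tauE x)).comp
        (tauE.toContinuousLinearEquiv : E2 →L[ℝ] E2) :=
      tauE.toContinuousLinearEquiv.comp_right_fderiv (f := u) (x := x)
    rw [h2]
    exact NNReal.eq ((fderiv ℝ u (tauE x)).opNorm_comp_linearIsometryEquiv tauE)
  simpa only [dirEnergy, h2] using h1

lemma dirEnergy_comp_tau (h : SymDomain Ω) (u : E2 → ℝ) :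
    dirEnergy Ω (u ∘ tauE) = dirEnergy Ω u := by
  have := dirEnergy_comp_isometry tauE Ω u
  rwa [tauE.preimage_eq_of_image_eq h.refl] at this

lemma dirEnergy_comp_rot (h : SymDomain Ω) (u : E2 → ℝ) :
    dirEnergy Ω (u ∘ rotE) = dirEnergy Ω u := by
  have := dirEnergy_comp_isometry rotE Ω u
  rwa [rotE.preimage_eq_of_image_eq h.rot] at this

lemma bdrySq_comp_tau (h : SymDomain Ω) (u : E2 → ℝ) :
    bdrySq (frontier Ω) (u ∘ tauE) = bdrySq (frontier Ω) u := by
  simp only [bdrySq_eq]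
  have := setLIntegral_hausdorff_comp_isometry tauE (frontier Ω) (fun x => ENNReal.ofReal (u x ^ 2))
  rwa [h.tau_frontier] at this

lemma bdrySq_comp_rot (h : SymDomain Ω) (u : E2 → ℝ) :
    bdrySq (frontier Ω) (u ∘ rotE) = bdrySq (frontier Ω) u := by
  simp only [bdrySq_eq]
  have := setLIntegral_hausdorff_comp_isometry rotE (frontier Ω) (fun x => ENNReal.ofReal (u x ^ 2))
  rwa [h.rot_frontier] at this

lemma integral_eq_zero_of_odd (h : SymDomain Ω) {u : E2 → ℝ}
    (hu : ∀ x ∈ frontier Ω, u (-x) = - u x) : ∫ x in frontier Ω, u x ∂μH[1] = 0 := by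
  have h1 : ∀ f : E2 → ℝ, ∫ x in frontier Ω, f (rotE x) ∂μH[1] = ∫ x in frontier Ω, f x ∂μH[1] := by
    intro f
    have := setIntegral_hausdorff_comp_isometry rotE (frontier Ω) f
    rwa [h.rot_frontier] at this
  have h2 : ∫ x in frontier Ω, u (-x) ∂μH[1] = ∫ x in frontier Ω, u x ∂μH[1] := by
    simp only [← rotE_rotE]
    rw [h1 (fun x => u (rotE x)), h1]
  rw [setIntegral_congr_fun h.finiteBdry.meas hu, integral_neg] at h2
  linarith

/-- A function that is odd with respect to the vertical axis has mean zero on the upper part of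
the boundary. -/
lemma integral_upper_eq_zero_of_odd (h : SymDomain Ω) {u : E2 → ℝ}
    (hu : ∀ x ∈ upper (frontier Ω), u (-tauE x) = - u x) :
    ∫ x in upper (frontier Ω), u x ∂μH[1] = 0 := by
  let g : E2 ≃ₗᵢ[ℝ] E2 := tauE.trans (LinearIsometryEquiv.neg ℝ)
  have hg : ∀ x, g x = - tauE x := fun x => rfl
  have hg' : g ⁻¹' upper (frontier Ω) = upper (frontier Ω) := by
    ext x
    have h1 : -tauE x ∈ frontier Ω ↔ x ∈ frontier Ω := by
      rw [← rotE_rotE]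
      have h2 : ∀ y, rotE y ∈ frontier Ω ↔ y ∈ frontier Ω := fun y => by
        conv_rhs => rw [← h.rot_frontier]
        rfl
      have h3 : ∀ y, tauE y ∈ frontier Ω ↔ y ∈ frontier Ω := fun y => by
        conv_rhs => rw [← h.tau_frontier]
        rfl
      rw [h2, h2, h3]
    simp only [mem_preimage, hg, mem_inter_iff, h1, mem_ofPred_eq]
    simp
  have h2 := setIntegral_hausdorff_comp_isometry g (upper (frontier Ω)) u
  rw [hg'] at h2
  simp only [hg] at h2
  rw [setIntegral_congr_fun h.finiteBdry_upper.meas hu, integral_neg] at h2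
  linarith

/-- Composition with the push-in map turns functions that are smooth in the domain into
functions that are smooth up to the boundary. -/
lemma exists_push_of_mapsTo (h : SymDomain Ω) {X : E2 → E2} {K : ℝ≥0} (hX : PushField Ω X K)
    {u : E2 → ℝ} (hu : ContDiffOn ℝ ∞ u Ω) {t : ℝ} (hmaps : MapsTo (push X t) (closure Ω) Ω)
    (ht : 0 < t ∧ t * K < 1) :
    ∃ v : E2 → ℝ, ContDiff ℝ ∞ v ∧
      (∀ᶠ x in 𝓝ˢ (closure Ω), v x = u (push X t x)) ∧
      dirEnergy Ω v ≤ pushFactor K t * dirEnergy Ω u ∧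
      dirEnergy (upper Ω) v ≤ pushFactor K t * dirEnergy (upper Ω) u := by
  obtain ⟨v, hv, hvu⟩ := hX.exists_smooth_push h.isOpen h.bdd hmaps hu
  have hd : ∀ x ∈ Ω, DifferentiableAt ℝ u x := fun x hx =>
    ((hu x hx).contDiffAt (h.isOpen.mem_nhds hx)).differentiableAt (by simp)
  have hloc : ∀ x ∈ closure Ω, v =ᶠ[𝓝 x] (u ∘ push X t) := fun x hx =>
    hvu.filter_mono (nhds_le_nhdsSet hx)
  refine ⟨v, hv, hvu, ?_, ?_⟩
  · rw [dirEnergy_congr h.isOpen.measurableSet fun x hx => hloc x (subset_closure hx)]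
    exact hX.dirEnergy_comp_push_le ht.1 ht.2 h.isOpen.measurableSet
      (fun x hx => hmaps (subset_closure hx)) hd
  · rw [dirEnergy_congr h.isOpen_upper.measurableSet fun x hx => hloc x (subset_closure hx.1)]
    exact hX.dirEnergy_comp_push_le ht.1 ht.2 h.isOpen_upper.measurableSet
      (fun x hx => ⟨hmaps (subset_closure hx.1), hX.push_one_pos ht.1 ht.2 hx.2⟩)
      (fun x hx => hd x hx.1)

lemma exists_push (h : SymDomain Ω) {X : E2 → E2} {K : ℝ≥0} (hX : PushField Ω X K)
    {u : E2 → ℝ} (hu : ContDiffOn ℝ ∞ u Ω) :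
    ∀ᶠ t in 𝓝[>] (0 : ℝ), ∃ v : E2 → ℝ, ContDiff ℝ ∞ v ∧
      (∀ᶠ x in 𝓝ˢ (closure Ω), v x = u (push X t x)) ∧
      dirEnergy Ω v ≤ pushFactor K t * dirEnergy Ω u ∧
      dirEnergy (upper Ω) v ≤ pushFactor K t * dirEnergy (upper Ω) u := by
  filter_upwards [hX.eventually_mapsTo h.bdd, eventually_mul_lt_one K] with t hmaps ht
  exact h.exists_push_of_mapsTo hX hu hmaps ht

/-- Passing to the limit in an inequality for functions composed with the push-in map. -/
lemma mul_bdrySq_le_of_push (h : SymDomain Ω) {X : E2 → E2} {K : ℝ≥0} (hX : PushField Ω X K)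
    {Γ : Set E2} (hΓ : MeasurableSet Γ) (hΓΩ : Γ ⊆ closure Ω) {u G : E2 → ℝ}
    (hu : ContinuousOn u Ω) {b M : ℝ≥0∞}
    (hle : ∀ᶠ t in 𝓝[>] (0 : ℝ), b * bdrySq Γ (u ∘ push X t) ≤ pushFactor K t * M)
    (hlim : ∀ᵐ x ∂μH[1].restrict Γ, ∀ᶠ t in 𝓝[>] (0 : ℝ), G (push X t x) ^ 2 ≤ u (push X t x) ^ 2)
    (hG : Continuous G) : b * bdrySq Γ G ≤ M := by
  rcases eq_or_ne M ⊤ with rfl | hM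
  · exact le_top
  simp only [bdrySq_eq] at hle ⊢
  refine mul_lintegral_le_of_liminf (u := 𝓝[>] (0 : ℝ))
    (F := fun t x => ENNReal.ofReal ((u ∘ push X t) x ^ 2)) (M := fun t => pushFactor K t * M)
    ?_ ?_ hle ?_
  · filter_upwards [hX.eventually_mapsTo h.bdd] with t ht
    have h1 : ContinuousOn (u ∘ push X t) Γ :=
      hu.comp (hX.contDiff_push t).continuous.continuousOn (fun x hx => ht (hΓΩ hx))
    exact (ENNReal.continuous_ofReal.comp_continuousOn (h1.pow 2)).aemeasurable hΓ
  · filter_upwards [hlim] with x hx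
    have h1 : Tendsto (fun t => ENNReal.ofReal (G (push X t x) ^ 2)) (𝓝[>] 0)
        (𝓝 (ENNReal.ofReal (G x ^ 2))) :=
      ((ENNReal.continuous_ofReal.comp (hG.pow 2)).tendsto x).comp (PushField.tendsto_push x)
    rw [← h1.liminf_eq]
    exact liminf_le_liminf (hx.mono fun t ht => ENNReal.ofReal_le_ofReal ht)
  · simpa using ENNReal.Tendsto.mul_const (tendsto_pushFactor K) (Or.inr hM)

end SymDomain

lemma continuous_foldUp : Continuous foldUp := by unfold foldUp; fun_prop

lemma foldUp_of_nonneg {x : E2} (h : 0 ≤ x 1) : foldUp x = x := by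
  apply E2.ext' <;> simp [foldUp, abs_of_nonneg h]

lemma foldUp_of_nonpos {x : E2} (h : x 1 ≤ 0) : foldUp x = tauE x := by
  apply E2.ext' <;> simp [foldUp, abs_of_nonpos h]

lemma foldUp_tauE (x : E2) : foldUp (tauE x) = foldUp x := by
  apply E2.ext' <;> simp [foldUp]

lemma dirEnergy_neg (W : Set E2) (f : E2 → ℝ) : dirEnergy W (fun x => - f x) = dirEnergy W f := by
  simp only [dirEnergy]
  congr 1 with x
  rw [show (fun x => - f x) = -f from rfl, fderiv_neg]
  simp

/-- The odd extension across the horizontal axis of a function on the upper half plane. -/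
def oddExt (f : E2 → ℝ) (x : E2) : ℝ := if 0 < x 1 then f x else - f (tauE x)

/-- A smoothing of `foldUp`. -/
def softFold (ε : ℝ) (x : E2) : E2 := !₂[x 0, √(x 1 ^ 2 + ε ^ 2)]

lemma contDiff_softFold {ε : ℝ} (hε : 0 < ε) : ContDiff ℝ ∞ (softFold ε) := by
  have h1 : ContDiff ℝ ∞ (fun x : E2 => √(x 1 ^ 2 + ε ^ 2)) := by
    refine ContDiff.sqrt (by fun_prop) fun x => ?_
    positivity
  rw [contDiff_euclidean]
  intro i
  fin_cases i
  · simp only [softFold]; simp; fun_prop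
  · simpa [softFold] using h1

lemma lipschitzWith_softFold (ε : ℝ) : LipschitzWith 1 (softFold ε) := by
  refine LipschitzWith.of_dist_le_mul fun x y => ?_
  have h1 : ∀ a : ℝ, √(a ^ 2 + ε ^ 2) = ‖(!₂[a, ε] : E2)‖ := fun a => by
    rw [← Real.sqrt_sq (norm_nonneg (!₂[a, ε] : E2)), E2.norm_sq]; simp
  have h2 : |√(x 1 ^ 2 + ε ^ 2) - √(y 1 ^ 2 + ε ^ 2)| ≤ |x 1 - y 1| := by
    rw [h1, h1]
    refine (abs_norm_sub_norm_le _ _).trans ?_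
    rw [← Real.sqrt_sq (norm_nonneg ((!₂[x 1, ε] : E2) - !₂[y 1, ε])), E2.norm_sq]
    simp [Real.sqrt_sq_eq_abs]
  rw [NNReal.coe_one, one_mul, dist_eq_norm, dist_eq_norm, ← abs_of_nonneg (norm_nonneg (x - y)),
    ← abs_of_nonneg (norm_nonneg (softFold ε x - softFold ε y)), ← sq_le_sq, E2.norm_sq, E2.norm_sq]
  have := sq_le_sq.2 h2
  simp [softFold]
  linarith

lemma continuous_softFold : Continuous (fun p : ℝ × E2 => softFold p.1 p.2) := by
  unfold softFold; fun_prop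

lemma softFold_zero (x : E2) : softFold 0 x = foldUp x := by
  apply E2.ext' <;> simp [softFold, foldUp, Real.sqrt_sq_eq_abs]

lemma nnnorm_fderiv_comp_softFold_le {f : E2 → ℝ} (hf : Differentiable ℝ f) {ε : ℝ} (hε : 0 < ε)
    (x : E2) : ‖fderiv ℝ (f ∘ softFold ε) x‖ ≤ ‖fderiv ℝ f (softFold ε x)‖ := by
  rw [fderiv_comp x (hf _) ((contDiff_softFold hε).differentiable (by simp) x)]
  refine (ContinuousLinearMap.opNorm_comp_le _ _).trans ?_
  refine mul_le_of_le_one_right (norm_nonneg _) ?_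
  simpa using norm_fderiv_le_of_lipschitz ℝ (lipschitzWith_softFold ε) (x₀ := x)

lemma integral_eq_zero_of_comp_eq_neg {Γ : Set E2} (hΓ : MeasurableSet Γ) (g : E2 ≃ₗᵢ[ℝ] E2)
    (hg : g ⁻¹' Γ = Γ) {u : E2 → ℝ} (hu : ∀ x ∈ Γ, u (g x) = - u x) :
    ∫ x in Γ, u x ∂μH[1] = 0 := by
  have h2 := setIntegral_hausdorff_comp_isometry g Γ u
  rw [hg, setIntegral_congr_fun hΓ hu, integral_neg] at h2
  linarith

namespace SymDomain
variable {Ω : Set E2}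

lemma steklov_mul_le (h : SymDomain Ω) {f : E2 → ℝ} (hf : ContDiff ℝ ∞ f)
    (h0 : ∫ x in frontier Ω, f x ∂μH[1] = 0) :
    steklov Ω 1 * bdrySq (frontier Ω) f ≤ dirEnergy Ω f :=
  steklovMixed_mul_le_of_integral_eq_zero h.finiteBdry h.hausdorff_ne_zero frontier_subset_closure
    hf h0

lemma steklovN_mul_le (h : SymDomain Ω) {f : E2 → ℝ} (hf : ContDiff ℝ ∞ f)
    (h0 : ∫ x in upper (frontier Ω), f x ∂μH[1] = 0) :
    steklovN (upper Ω) (upper (frontier Ω)) 1 * bdrySq (upper (frontier Ω)) f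
      ≤ dirEnergy (upper Ω) f :=
  steklovMixed_mul_le_of_integral_eq_zero h.finiteBdry_upper h.hausdorff_upper_ne_zero
    upper_subset_closure hf h0

lemma bdrySq_congr {Γ : Set E2} (hΓ : MeasurableSet Γ) {f g : E2 → ℝ}
    (hfg : ∀ x ∈ Γ, f x ^ 2 = g x ^ 2) : bdrySq Γ f = bdrySq Γ g := by
  simp only [bdrySq_eq]
  exact setLIntegral_congr_fun hΓ fun x hx => by simp only [hfg x hx]

lemma bdrySq_comp_foldUp (h : SymDomain Ω) (f : E2 → ℝ) :
    bdrySq (frontier Ω) (f ∘ foldUp) = 2 * bdrySq (upper (frontier Ω)) f := by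
  rw [h.bdrySq_split, two_mul]
  congr 1 <;> refine bdrySq_congr h.finiteBdry_upper.meas fun x hx => ?_ <;>
    simp [foldUp_tauE, foldUp_of_nonneg (show 0 < x 1 from hx.2).le]

lemma integral_comp_foldUp (h : SymDomain Ω) {f : E2 → ℝ} (hf : Continuous f) :
    ∫ x in frontier Ω, f (foldUp x) ∂μH[1] = 2 * ∫ x in upper (frontier Ω), f x ∂μH[1] := by
  have hneg : MeasurableSet {x : E2 | x 1 < 0} :=
    (isOpen_lt (by fun_prop) continuous_const).measurableSet
  have e1 : frontier Ω = (upper (frontier Ω) ∪ frontier Ω ∩ {x : E2 | x 1 < 0}) ∪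
      frontier Ω ∩ {x : E2 | x 1 = 0} := by
    ext x
    simp only [mem_union, mem_inter_iff, mem_ofPred_eq]
    rcases lt_trichotomy (x 1) 0 with h | h | h <;> grind
  have e2 : ∫ x in frontier Ω, f (foldUp x) ∂μH[1] =
      ∫ x in upper (frontier Ω) ∪ frontier Ω ∩ {x : E2 | x 1 < 0}, f (foldUp x) ∂μH[1] := by
    refine setIntegral_congr_set ?_
    conv_lhs => rw [e1]
    exact union_ae_eq_left_of_ae_eq_empty (ae_eq_empty.2 (hausdorff_frontier_axis h.lip h.refl))
  have e3 : tauE ⁻¹' (frontier Ω ∩ {x : E2 | x 1 < 0}) = upper (frontier Ω) := by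
    rw [preimage_inter, h.tau_frontier]; ext x; simp
  have hc : IntegrableOn (fun x => f (foldUp x)) (frontier Ω) μH[1] :=
    h.finiteBdry.integrableOn (hf.comp continuous_foldUp)
  rw [e2, setIntegral_union _ (h.finiteBdry.meas.inter hneg) (hc.mono_set inter_subset_left)
    (hc.mono_set inter_subset_left), ← setIntegral_hausdorff_comp_isometry tauE
    (frontier Ω ∩ {x : E2 | x 1 < 0}), e3]
  · simp only [foldUp_tauE]
    rw [← two_mul]
    congr 1
    exact setIntegral_congr_fun h.finiteBdry_upper.meas fun x hx => by
      simp only [foldUp_of_nonneg (show 0 < x 1 from hx.2).le]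
  · rw [Set.disjoint_left]
    intro x h h'
    have h1 : 0 < x 1 := h.2
    have h2 : x 1 < 0 := h'.2
    exact lt_asymm h1 h2

lemma oddExt_eventuallyEq {f : E2 → ℝ}
    (hf : ∀ᶠ x in 𝓝ˢ (Ω ∩ {x : E2 | x 1 = 0}), f x = 0) {x : E2} (hx : x ∈ Ω) :
    (0 < x 1 ∧ oddExt f =ᶠ[𝓝 x] f) ∨ (x 1 < 0 ∧ oddExt f =ᶠ[𝓝 x] fun y => - f (tauE y)) ∨
      (x 1 = 0 ∧ oddExt f =ᶠ[𝓝 x] fun _ => 0) := by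
  have hc : Continuous fun y : E2 => y 1 := by fun_prop
  rcases lt_trichotomy (x 1) 0 with h1 | h1 | h1
  · refine Or.inr (Or.inl ⟨h1, ?_⟩)
    filter_upwards [hc.continuousAt.eventually (gt_mem_nhds h1)] with y hy
    simp [oddExt, not_lt.2 hy.le]
  · refine Or.inr (Or.inr ⟨h1, ?_⟩)
    have h2 : ∀ᶠ y in 𝓝 x, f y = 0 := hf.filter_mono
      (nhds_le_nhdsSet (mem_inter hx h1))
    have h3 : ∀ᶠ y in 𝓝 x, f (tauE y) = 0 := by
      have h4 : tauE x = x := by apply E2.ext' <;> simp [h1]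
      have h5 := tauE.continuous.tendsto x
      rw [h4] at h5
      exact h5.eventually h2
    filter_upwards [h2, h3] with y h2 h3
    simp [oddExt, h2, h3]
  · refine Or.inl ⟨h1, ?_⟩
    filter_upwards [hc.continuousAt.eventually (lt_mem_nhds h1)] with y hy
    simp [oddExt, hy]

lemma contDiffOn_oddExt {f : E2 → ℝ} (hfs : ContDiff ℝ ∞ f)
    (hf : ∀ᶠ x in 𝓝ˢ (Ω ∩ {x : E2 | x 1 = 0}), f x = 0) : ContDiffOn ℝ ∞ (oddExt f) Ω := by
  intro x hx
  refine ContDiffAt.contDiffWithinAt ?_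
  rcases oddExt_eventuallyEq hf hx with ⟨_, h1⟩ | ⟨_, h1⟩ | ⟨_, h1⟩
  · exact hfs.contDiffAt.congr_of_eventuallyEq h1
  · exact (hfs.comp tauE.contDiff).neg.contDiffAt.congr_of_eventuallyEq h1
  · exact contDiffAt_const.congr_of_eventuallyEq h1

lemma oddExt_tauE {f : E2 → ℝ} (hf : ∀ᶠ x in 𝓝ˢ (Ω ∩ {x : E2 | x 1 = 0}), f x = 0) {x : E2}
    (hx : x ∈ Ω) : oddExt f (tauE x) = - oddExt f x := by
  rcases lt_trichotomy (x 1) 0 with h1 | h1 | h1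
  · simp [oddExt, h1, not_lt.2 h1.le]
  · have h4 : tauE x = x := by apply E2.ext' <;> simp [h1]
    have h5 : f x = 0 := hf.self_of_nhdsSet x ⟨hx, h1⟩
    simp [oddExt, h1, h4, h5]
  · simp [oddExt, h1, not_lt.2 h1.le]

lemma dirEnergy_oddExt (h : SymDomain Ω) {f : E2 → ℝ}
    (hf : ∀ᶠ x in 𝓝ˢ (Ω ∩ {x : E2 | x 1 = 0}), f x = 0) :
    dirEnergy Ω (oddExt f) = 2 * dirEnergy (upper Ω) f := by
  have h1 : ∀ x ∈ upper Ω, oddExt f =ᶠ[𝓝 x] f := by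
    rintro x ⟨hx, hx1 : 0 < x 1⟩
    rcases oddExt_eventuallyEq hf hx with h1 | h1 | h1
    · exact h1.2
    · linarith [h1.1]
    · linarith [h1.1]
  have h2 : ∀ x ∈ upper Ω, oddExt f ∘ tauE =ᶠ[𝓝 x] fun y => - f y := by
    intro x hx
    filter_upwards [h1 x hx, h.isOpen.mem_nhds hx.1] with y hy hyΩ
    simp only [Function.comp, oddExt_tauE hf hyΩ, hy]
  rw [h.dirEnergy_split, dirEnergy_congr h.isOpen_upper.measurableSet h1,
    dirEnergy_congr h.isOpen_upper.measurableSet h2, dirEnergy_neg, two_mul]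

/-- A lower bound for the first mixed Dirichlet eigenvalue of the upper half of the domain, from
an inequality for odd functions. -/
lemma le_steklovD (h : SymDomain Ω) {X : E2 → E2} {K : ℝ≥0} (hX : PushField Ω X K) {b : ℝ≥0∞}
    (hb : ∀ u : E2 → ℝ, ContDiffOn ℝ ∞ u Ω → (∀ x ∈ Ω, u (tauE x) = - u x) →
      ∀ᶠ t in 𝓝[>] (0 : ℝ), b * bdrySq (frontier Ω) (u ∘ push X t)
        ≤ pushFactor K t * dirEnergy Ω u) :
    b ≤ steklovD (upper Ω) (upper (frontier Ω)) (Ω ∩ {x : E2 | x 1 = 0}) 0 := by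
  refine le_steklovMixed_zero h.finiteBdry_upper (fun f hf hfD => ?_) fun f hf hfD hf0 => ?_
  · have hs := contDiffOn_oddExt hf hfD
    have key := h.mul_bdrySq_le_of_push hX h.finiteBdry.meas frontier_subset_closure
      hs.continuousOn (hb _ hs fun x hx => oddExt_tauE hfD hx) (G := f ∘ foldUp) ?_
      (hf.continuous.comp continuous_foldUp)
    · rw [h.bdrySq_comp_foldUp, h.dirEnergy_oddExt hfD, mul_left_comm] at key
      exact (ENNReal.mul_le_mul_iff_right (by simp) (by simp)).1 key
    · refine ae_restrict_of_forall_mem h.finiteBdry.meas fun x hx => ?_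
      filter_upwards [hX.eventually_mapsTo h.bdd] with t ht
      have hmem := ht (frontier_subset_closure hx)
      set y := push X t x
      rcases lt_trichotomy (y 1) 0 with h1 | h1 | h1
      · simp [oddExt, foldUp_of_nonpos h1.le, not_lt.2 h1.le]
      · have h4 : tauE y = y := by apply E2.ext' <;> simp [h1]
        simp [oddExt, foldUp_of_nonpos h1.le, h1, h4]
      · simp [oddExt, foldUp_of_nonneg h1.le, h1]
  · obtain ⟨c, hc⟩ := exists_eqOn_const_upper h.isOpen h.isConnected.isPreconnected h.refl hf hf0
    have h1 : f 0 = 0 := hfD.self_of_nhdsSet 0 ⟨h.zero_mem, by simp⟩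
    have h2 : (0 : E2) ∈ closure (upper Ω) := mem_closure_upper h.isOpen h.zero_mem (by simp)
    have h3 : c = 0 := by rw [← h1, hc h2]
    intro x hx
    rw [hc hx, h3]; rfl

lemma steklov_le_steklovD (h : SymDomain Ω) {X : E2 → E2} {K : ℝ≥0} (hX : PushField Ω X K) :
    steklov Ω 1 ≤ steklovD (upper Ω) (upper (frontier Ω)) (Ω ∩ {x : E2 | x 1 = 0}) 0 := by
  refine h.le_steklovD hX fun u hu hodd => ?_
  filter_upwards [h.exists_push hX hu, hX.eventually_mapsTo h.bdd] with t ⟨v, hv, hvu, hvE, _⟩ ht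
  have h1 : ∀ x ∈ frontier Ω, v x = u (push X t x) := fun x hx =>
    hvu.self_of_nhdsSet x (frontier_subset_closure hx)
  have h2 : ∫ x in frontier Ω, v x ∂μH[1] = 0 := by
    refine integral_eq_zero_of_comp_eq_neg h.finiteBdry.meas tauE h.tau_frontier fun x hx => ?_
    have hx' : tauE x ∈ frontier Ω := by rwa [← h.tau_frontier] at hx
    rw [h1 x hx, h1 _ hx', hX.push_tau, hodd _ (ht (frontier_subset_closure hx))]
  have h3 : bdrySq (frontier Ω) (u ∘ push X t) = bdrySq (frontier Ω) v :=
    bdrySq_congr h.finiteBdry.meas fun x hx => by rw [h1 x hx]; rfl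
  rw [h3]
  exact (h.steklov_mul_le hv h2).trans hvE

lemma steklovN_mul_le_push (h : SymDomain Ω) {X : E2 → E2} {K : ℝ≥0} (hX : PushField Ω X K)
    {u : E2 → ℝ} (hu : ContDiffOn ℝ ∞ u Ω) (hodd : ∀ x ∈ Ω, u (-tauE x) = - u x) :
    ∀ᶠ t in 𝓝[>] (0 : ℝ), steklovN (upper Ω) (upper (frontier Ω)) 1 *
      bdrySq (upper (frontier Ω)) (u ∘ push X t) ≤ pushFactor K t * dirEnergy (upper Ω) u := by
  filter_upwards [h.exists_push hX hu, hX.eventually_mapsTo h.bdd] with t ⟨v, hv, hvu, _, hvE⟩ ht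
  have h1 : ∀ x ∈ frontier Ω, v x = u (push X t x) := fun x hx =>
    hvu.self_of_nhdsSet x (frontier_subset_closure hx)
  have h2 : ∫ x in upper (frontier Ω), v x ∂μH[1] = 0 := by
    refine h.integral_upper_eq_zero_of_odd fun x hx => ?_
    have hx' : -tauE x ∈ frontier Ω := by
      have h2 : ∀ y, rotE y ∈ frontier Ω ↔ y ∈ frontier Ω := fun y => by
        conv_rhs => rw [← h.rot_frontier]
        rfl
      have h3 : ∀ y, tauE y ∈ frontier Ω ↔ y ∈ frontier Ω := fun y => by
        conv_rhs => rw [← h.tau_frontier]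
        rfl
      rw [← rotE_rotE, h2, h2, h3]
      exact hx.1
    rw [h1 x hx.1, h1 _ hx', hX.push_neg, hX.push_tau, hodd _ (ht (frontier_subset_closure hx.1))]
  have h3 : bdrySq (upper (frontier Ω)) (u ∘ push X t) = bdrySq (upper (frontier Ω)) v :=
    bdrySq_congr h.finiteBdry_upper.meas fun x hx => by rw [h1 x hx.1]; rfl
  rw [h3]
  exact (h.steklovN_mul_le hv h2).trans hvE

lemma contDiffOn_comp_tau (h : SymDomain Ω) {u : E2 → ℝ} (hu : ContDiffOn ℝ ∞ u Ω) :
    ContDiffOn ℝ ∞ (u ∘ tauE) Ω :=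
  hu.comp tauE.contDiff.contDiffOn fun _ hx => h.tau_mem.2 hx

lemma contDiffOn_comp_rot (h : SymDomain Ω) {u : E2 → ℝ} (hu : ContDiffOn ℝ ∞ u Ω) :
    ContDiffOn ℝ ∞ (u ∘ rotE) Ω :=
  hu.comp rotE.contDiff.contDiffOn fun _ hx => h.rot_mem.2 hx

lemma steklovN_le_steklovD (h : SymDomain Ω) {X : E2 → E2} {K : ℝ≥0} (hX : PushField Ω X K) :
    steklovN (upper Ω) (upper (frontier Ω)) 1
      ≤ steklovD (upper Ω) (upper (frontier Ω)) (Ω ∩ {x : E2 | x 1 = 0}) 0 := by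
  refine h.le_steklovD hX fun u hu hodd => ?_
  have hg := h.contDiffOn_comp_rot hu
  have hgodd : ∀ x ∈ Ω, (u ∘ rotE) (-tauE x) = - (u ∘ rotE) x := by
    intro x hx
    have : rotE (-tauE x) = tauE (rotE x) := by rw [tauE_rotE, map_neg]
    simp only [Function.comp, this, hodd _ (h.rot_mem.2 hx)]
  have hgodd' : ∀ x ∈ Ω, (u ∘ rotE ∘ tauE) (-tauE x) = - (u ∘ rotE ∘ tauE) x := by
    intro x hx
    have := hgodd (tauE x) (h.tau_mem.2 hx)
    simpa using this
  filter_upwards [h.steklovN_mul_le_push hX hg hgodd,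
    h.steklovN_mul_le_push hX (h.contDiffOn_comp_tau hg) hgodd'] with t h1 h2
  have e1 : bdrySq (frontier Ω) (u ∘ push X t) = bdrySq (upper (frontier Ω)) ((u ∘ rotE) ∘ push X t)
      + bdrySq (upper (frontier Ω)) (((u ∘ rotE) ∘ tauE) ∘ push X t) := by
    rw [← h.bdrySq_comp_rot, h.bdrySq_split]
    congr 2
    · ext x; simp [hX.push_rot]
    · ext x; simp [hX.push_rot, hX.push_tau]
  rw [e1, ← h.dirEnergy_comp_rot u, h.dirEnergy_split (u ∘ rotE), mul_add, mul_add]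
  exact add_le_add h1 h2

lemma steklov_le_steklovN (h : SymDomain Ω) :
    steklov Ω 1 ≤ steklovN (upper Ω) (upper (frontier Ω)) 1 := by
  refine le_steklovMixed_one h.finiteBdry_upper h.hausdorff_upper_ne_zero (fun f hf h0 => ?_)
    (fun f hf hf0 => exists_eqOn_const_upper h.isOpen h.isConnected.isPreconnected h.refl hf hf0)
    upper_subset_closure
  have hcomp : IsCompact (frontier Ω) :=
    h.bdd.isCompact_closure.of_isClosed_subset isClosed_frontier frontier_subset_closure
  have hcont : Continuous (fun p : ℝ × E2 => f (softFold p.1 p.2)) :=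
    hf.continuous.comp continuous_softFold
  have : IsFiniteMeasure (μH[1].restrict (frontier Ω) : Measure E2) :=
    ⟨by simpa using hausdorff_frontier_lt_top h.lip⟩
  have : IsFiniteMeasure (volume.restrict Ω : Measure E2) :=
    ⟨by simpa using h.bdd.measure_lt_top⟩
  let L : ℝ := (μH[1] (frontier Ω)).toReal
  let m : ℝ → ℝ := fun ε => L⁻¹ * ∫ x in frontier Ω, f (softFold ε x) ∂μH[1]
  have hL : L ≠ 0 := ENNReal.toReal_ne_zero.2 ⟨h.hausdorff_ne_zero, h.finiteBdry.fin⟩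
  have hm : Tendsto m (𝓝[>] 0) (𝓝 0) := by
    have h1 : Continuous m := by
      refine continuous_const.mul ?_
      have := continuous_parametric_integral_of_continuous (μ := μH[1].restrict (frontier Ω))
        (f := fun ε x => f (softFold ε x)) hcont hcomp
      rwa [Measure.restrict_restrict h.finiteBdry.meas, inter_self] at this
    have h2 : m 0 = 0 := by
      simp only [m, softFold_zero]
      rw [h.integral_comp_foldUp hf.continuous, h0]; simp
    have h3 := h1.tendsto 0
    rw [h2] at h3
    exact h3.mono_left nhdsWithin_le_nhds
  have hD : Continuous (fun p : ℝ × E2 => ‖fderiv ℝ f (softFold p.1 p.2)‖ ^ 2) :=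
    (((hf.continuous_fderiv (by simp)).comp continuous_softFold).norm.pow 2)
  let M : ℝ → ℝ := fun ε => ∫ x in Ω, ‖fderiv ℝ f (softFold ε x)‖ ^ 2
  have hinteg : ∀ ε, IntegrableOn (fun x => ‖fderiv ℝ f (softFold ε x)‖ ^ 2) Ω volume := fun ε =>
    IntegrableOn.mono_set (((hD.comp (Continuous.prodMk_right ε)).continuousOn).integrableOn_compact
      h.bdd.isCompact_closure) subset_closure
  have hMc : Tendsto (fun ε => ENNReal.ofReal (M ε)) (𝓝[>] 0) (𝓝 (2 * dirEnergy (upper Ω) f)) := by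
    have h1 : Continuous M := by
      have := continuous_parametric_integral_of_continuous (μ := volume.restrict Ω)
        (f := fun ε x => ‖fderiv ℝ f (softFold ε x)‖ ^ 2) hD h.bdd.isCompact_closure
      rwa [Measure.restrict_restrict isClosed_closure.measurableSet,
        inter_eq_right.2 subset_closure] at this
    have h2 : ENNReal.ofReal (M 0) = 2 * dirEnergy (upper Ω) f := by
      simp only [M]
      rw [ofReal_integral_eq_lintegral_ofReal (hinteg 0) (ae_of_all _ fun x => by positivity)]
      have hτ : tauE ⁻¹' Ω = Ω := tauE.preimage_eq_of_image_eq h.refl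
      rw [lintegral_split_tau (μ := volume) h.isOpen.measurableSet hτ
        (fun T F => tauE.measurePreserving.setLIntegral_comp_preimage_emb
          tauE.toHomeomorph.measurableEmbedding F T)
        (measure_mono_null inter_subset_right volume_axis), two_mul]
      simp only [softFold_zero, foldUp_tauE, dirEnergy]
      congr 1 <;> refine setLIntegral_congr_fun h.isOpen_upper.measurableSet fun x hx => ?_ <;>
      · simp only [foldUp_of_nonneg (show 0 < x 1 from hx.2).le]
        rw [ENNReal.ofReal_pow (norm_nonneg _), ofReal_norm]
        rfl
    rw [← h2]
    exact ((ENNReal.continuous_ofReal.comp h1).tendsto 0).mono_left nhdsWithin_le_nhds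
  have key : steklov Ω 1 * bdrySq (frontier Ω) (f ∘ foldUp) ≤ 2 * dirEnergy (upper Ω) f := by
    rw [bdrySq_eq]
    refine mul_lintegral_le_of_tendsto (u := 𝓝[>] (0 : ℝ))
      (F := fun ε x => ENNReal.ofReal ((f (softFold ε x) - m ε) ^ 2)) ?_ ?_ ?_ hMc
    · refine Eventually.of_forall fun ε => ?_
      have : Continuous fun x => f (softFold ε x) := hcont.comp (Continuous.prodMk_right ε)
      exact (ENNReal.continuous_ofReal.comp
        ((this.sub continuous_const).pow 2)).measurable.aemeasurable
    · refine ae_of_all _ fun x => ?_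
      have h1 : Tendsto (fun ε => f (softFold ε x)) (𝓝[>] 0) (𝓝 (f (foldUp x))) := by
        rw [← softFold_zero]
        exact ((hcont.comp (Continuous.prodMk_left x)).tendsto 0).mono_left nhdsWithin_le_nhds
      have h2 := ((h1.sub hm).pow 2)
      rw [sub_zero] at h2
      exact (ENNReal.continuous_ofReal.tendsto _).comp h2
    · filter_upwards [self_mem_nhdsWithin] with ε hε
      have hfs : ContDiff ℝ ∞ (f ∘ softFold ε) := hf.comp (contDiff_softFold hε)
      have h1 : ∫ x in frontier Ω, ((f ∘ softFold ε) x - m ε) ∂μH[1] = 0 := by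
        rw [integral_sub (h.finiteBdry.integrableOn hfs.continuous)
          (h.finiteBdry.integrableOn continuous_const)]
        simp only [integral_const, smul_eq_mul, m, measureReal_def, Measure.restrict_apply_univ]
        have e : (μH[1] (frontier Ω)).toReal = L := rfl
        rw [e, mul_inv_cancel_left₀ hL]
        simp
      have h2 := h.steklov_mul_le (hfs.sub contDiff_const) h1
      rw [bdrySq_eq] at h2
      refine h2.trans ?_
      simp only [M]
      rw [ofReal_integral_eq_lintegral_ofReal (hinteg ε) (ae_of_all _ fun x => by positivity)]
      refine lintegral_mono fun x => ?_
      rw [show (fun x => (f ∘ softFold ε) x - m ε) = (f ∘ softFold ε) - fun _ => m ε from rfl,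
        fderiv_sub (hfs.differentiable (by simp) x) (differentiableAt_const _)]
      simp only [fderiv_fun_const, Pi.zero_apply, sub_zero]
      rw [ENNReal.ofReal_pow (norm_nonneg _), ofReal_norm]
      gcongr
      exact_mod_cast nnnorm_fderiv_comp_softFold_le (hf.differentiable (by simp)) hε x
  rw [h.bdrySq_comp_foldUp, mul_left_comm] at key
  exact (ENNReal.mul_le_mul_iff_right (by simp) (by simp)).1 key

end SymDomain

/-! ### A smooth threshold function -/

/-- A smooth function vanishing on `[-1, 1]`, with derivative in `[0, 1]`, at bounded distance
from the identity. -/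
def smoothThr (s : ℝ) : ℝ := ∫ r in (0 : ℝ)..s, Real.smoothTransition (r ^ 2 - 1)

lemma continuous_smoothThr_integrand :
    Continuous fun r : ℝ => Real.smoothTransition (r ^ 2 - 1) := by fun_prop

lemma deriv_smoothThr : deriv smoothThr = fun s => Real.smoothTransition (s ^ 2 - 1) := by
  ext s
  exact (intervalIntegral.integral_hasDerivAt_right
    (continuous_smoothThr_integrand.intervalIntegrable _ _)
    continuous_smoothThr_integrand.stronglyMeasurable.stronglyMeasurableAtFilter
    continuous_smoothThr_integrand.continuousAt).deriv

lemma contDiff_smoothThr : ContDiff ℝ ∞ smoothThr := by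
  rw [contDiff_infty_iff_deriv]
  refine ⟨fun s => (intervalIntegral.integral_hasDerivAt_right
    (continuous_smoothThr_integrand.intervalIntegrable _ _)
    continuous_smoothThr_integrand.stronglyMeasurable.stronglyMeasurableAtFilter
    continuous_smoothThr_integrand.continuousAt).differentiableAt, ?_⟩
  rw [deriv_smoothThr]
  exact Real.smoothTransition.contDiff.comp (by fun_prop)

lemma smoothThr_of_abs_le {s : ℝ} (hs : |s| ≤ 1) : smoothThr s = 0 := by
  rw [smoothThr]
  refine intervalIntegral.integral_zero_ae (ae_of_all _ fun r hr => ?_)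
  apply Real.smoothTransition.zero_of_nonpos
  have h1 : |r| ≤ |s| := by
    rcases le_total 0 s with h | h
    · rw [uIoc_of_le h] at hr
      rw [abs_of_pos hr.1, abs_of_nonneg h]; exact hr.2
    · rw [uIoc_of_ge h] at hr
      rw [abs_of_nonpos hr.2, abs_of_nonpos h]; linarith [hr.1]
  have := (sq_le_one_iff_abs_le_one r).2 (h1.trans hs)
  linarith

lemma abs_deriv_smoothThr_le (s : ℝ) : |deriv smoothThr s| ≤ 1 := by
  rw [deriv_smoothThr, abs_of_nonneg (Real.smoothTransition.nonneg _)]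
  exact Real.smoothTransition.le_one _

lemma abs_smoothThr_sub_le (s : ℝ) : |smoothThr s - s| ≤ 2 := by
  have hcont : Continuous fun r : ℝ => Real.smoothTransition (r ^ 2 - 1) - 1 :=
    continuous_smoothThr_integrand.sub continuous_const
  have h1 : ∀ a b : ℝ, smoothThr b - b - (smoothThr a - a) =
      ∫ r in a..b, (Real.smoothTransition (r ^ 2 - 1) - 1) := by
    intro a b
    rw [intervalIntegral.integral_sub (continuous_smoothThr_integrand.intervalIntegrable _ _)
      (continuous_const.intervalIntegrable _ _), intervalIntegral.integral_const,
      ← intervalIntegral.integral_interval_sub_left (a := 0)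
      (continuous_smoothThr_integrand.intervalIntegrable _ _)
      (continuous_smoothThr_integrand.intervalIntegrable _ _)]
    simp only [smoothThr, smul_eq_mul]; ring
  have h2 : ∀ a : ℝ, |a| ≤ 2 → |smoothThr a - a| ≤ 2 := by
    intro a ha
    have h3 := h1 0 a
    simp only [smoothThr_of_abs_le (show |(0 : ℝ)| ≤ 1 by simp), sub_zero] at h3
    rw [h3, ← Real.norm_eq_abs]
    refine (intervalIntegral.norm_integral_le_of_norm_le_const (C := 1) fun r _ => ?_).trans ?_
    · rw [Real.norm_eq_abs, abs_le]
      constructor <;> linarith [Real.smoothTransition.nonneg (r ^ 2 - 1),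
        Real.smoothTransition.le_one (r ^ 2 - 1)]
    · simpa using ha
  have h3 : ∀ a : ℝ, |a| = 2 → (∀ r ∈ uIoc a s, 2 ≤ |r|) → |smoothThr s - s| ≤ 2 := by
    intro a ha hr
    have h4 := h1 a s
    rw [intervalIntegral.integral_zero_ae (ae_of_all _ fun r hr' => ?_)] at h4
    · rw [sub_eq_zero.1 h4]; exact h2 a ha.le
    · have h5 : 2 ^ 2 ≤ r ^ 2 := by
        rw [← sq_abs r]; gcongr; exact hr r hr'
      rw [Real.smoothTransition.one_of_one_le (by linarith), sub_self]
  rcases le_or_gt |s| 2 with h | h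
  · exact h2 s h
  · rcases le_total 0 s with h' | h'
    · rw [abs_of_nonneg h'] at h
      refine h3 2 (by norm_num) fun r hr => ?_
      rw [uIoc_of_le h.le] at hr
      exact hr.1.le.trans (le_abs_self r)
    · rw [abs_of_nonpos h'] at h
      refine h3 (-2) (by norm_num) fun r hr => ?_
      rw [uIoc_of_ge (by linarith)] at hr
      linarith [neg_le_abs r, hr.2]

/-- The rescaled threshold function, vanishing on `[-δ, δ]`. -/
def scaledThr (δ s : ℝ) : ℝ := δ * smoothThr (δ⁻¹ * s)

lemma contDiff_scaledThr (δ : ℝ) : ContDiff ℝ ∞ (scaledThr δ) :=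
  contDiff_const.mul (contDiff_smoothThr.comp (contDiff_const.mul contDiff_id))

lemma scaledThr_of_abs_le {δ s : ℝ} (hδ : 0 < δ) (hs : |s| ≤ δ) : scaledThr δ s = 0 := by
  rw [scaledThr, smoothThr_of_abs_le, mul_zero]
  rw [abs_mul, abs_of_pos (inv_pos.2 hδ), inv_mul_le_iff₀ hδ, mul_one]
  exact hs

lemma abs_deriv_scaledThr_le {δ : ℝ} (hδ : 0 < δ) (s : ℝ) : |deriv (scaledThr δ) s| ≤ 1 := by
  have h1 : HasDerivAt (scaledThr δ) (δ * (deriv smoothThr (δ⁻¹ * s) * δ⁻¹)) s := by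
    refine HasDerivAt.const_mul _ ?_
    have h2 := (contDiff_smoothThr.differentiable (by simp) (δ⁻¹ * s)).hasDerivAt
    exact h2.comp s (by simpa using (hasDerivAt_id s).const_mul δ⁻¹)
  rw [h1.deriv, mul_comm, mul_assoc, inv_mul_cancel₀ hδ.ne', mul_one]
  exact abs_deriv_smoothThr_le _

lemma abs_scaledThr_sub_le {δ : ℝ} (hδ : 0 < δ) (s : ℝ) : |scaledThr δ s - s| ≤ 2 * δ := by
  have h1 : scaledThr δ s - s = δ * (smoothThr (δ⁻¹ * s) - δ⁻¹ * s) := by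
    rw [scaledThr, mul_sub, mul_inv_cancel_left₀ hδ.ne']
  rw [h1, abs_mul, abs_of_pos hδ, mul_comm]
  exact mul_le_mul_of_nonneg_right (abs_smoothThr_sub_le _) hδ.le

lemma tendsto_scaledThr (s : ℝ) : Tendsto (fun δ => scaledThr δ s) (𝓝[>] 0) (𝓝 s) := by
  rw [tendsto_iff_norm_sub_tendsto_zero]
  have h1 : Tendsto (fun δ : ℝ => 2 * δ) (𝓝[>] 0) (𝓝 0) := by
    have : Continuous fun δ : ℝ => 2 * δ := by fun_prop
    simpa using (this.tendsto 0).mono_left nhdsWithin_le_nhds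
  refine squeeze_zero' (Eventually.of_forall fun _ => norm_nonneg _) ?_ h1
  filter_upwards [self_mem_nhdsWithin] with δ hδ using abs_scaledThr_sub_le hδ s

lemma nnnorm_fderiv_scaledThr_comp_le {δ : ℝ} (hδ : 0 < δ) {u : E2 → ℝ} {x : E2}
    (hu : DifferentiableAt ℝ u x) : ‖fderiv ℝ (scaledThr δ ∘ u) x‖₊ ≤ ‖fderiv ℝ u x‖₊ := by
  have h1 := ((contDiff_scaledThr δ).differentiable (by simp) (u x)).hasDerivAt.comp_hasFDerivAt x
    hu.hasFDerivAt
  rw [h1.fderiv, nnnorm_smul]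
  refine mul_le_of_le_one_left zero_le ?_
  exact_mod_cast abs_deriv_scaledThr_le hδ (u x)

lemma dirEnergy_scaledThr_comp_le {δ : ℝ} (hδ : 0 < δ) {W : Set E2} (hW : MeasurableSet W)
    {u : E2 → ℝ} (hu : ∀ x ∈ W, DifferentiableAt ℝ u x) :
    dirEnergy W (scaledThr δ ∘ u) ≤ dirEnergy W u := by
  refine setLIntegral_mono' hW fun x hx => ?_
  gcongr
  exact nnnorm_fderiv_scaledThr_comp_le hδ (hu x hx)

/-! ### Parallelogram identities -/

lemma dirEnergy_parallelogram {W : Set E2} (hW : MeasurableSet W) {a b : E2 → ℝ}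
    (ha : ∀ x ∈ W, DifferentiableAt ℝ a x) (hb : ∀ x ∈ W, DifferentiableAt ℝ b x) :
    dirEnergy W (fun x => a x + b x) + dirEnergy W (fun x => a x - b x)
      = 2 * (dirEnergy W a + dirEnergy W b) := by
  have hm : ∀ u : E2 → ℝ, Measurable fun x => (‖fderiv ℝ u x‖₊ : ℝ≥0∞) ^ 2 := fun u =>
    ((measurable_fderiv ℝ u).nnnorm.coe_nnreal_ennreal).pow_const 2
  simp only [dirEnergy]
  rw [← lintegral_add_left (hm _), ← lintegral_add_left (hm _),
    ← lintegral_const_mul (f := fun x => (‖fderiv ℝ a x‖₊ : ℝ≥0∞) ^ 2 +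
      (‖fderiv ℝ b x‖₊ : ℝ≥0∞) ^ 2)
      _ ((hm _).add (hm _))]
  refine setLIntegral_congr_fun hW fun x hx => ?_
  rw [show (fun x => a x + b x) = a + b from rfl, show (fun x => a x - b x) = a - b from rfl,
    fderiv_add (ha x hx) (hb x hx), fderiv_sub (ha x hx) (hb x hx)]
  let p := (InnerProductSpace.toDual ℝ E2).symm (fderiv ℝ a x)
  let q := (InnerProductSpace.toDual ℝ E2).symm (fderiv ℝ b x)
  have h1 := parallelogram_law_with_norm ℝ p q
  have e1 : ‖p + q‖ = ‖fderiv ℝ a x + fderiv ℝ b x‖ := by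
    rw [← map_add, LinearIsometryEquiv.norm_map]
  have e2 : ‖p - q‖ = ‖fderiv ℝ a x - fderiv ℝ b x‖ := by
    rw [← map_sub, LinearIsometryEquiv.norm_map]
  have e3 : ‖p‖ = ‖fderiv ℝ a x‖ := LinearIsometryEquiv.norm_map _ _
  have e4 : ‖q‖ = ‖fderiv ℝ b x‖ := LinearIsometryEquiv.norm_map _ _
  rw [e1, e2, e3, e4] at h1
  norm_cast
  apply NNReal.eq
  push_cast
  nlinarith [h1]

lemma bdrySq_parallelogram {Γ : Set E2} (hΓ : MeasurableSet Γ) {a b : E2 → ℝ}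
    (ha : ContinuousOn a Γ) (hb : ContinuousOn b Γ) :
    bdrySq Γ (fun x => a x + b x) + bdrySq Γ (fun x => a x - b x)
      = 2 * (bdrySq Γ a + bdrySq Γ b) := by
  have hm : ∀ u : E2 → ℝ, ContinuousOn u Γ →
      AEMeasurable (fun x => ENNReal.ofReal (u x ^ 2)) (μH[1].restrict Γ) := fun u hu =>
    (ENNReal.continuous_ofReal.comp_continuousOn (hu.pow 2)).aemeasurable hΓ
  simp only [bdrySq_eq]
  rw [← lintegral_add_left' (hm (fun x => a x + b x) (ha.add hb)), ← lintegral_add_left' (hm _ ha),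
    ← lintegral_const_mul'' (f := fun x => ENNReal.ofReal (a x ^ 2) + ENNReal.ofReal (b x ^ 2))
      _ ((hm _ ha).add (hm _ hb))]
  refine lintegral_congr fun x => ?_
  rw [← ENNReal.ofReal_add (by positivity) (by positivity),
    ← ENNReal.ofReal_add (by positivity) (by positivity),
    show (2 : ℝ≥0∞) = ENNReal.ofReal 2 by simp, ← ENNReal.ofReal_mul (by norm_num)]
  congr 1
  ring

namespace SymDomain
variable {Ω : Set E2} {X : E2 → E2} {K : ℝ≥0} {t : ℝ}

lemma differentiableAt_of_contDiffOn (h : SymDomain Ω) {u : E2 → ℝ} (hu : ContDiffOn ℝ ∞ u Ω)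
    {x : E2} (hx : x ∈ Ω) : DifferentiableAt ℝ u x :=
  ((hu x hx).contDiffAt (h.isOpen.mem_nhds hx)).differentiableAt (by simp)

/-- The first mixed Dirichlet eigenvalue of the upper half of the domain. -/
abbrev lamD (Ω : Set E2) : ℝ≥0∞ :=
  steklovD (upper Ω) (upper (frontier Ω)) (Ω ∩ {x : E2 | x 1 = 0}) 0

lemma lamD_mul_le_of_eventually_zero (h : SymDomain Ω) (hX : PushField Ω X K)
    (hmaps : MapsTo (push X t) (closure Ω) Ω) (ht : 0 < t ∧ t * K < 1)
    {u : E2 → ℝ} (hu : ContDiffOn ℝ ∞ u Ω) (h0 : ∀ x ∈ Ω, x 1 = 0 → u =ᶠ[𝓝 x] 0) :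
    lamD Ω * bdrySq (upper (frontier Ω)) (u ∘ push X t)
      ≤ pushFactor K t * dirEnergy (upper Ω) u := by
  obtain ⟨v, hv, hvu, _, hvE⟩ := h.exists_push_of_mapsTo hX hu hmaps ht
  have hvD : ∀ᶠ x in 𝓝ˢ (Ω ∩ {x : E2 | x 1 = 0}), v x = 0 := by
    rw [eventually_nhdsSet_iff_forall]
    rintro x ⟨hx, hx1 : x 1 = 0⟩
    have h1 : ∀ᶠ y in 𝓝 x, v y = u (push X t y) :=
      hvu.filter_mono (nhds_le_nhdsSet (subset_closure hx))
    have h2 : tauE (push X t x) = push X t x := by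
      rw [← hX.push_tau]
      congr 1
      apply E2.ext' <;> simp [hx1]
    have h3 : push X t x 1 = 0 := by
      have := congrArg (fun y : E2 => y 1) h2
      simp at this; linarith
    have h4 := (hX.contDiff_push t).continuous.continuousAt.eventually
      (h0 _ (hmaps (subset_closure hx)) h3)
    filter_upwards [h1, h4] with y hy1 hy2
    rw [hy1, hy2]; rfl
  have h3 : bdrySq (upper (frontier Ω)) (u ∘ push X t) = bdrySq (upper (frontier Ω)) v :=
    bdrySq_congr h.finiteBdry_upper.meas fun x hx => by
      rw [hvu.self_of_nhdsSet x (frontier_subset_closure hx.1)]; rfl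
  rw [h3]
  exact (steklovMixed_zero_mul_le h.finiteBdry_upper upper_subset_closure hv hvD).trans hvE

lemma lamD_mul_le_upper (h : SymDomain Ω) (hX : PushField Ω X K)
    (hmaps : MapsTo (push X t) (closure Ω) Ω) (ht : 0 < t ∧ t * K < 1)
    {u : E2 → ℝ} (hu : ContDiffOn ℝ ∞ u Ω) (h0 : ∀ x ∈ Ω, x 1 = 0 → u x = 0) :
    lamD Ω * bdrySq (upper (frontier Ω)) (u ∘ push X t)
      ≤ pushFactor K t * dirEnergy (upper Ω) u := by
  have hpc : ContinuousOn (u ∘ push X t) (upper (frontier Ω)) :=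
    hu.continuousOn.comp (hX.contDiff_push t).continuous.continuousOn
      fun x hx => hmaps (frontier_subset_closure hx.1)
  simp only [bdrySq_eq]
  refine mul_lintegral_le_of_tendsto (u := 𝓝[>] (0 : ℝ))
    (F := fun δ x => ENNReal.ofReal (((scaledThr δ ∘ u) ∘ push X t) x ^ 2)) ?_ ?_ ?_
    tendsto_const_nhds
  · refine Eventually.of_forall fun δ => ?_
    exact (ENNReal.continuous_ofReal.comp_continuousOn
      (((contDiff_scaledThr δ).continuous.comp_continuousOn hpc).pow 2)).aemeasurable
      h.finiteBdry_upper.meas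
  · refine ae_of_all _ fun x => ?_
    exact (ENNReal.continuous_ofReal.tendsto _).comp ((tendsto_scaledThr _).pow 2)
  · filter_upwards [self_mem_nhdsWithin] with δ hδ
    have h1 := h.lamD_mul_le_of_eventually_zero hX hmaps ht
      ((contDiff_scaledThr δ).comp_contDiffOn hu) fun x hx hx1 => by
        have hc : ContinuousAt u x := hu.continuousOn.continuousAt (h.isOpen.mem_nhds hx)
        have h2 : ∀ᶠ y in 𝓝 x, dist (u y) (u x) < δ := hc.eventually (ball_mem_nhds _ hδ)
        filter_upwards [h2] with y hy
        rw [h0 x hx hx1, dist_zero_right, Real.norm_eq_abs] at hy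
        exact scaledThr_of_abs_le hδ hy.le
    rw [bdrySq_eq] at h1
    refine h1.trans ?_
    gcongr
    exact dirEnergy_scaledThr_comp_le hδ h.isOpen_upper.measurableSet
      fun x hx => h.differentiableAt_of_contDiffOn hu hx.1

lemma lamD_mul_le_of_axis (h : SymDomain Ω) (hX : PushField Ω X K)
    (hmaps : MapsTo (push X t) (closure Ω) Ω) (ht : 0 < t ∧ t * K < 1)
    {u : E2 → ℝ} (hu : ContDiffOn ℝ ∞ u Ω) (h0 : ∀ x ∈ Ω, x 1 = 0 → u x = 0) :
    lamD Ω * bdrySq (frontier Ω) (u ∘ push X t) ≤ pushFactor K t * dirEnergy Ω u := by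
  have h1 := h.lamD_mul_le_upper hX hmaps ht hu h0
  have h2 := h.lamD_mul_le_upper hX hmaps ht (h.contDiffOn_comp_tau hu)
    (fun x hx hx1 => h0 _ (h.tau_mem.2 hx) (by simpa using hx1))
  have e1 : (u ∘ push X t) ∘ tauE = (u ∘ tauE) ∘ push X t := by
    ext x; simp [hX.push_tau]
  rw [h.bdrySq_split, h.dirEnergy_split, mul_add, mul_add, e1]
  exact add_le_add h1 h2

lemma lamD_mul_le_of_axis' (h : SymDomain Ω) (hX : PushField Ω X K)
    (hmaps : MapsTo (push X t) (closure Ω) Ω) (ht : 0 < t ∧ t * K < 1)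
    {u : E2 → ℝ} (hu : ContDiffOn ℝ ∞ u Ω) (h0 : ∀ x ∈ Ω, x 0 = 0 → u x = 0) :
    lamD Ω * bdrySq (frontier Ω) (u ∘ push X t) ≤ pushFactor K t * dirEnergy Ω u := by
  have h1 := h.lamD_mul_le_of_axis hX hmaps ht (h.contDiffOn_comp_rot hu)
    (fun x hx hx1 => h0 _ (h.rot_mem.2 hx) (by simpa using hx1))
  have e1 : (u ∘ rotE) ∘ push X t = (u ∘ push X t) ∘ rotE := by
    ext x; simp [hX.push_rot]
  rwa [e1, h.bdrySq_comp_rot, h.dirEnergy_comp_rot] at h1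

lemma lamD_mul_le_of_odd (h : SymDomain Ω) (hX : PushField Ω X K)
    (hmaps : MapsTo (push X t) (closure Ω) Ω) (ht : 0 < t ∧ t * K < 1)
    {u : E2 → ℝ} (hu : ContDiffOn ℝ ∞ u Ω) (hodd : ∀ x ∈ Ω, u (-x) = - u x) :
    lamD Ω * bdrySq (frontier Ω) (u ∘ push X t) ≤ pushFactor K t * dirEnergy Ω u := by
  let a : E2 → ℝ := fun x => (u x + u (tauE x)) / 2
  let b : E2 → ℝ := fun x => (u x - u (tauE x)) / 2
  have ha : ContDiffOn ℝ ∞ a Ω := (hu.add (h.contDiffOn_comp_tau hu)).div_const 2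
  have hb : ContDiffOn ℝ ∞ b Ω := (hu.sub (h.contDiffOn_comp_tau hu)).div_const 2
  have h1 := h.lamD_mul_le_of_axis' hX hmaps ht ha fun x hx hx0 => by
    have : tauE x = -x := by apply E2.ext' <;> simp [hx0]
    simp [a, this, hodd x hx]
  have h2 := h.lamD_mul_le_of_axis hX hmaps ht hb fun x hx hx0 => by
    have : tauE x = x := by apply E2.ext' <;> simp [hx0]
    simp [b, this]
  have hpc : ∀ {v : E2 → ℝ}, ContDiffOn ℝ ∞ v Ω → ContinuousOn (v ∘ push X t) (frontier Ω) :=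
    fun hv => hv.continuousOn.comp (hX.contDiff_push t).continuous.continuousOn
      fun x hx => hmaps (frontier_subset_closure hx)
  have e1 := dirEnergy_parallelogram h.isOpen.measurableSet
    (fun x hx => h.differentiableAt_of_contDiffOn ha hx)
    (fun x hx => h.differentiableAt_of_contDiffOn hb hx)
  have e2 := bdrySq_parallelogram h.finiteBdry.meas (hpc ha) (hpc hb)
  have e3 : (fun x => a x + b x) = u := by ext x; simp only [a, b]; ring
  have e4 : (fun x => a x - b x) = u ∘ tauE := by ext x; simp only [a, b, Function.comp]; ring
  have e5 : (fun x => (a ∘ push X t) x + (b ∘ push X t) x) = u ∘ push X t := by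
    ext x; simp only [a, b, Function.comp]; ring
  have e6 : (fun x => (a ∘ push X t) x - (b ∘ push X t) x) = (u ∘ push X t) ∘ tauE := by
    ext x; simp only [a, b, Function.comp, hX.push_tau]; ring
  rw [e3, e4, h.dirEnergy_comp_tau, ← two_mul] at e1
  rw [e5, e6, h.bdrySq_comp_tau, ← two_mul] at e2
  rw [(ENNReal.mul_right_inj (by simp) (by simp)).1 e1,
    (ENNReal.mul_right_inj (by simp) (by simp)).1 e2, mul_add, mul_add]
  exact add_le_add h1 h2

/-- To bound the first mixed Dirichlet eigenvalue by the first Steklov eigenvalue it suffices to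
consider even functions. -/
lemma lamD_le_steklov (h : SymDomain Ω) (hX : PushField Ω X K)
    (heven : ∀ f : E2 → ℝ, ContDiff ℝ ∞ f → (∀ x, f (-x) = f x) →
      ∃ c : ℝ, lamD Ω * bdrySq (frontier Ω) (fun x => f x - c) ≤ dirEnergy Ω f) :
    lamD Ω ≤ steklov Ω 1 := by
  refine le_steklovMixed_one h.finiteBdry h.hausdorff_ne_zero (fun f hf h0 => ?_)
    (fun f hf hf0 => exists_eqOn_const_of_dirEnergy h.isOpen h.isConnected.isPreconnected hf hf0)
    frontier_subset_closure
  let a : E2 → ℝ := fun x => (f x + f (-x)) / 2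
  let b : E2 → ℝ := fun x => (f x - f (-x)) / 2
  have hfn : ContDiff ℝ ∞ fun x => f (-x) := hf.comp contDiff_neg
  have ha : ContDiff ℝ ∞ a := (hf.add hfn).div_const 2
  have hb : ContDiff ℝ ∞ b := (hf.sub hfn).div_const 2
  have h1 : lamD Ω * bdrySq (frontier Ω) b ≤ dirEnergy Ω b := by
    refine h.mul_bdrySq_le_of_push hX h.finiteBdry.meas frontier_subset_closure
      hb.continuous.continuousOn ?_ (ae_of_all _ fun x => Eventually.of_forall fun t => le_rfl)
      hb.continuous
    filter_upwards [hX.eventually_mapsTo h.bdd, eventually_mul_lt_one K] with t hmaps ht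
    exact h.lamD_mul_le_of_odd hX hmaps ht hb.contDiffOn fun x _ => by
      simp only [b, neg_neg]; ring
  have hneg : (fun x => f (-x)) = (f ∘ rotE) ∘ rotE := by ext x; simp
  have h2 : lamD Ω * bdrySq (frontier Ω) a ≤ dirEnergy Ω a := by
    obtain ⟨c, hc⟩ := heven a ha fun x => by simp only [a, neg_neg]; ring
    refine le_trans ?_ hc
    gcongr
    refine h.finiteBdry.bdrySq_le_sub_const ha.continuous ?_ c
    have h3 : ∀ g : E2 → ℝ,
        ∫ x in frontier Ω, g (rotE x) ∂μH[1] = ∫ x in frontier Ω, g x ∂μH[1] := by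
      intro g
      have := setIntegral_hausdorff_comp_isometry rotE (frontier Ω) g
      rwa [h.rot_frontier] at this
    have h4 : ∫ x in frontier Ω, f (-x) ∂μH[1] = 0 := by
      simp only [← rotE_rotE]
      rw [h3 (fun x => f (rotE x)), h3, h0]
    simp only [a]
    rw [integral_div, integral_add (h.finiteBdry.integrableOn hf.continuous)
      (h.finiteBdry.integrableOn hfn.continuous), h0, h4]
    simp
  have e1 := dirEnergy_parallelogram h.isOpen.measurableSet
    (fun x _ => ha.differentiable (by simp) x) (fun x _ => hb.differentiable (by simp) x)
  have e2 := bdrySq_parallelogram h.finiteBdry.meas ha.continuous.continuousOn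
    hb.continuous.continuousOn
  have e3 : (fun x => a x + b x) = f := by ext x; simp only [a, b]; ring
  have e4 : (fun x => a x - b x) = (f ∘ rotE) ∘ rotE := by
    rw [← hneg]; ext x; simp only [a, b]; ring
  rw [e3, e4, h.dirEnergy_comp_rot, h.dirEnergy_comp_rot, ← two_mul] at e1
  rw [e3, e4, h.bdrySq_comp_rot, h.bdrySq_comp_rot, ← two_mul] at e2
  rw [(ENNReal.mul_right_inj (by simp) (by simp)).1 e1,
    (ENNReal.mul_right_inj (by simp) (by simp)).1 e2, mul_add]
  exact add_le_add h2 h1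

end SymDomain

/-! ### Components of superlevel sets of even functions -/

/-- The part of `Ω` where `f` exceeds `c`. -/
def superlevel (Ω : Set E2) (f : E2 → ℝ) (c : ℝ) : Set E2 := Ω ∩ {x | c < f x}

/-- Some component of the superlevel set of `f` is symmetric about the origin and accumulates at
the boundary of `Ω`. -/
def HasSymmComponent (Ω : Set E2) (f : E2 → ℝ) (c : ℝ) : Prop :=
  ∃ x ∈ superlevel Ω f c, -x ∈ connectedComponentIn (superlevel Ω f c) x ∧
    (closure (connectedComponentIn (superlevel Ω f c) x) ∩ frontier Ω).Nonempty

open Classical in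
/-- A locally constant odd function on the superlevel set of an even function, which vanishes
only on symmetric components. -/
def componentSign (P : Set E2) (x : E2) : ℝ :=
  if connectedComponentIn P x = connectedComponentIn P (-x) then 0
  else if WellOrderingRel (connectedComponentIn P x) (connectedComponentIn P (-x)) then 1 else -1

lemma componentSign_neg (P : Set E2) (x : E2) : componentSign P (-x) = - componentSign P x := by
  classical
  rw [componentSign, componentSign, neg_neg]
  by_cases h : connectedComponentIn P x = connectedComponentIn P (-x)
  · simp [h]
  · rw [if_neg h, if_neg (Ne.symm h)]
    rcases trichotomous_of WellOrderingRel (connectedComponentIn P x)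
      (connectedComponentIn P (-x)) with h1 | h1 | h1
    · rw [if_pos h1, if_neg (asymm h1)]
    · exact absurd h1 h
    · rw [if_pos h1, if_neg (asymm h1), neg_neg]

lemma abs_componentSign_le (P : Set E2) (x : E2) : |componentSign P x| ≤ 1 := by
  rw [componentSign]; split_ifs <;> simp

lemma componentSign_sq {P : Set E2} {x : E2} (hx : -x ∈ P) (h : -x ∉ connectedComponentIn P x) :
    componentSign P x ^ 2 = 1 := by
  have h1 : connectedComponentIn P x ≠ connectedComponentIn P (-x) := fun h2 =>
    h (h2 ▸ mem_connectedComponentIn hx)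
  rw [componentSign, if_neg h1]
  split_ifs <;> simp

lemma neg_mem_connectedComponentIn {P : Set E2} (hP : ∀ x ∈ P, -x ∈ P) {x y : E2} (hx : x ∈ P)
    (hy : y ∈ connectedComponentIn P x) : -y ∈ connectedComponentIn P (-x) := by
  have h1 : (Neg.neg : E2 → E2) '' connectedComponentIn P x ⊆ connectedComponentIn P (-x) := by
    refine IsPreconnected.subset_connectedComponentIn
      (isPreconnected_connectedComponentIn.image _ continuous_neg.continuousOn)
      ⟨x, mem_connectedComponentIn hx, rfl⟩ ?_
    rintro _ ⟨z, hz, rfl⟩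
    exact hP z (connectedComponentIn_subset _ _ hz)
  exact h1 ⟨y, hy, rfl⟩

lemma componentSign_eventuallyEq {P : Set E2} (hPo : IsOpen P) (hP : ∀ x ∈ P, -x ∈ P) {x : E2}
    (hx : x ∈ P) : ∀ᶠ y in 𝓝 x, componentSign P y = componentSign P x := by
  filter_upwards [hPo.connectedComponentIn.mem_nhds (mem_connectedComponentIn hx)] with y hy
  rw [componentSign, componentSign, connectedComponentIn_eq hy,
    connectedComponentIn_eq (neg_mem_connectedComponentIn hP hx hy)]

namespace SymDomain
variable {Ω : Set E2} {X : E2 → E2} {K : ℝ≥0} {f : E2 → ℝ} {c c' δ : ℝ}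

lemma isOpen_superlevel (h : SymDomain Ω) (hf : Continuous f) : IsOpen (superlevel Ω f c) :=
  h.isOpen.inter (isOpen_lt continuous_const hf)

lemma neg_mem_superlevel (h : SymDomain Ω) (hev : ∀ x, f (-x) = f x) {x : E2}
    (hx : x ∈ superlevel Ω f c) : -x ∈ superlevel Ω f c :=
  ⟨h.neg_mem.2 hx.1, by rw [mem_ofPred_eq, hev]; exact hx.2⟩

/-- The odd competitor built from the truncation of an even function. -/
def oddTrunc (Ω : Set E2) (f : E2 → ℝ) (c δ : ℝ) (x : E2) : ℝ :=
  scaledThr δ (max (f x - c) 0) * componentSign (superlevel Ω f c) x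

lemma oddTrunc_eventuallyEq (h : SymDomain Ω) (hf : Continuous f) (hev : ∀ x, f (-x) = f x)
    {x : E2} (hx : x ∈ superlevel Ω f c) : oddTrunc Ω f c δ =ᶠ[𝓝 x]
      fun y => componentSign (superlevel Ω f c) x • (scaledThr δ ∘ fun z => f z - c) y := by
  filter_upwards [componentSign_eventuallyEq (h.isOpen_superlevel hf)
    (fun x hx => h.neg_mem_superlevel hev hx) hx, (h.isOpen_superlevel hf).mem_nhds hx] with y h1 h2
  have h3 : c < f y := h2.2
  rw [oddTrunc, h1, max_eq_left (by linarith), mul_comm, smul_eq_mul]; rfl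

lemma oddTrunc_eventuallyEq_zero (hf : Continuous f) (hδ : 0 < δ) {x : E2} (hx : f x ≤ c) :
    oddTrunc Ω f c δ =ᶠ[𝓝 x] fun _ => 0 := by
  filter_upwards [hf.continuousAt.eventually (gt_mem_nhds (show f x < c + δ by linarith))] with y hy
  rw [oddTrunc, scaledThr_of_abs_le hδ, zero_mul]
  rw [abs_of_nonneg (le_max_right _ _)]
  exact max_le (by linarith) hδ.le

lemma contDiffOn_oddTrunc (h : SymDomain Ω) (hf : ContDiff ℝ ∞ f) (hev : ∀ x, f (-x) = f x)
    (hδ : 0 < δ) : ContDiffOn ℝ ∞ (oddTrunc Ω f c δ) Ω := by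
  intro x hx
  apply ContDiffAt.contDiffWithinAt
  by_cases hc : c < f x
  · refine ContDiffAt.congr_of_eventuallyEq ?_ (h.oddTrunc_eventuallyEq hf.continuous hev ⟨hx, hc⟩)
    exact (((contDiff_scaledThr δ).comp (hf.sub contDiff_const)).const_smul _).contDiffAt
  · exact contDiffAt_const.congr_of_eventuallyEq
      (oddTrunc_eventuallyEq_zero hf.continuous hδ (not_lt.1 hc))

lemma dirEnergy_oddTrunc_le (h : SymDomain Ω) (hf : ContDiff ℝ ∞ f) (hev : ∀ x, f (-x) = f x)
    (hδ : 0 < δ) : dirEnergy Ω (oddTrunc Ω f c δ) ≤ dirEnergy (superlevel Ω f c) f := by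
  have hPo := h.isOpen_superlevel (c := c) hf.continuous
  have h1 : dirEnergy Ω (oddTrunc Ω f c δ) ≤
      ∫⁻ x in Ω, (superlevel Ω f c).indicator (fun x => (‖fderiv ℝ f x‖₊ : ℝ≥0∞) ^ 2) x := by
    refine setLIntegral_mono' h.isOpen.measurableSet fun x hx => ?_
    by_cases hc : c < f x
    · rw [indicator_of_mem (show x ∈ superlevel Ω f c from ⟨hx, hc⟩)]
      gcongr
      have hd : DifferentiableAt ℝ (fun z => f z - c) x :=
        (hf.differentiable (by simp) x).sub_const c
      rw [(h.oddTrunc_eventuallyEq hf.continuous hev ⟨hx, hc⟩).fderiv_eq]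
      have hd2 : DifferentiableAt ℝ (scaledThr δ ∘ fun z => f z - c) x :=
        DifferentiableAt.comp x ((contDiff_scaledThr δ).differentiable (by simp) _) hd
      rw [show (fun y => componentSign (superlevel Ω f c) x • (scaledThr δ ∘ fun z => f z - c) y)
        = componentSign (superlevel Ω f c) x • (scaledThr δ ∘ fun z => f z - c) from rfl,
        fderiv_const_smul hd2, nnnorm_smul]
      refine (mul_le_of_le_one_left zero_le ?_).trans
        ((nnnorm_fderiv_scaledThr_comp_le hδ hd).trans_eq ?_)
      · exact_mod_cast abs_componentSign_le _ x
      · rw [fderiv_sub_const]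
    · rw [(oddTrunc_eventuallyEq_zero hf.continuous hδ (not_lt.1 hc)).fderiv_eq]
      simp
  refine h1.trans_eq ?_
  rw [setLIntegral_indicator hPo.measurableSet, dirEnergy,
    inter_eq_left.2 (show superlevel Ω f c ⊆ Ω from inter_subset_left)]

lemma lamD_mul_truncation_le (h : SymDomain Ω) (hX : PushField Ω X K) (hf : ContDiff ℝ ∞ f)
    (hev : ∀ x, f (-x) = f x) (hc : ¬ HasSymmComponent Ω f c) :
    lamD Ω * bdrySq (frontier Ω) (fun x => max (f x - c) 0) ≤ dirEnergy (superlevel Ω f c) f := by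
  have hmc : Continuous fun x => max (f x - c) 0 :=
    (hf.continuous.sub continuous_const).max continuous_const
  have key : ∀ δ : ℝ, 0 < δ →
      lamD Ω * bdrySq (frontier Ω) (fun x => scaledThr δ (max (f x - c) 0))
        ≤ dirEnergy (superlevel Ω f c) f := by
    intro δ hδ
    refine h.mul_bdrySq_le_of_push hX h.finiteBdry.meas frontier_subset_closure
      (h.contDiffOn_oddTrunc (c := c) hf hev hδ).continuousOn ?_ ?_
      ((contDiff_scaledThr δ).continuous.comp hmc)
    · filter_upwards [hX.eventually_mapsTo h.bdd, eventually_mul_lt_one K] with t hmaps ht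
      refine (h.lamD_mul_le_of_odd hX hmaps ht (h.contDiffOn_oddTrunc (c := c) hf hev hδ)
        fun x hx => ?_).trans ?_
      · rw [oddTrunc, oddTrunc, hev, componentSign_neg]; ring
      · gcongr
        exact h.dirEnergy_oddTrunc_le hf hev hδ
    · refine ae_restrict_of_forall_mem h.finiteBdry.meas fun x hx => ?_
      have htend := PushField.tendsto_push (X := X) x
      rcases le_or_gt (f x) c with hfx | hfx
      · filter_upwards [htend.eventually (hf.continuous.continuousAt.eventually
          (gt_mem_nhds (show f x < c + δ by linarith)))] with t ht
        rw [scaledThr_of_abs_le hδ]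
        · simpa using sq_nonneg _
        · rw [abs_of_nonneg (le_max_right _ _)]
          exact max_le (by linarith) hδ.le
      · have h1 : ∀ᶠ t in 𝓝[>] (0 : ℝ), push X t x ∈ superlevel Ω f c := by
          filter_upwards [hX.eventually_mapsTo h.bdd, htend.eventually
            (hf.continuous.continuousAt.eventually (lt_mem_nhds hfx))] with t h1 h2
          exact ⟨h1 (frontier_subset_closure hx), h2⟩
        obtain ⟨t₀, ht₀, hsub⟩ := mem_nhdsGT_iff_exists_Ioo_subset.1 h1
        filter_upwards [Ioo_mem_nhdsGT ht₀] with t ht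
        have hy := hsub ht
        let J := (fun s => push X s x) '' Ioo 0 t₀
        have hJc : Continuous fun s : ℝ => push X s x := by unfold push; fun_prop
        have hJ : J ⊆ connectedComponentIn (superlevel Ω f c) (push X t x) := by
          refine (isPreconnected_Ioo.image _ hJc.continuousOn).subset_connectedComponentIn
            ⟨t, ht, rfl⟩ ?_
          rintro _ ⟨s, hs, rfl⟩
          exact hsub hs
        have hxJ : x ∈ closure J := mem_closure_of_tendsto htend <| by
          filter_upwards [Ioo_mem_nhdsGT ht₀] with s hs using ⟨s, hs, rfl⟩
        have h2 : -(push X t x) ∉ connectedComponentIn (superlevel Ω f c) (push X t x) :=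
          fun h3 => hc ⟨_, hy, h3, x, closure_mono hJ hxJ, hx⟩
        rw [oddTrunc, mul_pow, componentSign_sq (h.neg_mem_superlevel hev hy) h2, mul_one]
  simp only [bdrySq_eq] at key ⊢
  refine mul_lintegral_le_of_tendsto (u := 𝓝[>] (0 : ℝ))
    (F := fun δ x => ENNReal.ofReal (scaledThr δ (max (f x - c) 0) ^ 2)) ?_ ?_ ?_
    tendsto_const_nhds
  · refine Eventually.of_forall fun δ => Measurable.aemeasurable ?_
    exact (ENNReal.continuous_ofReal.comp
      (((contDiff_scaledThr δ).continuous.comp hmc).pow 2)).measurable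
  · refine ae_of_all _ fun x => ?_
    exact (ENNReal.continuous_ofReal.tendsto _).comp ((tendsto_scaledThr _).pow 2)
  · filter_upwards [self_mem_nhdsWithin] with δ hδ using key δ hδ

lemma not_both_symmComponent (h : SymDomain Ω) (hsc : IsSimplyConnected Ω)
    (hf : Continuous f) (hev : ∀ x, f (-x) = f x) (hcc : c ≤ c')
    (h1 : HasSymmComponent Ω f c') (h2 : HasSymmComponent Ω (fun x => - f x) (-c)) : False := by
  obtain ⟨x, hx, hxn, hxt⟩ := h1
  obtain ⟨y, hy, hyn, hyt⟩ := h2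
  have hev' : ∀ x, - f (-x) = - f x := fun x => by rw [hev]
  let e : ℂ ≃ₗᵢ[ℝ] E2 := Complex.orthonormalBasisOneI.repr
  let eh : ℂ ≃ₜ E2 := e.toHomeomorph
  have hneg : ∀ z, eh (-z) = - eh z := fun z => map_neg e z
  have touch : ∀ U : Set E2, (closure U ∩ frontier Ω).Nonempty →
      (closure (eh ⁻¹' U) ∩ frontier (eh ⁻¹' Ω)).Nonempty := by
    intro U hU
    rw [← eh.preimage_closure, ← eh.preimage_frontier, ← preimage_inter]
    exact hU.preimage eh.surjective
  have symm : ∀ P : Set E2, (∀ x ∈ P, -x ∈ P) → ∀ x ∈ P, -x ∈ connectedComponentIn P x →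
      ∀ z ∈ eh ⁻¹' connectedComponentIn P x, -z ∈ eh ⁻¹' connectedComponentIn P x := by
    intro P hP x hx hxn z hz
    rw [mem_preimage, hneg, connectedComponentIn_eq hxn]
    exact neg_mem_connectedComponentIn hP hx hz
  refine not_both_touch (Ω := eh ⁻¹' Ω) (U := eh ⁻¹' connectedComponentIn (superlevel Ω f c') x)
    (W := eh ⁻¹' connectedComponentIn (superlevel Ω (fun x => - f x) (-c)) y)
    (h.isOpen.preimage eh.continuous) ?_
    ((h.isOpen_superlevel hf).connectedComponentIn.preimage eh.continuous) ?_
    (symm _ (fun _ hx => h.neg_mem_superlevel hev hx) x hx hxn) ?_ (touch _ hxt)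
    ((h.isOpen_superlevel hf.neg).connectedComponentIn.preimage eh.continuous) ?_
    (symm _ (fun _ hx => h.neg_mem_superlevel hev' hx) y hy hyn) ?_ (touch _ hyt) ?_
  · exact eh.isSimplyConnected_preimage.2 hsc
  · exact eh.isConnected_preimage.2 (isConnected_connectedComponentIn_iff.2 hx)
  · exact preimage_mono ((connectedComponentIn_subset _ _).trans inter_subset_left)
  · exact eh.isConnected_preimage.2 (isConnected_connectedComponentIn_iff.2 hy)
  · exact preimage_mono ((connectedComponentIn_subset _ _).trans inter_subset_left)
  · refine Disjoint.preimage _ (disjoint_left.2 fun z hz1 hz2 => ?_)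
    have h3 : c' < f z := (connectedComponentIn_subset _ _ hz1).2
    have h4 : -c < - f z := (connectedComponentIn_subset _ _ hz2).2
    linarith

lemma hasSymmComponent_of_lt (h : SymDomain Ω) (hlt : ∀ x ∈ Ω, c < f x) :
    HasSymmComponent Ω f c := by
  have hP : superlevel Ω f c = Ω := inter_eq_left.2 hlt
  have hne : (frontier Ω).Nonempty := by
    by_contra hne
    exact h.hausdorff_ne_zero (by rw [not_nonempty_iff_eq_empty.1 hne, measure_empty])
  refine ⟨0, hP.symm ▸ h.zero_mem, ?_, ?_⟩
  · rw [neg_zero]; exact mem_connectedComponentIn (hP.symm ▸ h.zero_mem)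
  · rw [hP, h.isConnected.isPreconnected.connectedComponentIn h.zero_mem]
    exact hne.mono fun x hx => ⟨frontier_subset_closure hx, hx⟩

lemma exists_splitting_level (h : SymDomain Ω) (hsc : IsSimplyConnected Ω)
    (hf : Continuous f) (hev : ∀ x, f (-x) = f x) :
    ∃ c : ℝ, (∀ a, c < a → ¬ HasSymmComponent Ω f a) ∧
      ∀ a, a < c → ¬ HasSymmComponent Ω (fun x => - f x) (-a) := by
  have hK : IsCompact (closure Ω) := h.bdd.isCompact_closure
  obtain ⟨m, hm⟩ := (hK.image hf).bddBelow
  obtain ⟨M, hM⟩ := (hK.image hf).bddAbove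
  have hne : {a | HasSymmComponent Ω f a}.Nonempty :=
    ⟨m - 1, h.hasSymmComponent_of_lt fun x hx => by
    linarith [hm ⟨x, subset_closure hx, rfl⟩]⟩
  have hbd : BddAbove {a | HasSymmComponent Ω f a} := by
    refine ⟨M, ?_⟩
    rintro a ⟨x, hx, -⟩
    have h1 : a < f x := hx.2
    linarith [hM ⟨x, subset_closure hx.1, rfl⟩]
  refine ⟨sSup {a | HasSymmComponent Ω f a}, fun a ha hs => ?_, fun a ha hs => ?_⟩
  · exact absurd (le_csSup hbd hs) (not_le.2 ha)
  · obtain ⟨b, hb, hab⟩ := exists_lt_of_lt_csSup hne ha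
    exact h.not_both_symmComponent hsc hf hev hab.le hb hs

lemma lamD_mul_truncation_le_of_forall_gt (h : SymDomain Ω) (hX : PushField Ω X K)
    (hf : ContDiff ℝ ∞ f) (hev : ∀ x, f (-x) = f x)
    (hc : ∀ a, c < a → ¬ HasSymmComponent Ω f a) :
    lamD Ω * bdrySq (frontier Ω) (fun x => max (f x - c) 0) ≤ dirEnergy (superlevel Ω f c) f := by
  simp only [bdrySq_eq]
  refine mul_lintegral_le_of_tendsto (u := 𝓝[>] c)
    (F := fun a x => ENNReal.ofReal (max (f x - a) 0 ^ 2)) ?_ ?_ ?_ tendsto_const_nhds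
  · refine Eventually.of_forall fun a => Measurable.aemeasurable ?_
    have := hf.continuous
    exact (ENNReal.continuous_ofReal.comp (by fun_prop)).measurable
  · refine ae_of_all _ fun x => Tendsto.mono_left ?_ nhdsWithin_le_nhds
    exact (ENNReal.continuous_ofReal.comp (by fun_prop : Continuous fun a => max (f x - a) 0 ^ 2)
      ).tendsto c
  · filter_upwards [self_mem_nhdsWithin] with a ha
    have h1 := h.lamD_mul_truncation_le hX hf hev (hc a ha)
    rw [bdrySq_eq] at h1
    refine h1.trans (lintegral_mono_set fun x hx => ⟨hx.1, ?_⟩)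
    exact lt_trans (show c < a from ha) hx.2

lemma exists_lamD_mul_le_of_even (h : SymDomain Ω) (hX : PushField Ω X K)
    (hsc : IsSimplyConnected Ω) (hf : ContDiff ℝ ∞ f) (hev : ∀ x, f (-x) = f x) :
    ∃ c : ℝ, lamD Ω * bdrySq (frontier Ω) (fun x => f x - c) ≤ dirEnergy Ω f := by
  obtain ⟨c, hc1, hc2⟩ := h.exists_splitting_level hsc hf.continuous hev
  refine ⟨c, ?_⟩
  have h1 := h.lamD_mul_truncation_le_of_forall_gt hX hf hev hc1
  have h2 := h.lamD_mul_truncation_le_of_forall_gt (f := fun x => - f x) (c := -c) hX hf.neg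
    (fun x => by rw [hev]) fun a ha => by
      have := hc2 (-a) (by linarith)
      rwa [neg_neg] at this
  rw [dirEnergy_neg] at h2
  have hcont := hf.continuous
  have e1 : bdrySq (frontier Ω) (fun x => f x - c) = bdrySq (frontier Ω) (fun x => max (f x - c) 0)
      + bdrySq (frontier Ω) (fun x => max (- f x - -c) 0) := by
    simp only [bdrySq_eq]
    have hm : Continuous fun x => ENNReal.ofReal (max (f x - c) 0 ^ 2) :=
      ENNReal.continuous_ofReal.comp (by fun_prop)
    rw [← lintegral_add_left hm.measurable]
    refine lintegral_congr fun x => ?_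
    rw [← ENNReal.ofReal_add (by positivity) (by positivity)]
    congr 1
    rcases le_total (f x) c with h3 | h3
    · rw [max_eq_right (by linarith), max_eq_left (by linarith)]; ring
    · rw [max_eq_left (by linarith), max_eq_right (by linarith)]; ring
  have e2 : dirEnergy (superlevel Ω f c) f + dirEnergy (superlevel Ω (fun x => - f x) (-c)) f
      ≤ dirEnergy Ω f := by
    rw [dirEnergy, dirEnergy, ← lintegral_union (h.isOpen_superlevel
      (f := fun x => - f x) hcont.neg).measurableSet]
    · exact lintegral_mono_set (union_subset inter_subset_left inter_subset_left)
    · refine disjoint_left.2 fun z hz1 hz2 => ?_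
      have h3 : c < f z := hz1.2
      have h4 : -c < - f z := hz2.2
      linarith
  rw [e1, mul_add]
  exact (add_le_add h1 h2).trans e2

lemma lamD_eq_steklov (h : SymDomain Ω) (hX : PushField Ω X K) (hsc : IsSimplyConnected Ω) :
    lamD Ω = steklov Ω 1 :=
  (h.lamD_le_steklov hX fun _ hf hev => h.exists_lamD_mul_le_of_even hX hsc hf hev).antisymm
    (h.steklov_le_steklovD hX)

end SymDomain

/-! ### Odd conformal maps onto large parts of the disc -/

lemma DifferentiableAt.of_sq_eq {q φ : ℂ → ℂ} {z : ℂ} (hφ : DifferentiableAt ℂ φ z)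
    (hq : ContinuousAt q z) (hne : q z ≠ 0) (h : ∀ᶠ w in 𝓝 z, q w ^ 2 = φ w) :
    DifferentiableAt ℂ q z := by
  have hs : HasStrictDerivAt (fun w : ℂ => w ^ 2) (2 * q z) (q z) := by
    simpa using hasStrictDerivAt_pow 2 (q z)
  have hs0 : 2 * q z ≠ 0 := by simpa using hne
  have hl := (hs.to_localInverse hs0).hasDerivAt.differentiableAt
  rw [h.self_of_nhds] at hl
  refine (hl.comp z hφ).congr_of_eventuallyEq ?_
  filter_upwards [h, hq.eventually
    (hs.hasStrictFDerivAt_equiv hs0).eventually_left_inverse] with w h1 h2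
  rw [Function.comp, ← h1]
  exact h2.symm

structure SymmPlaneDomain (U : Set ℂ) : Prop where
  isOpen : IsOpen U
  isSimplyConnected : IsSimplyConnected U
  zero_mem : 0 ∈ U
  neg_mem : ∀ z ∈ U, -z ∈ U
  bdd : Bornology.IsBounded U

lemma SymmPlaneDomain.exists_even_sqrt {U : Set ℂ} (hU : SymmPlaneDomain U) {φ : ℂ → ℂ}
    (hφ : DifferentiableOn ℂ φ U) (hne : ∀ z ∈ U, φ z ≠ 0) (hev : ∀ z ∈ U, φ (-z) = φ z) :
    ∃ q : ℂ → ℂ, DifferentiableOn ℂ q U ∧ (∀ z ∈ U, q z ^ 2 = φ z) ∧ (∀ z ∈ U, q z ≠ 0) ∧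
      ∀ z ∈ U, q (-z) = q z := by
  obtain ⟨q, hqc, hq⟩ := Complex.exists_continuousOn_pow_eq hU.isSimplyConnected hU.isOpen
    hφ.continuousOn (by rintro ⟨z, hz, h⟩; exact hne z hz h) two_ne_zero
  have hq0 : ∀ z ∈ U, q z ≠ 0 := fun z hz h => hne z hz (by rw [← hq z, h]; simp)
  refine ⟨q, fun z hz => ?_, fun z _ => hq z, hq0, fun z hz => ?_⟩
  · have hn := hU.isOpen.mem_nhds hz
    exact (DifferentiableAt.of_sq_eq (hφ.differentiableAt hn) (hqc.continuousAt hn) (hq0 z hz)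
      (Eventually.of_forall hq)).differentiableWithinAt
  · have h1 : ContinuousOn (fun z => q (-z)) U :=
      hqc.comp continuous_neg.continuousOn fun z hz => hU.neg_mem z hz
    refine hU.isSimplyConnected.isPathConnected.isConnected.isPreconnected.eq_of_sq_eq h1 hqc
      (fun z hz => ?_) (fun {z} hz => hq0 z hz) hU.zero_mem (by simp) hz
    simp only [Pi.pow_apply]
    rw [hq, hq, hev z hz]

/-- `z ^ 2 * H z` is a conformal map to the unit disc of the quotient of `U` by `±1`. -/
structure QuotientMap (U : Set ℂ) (H : ℂ → ℂ) : Prop where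
  diff : DifferentiableOn ℂ H U
  even : ∀ z ∈ U, H (-z) = H z
  ne_zero : ∀ z ∈ U, H z ≠ 0
  norm_lt : ∀ z ∈ U, ‖z ^ 2 * H z‖ < 1
  inj : ∀ z ∈ U, ∀ w ∈ U, z ^ 2 * H z = w ^ 2 * H w → w = z ∨ w = -z

namespace SymmPlaneDomain
variable {U : Set ℂ}

lemma exists_quotientMap (hU : SymmPlaneDomain U) : ∃ H, QuotientMap U H := by
  obtain ⟨R, hR0, hR⟩ : ∃ R : ℝ, 0 < R ∧ U ⊆ ball 0 R := hU.bdd.subset_ball_lt 0 0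
  have hRC : (R : ℂ) ^ 2 ≠ 0 := by exact_mod_cast (pow_pos hR0 2).ne'
  refine ⟨fun _ => ((R : ℂ) ^ 2)⁻¹, differentiableOn_const _, fun _ _ => rfl,
    fun _ _ => inv_ne_zero hRC, fun z hz => ?_, fun z _ w _ h => ?_⟩
  · have h1 : ‖z‖ < R := by simpa using hR hz
    rw [norm_mul, norm_inv, norm_pow, norm_pow, Complex.norm_real, Real.norm_of_nonneg hR0.le,
      ← div_eq_mul_inv, div_lt_one (by positivity)]
    gcongr
  · have h2 := mul_right_cancel₀ (inv_ne_zero hRC) h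
    exact (sq_eq_sq_iff_eq_or_eq_neg.1 h2).elim (fun h => Or.inl h.symm)
      fun h => Or.inr (by rw [h, neg_neg])

lemma exists_norm_zero_le (hU : SymmPlaneDomain U) :
    ∃ C : ℝ, ∀ H, QuotientMap U H → ‖H 0‖ ≤ C := by
  obtain ⟨r, hr, hrU⟩ := nhds_basis_closedBall.mem_iff.1 (hU.isOpen.mem_nhds hU.zero_mem)
  refine ⟨(r ^ 2)⁻¹, fun H hH => ?_⟩
  refine Complex.norm_le_of_forall_mem_frontier_norm_le (U := ball (0 : ℂ) r) isBounded_ball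
    ?_ (fun z hz => ?_) (subset_closure (mem_ball_self hr))
  · refine DifferentiableOn.diffContOnCl ?_
    rw [closure_ball _ hr.ne']
    exact hH.diff.mono hrU
  · rw [frontier_ball _ hr.ne'] at hz
    have h1 := (hH.norm_lt z (hrU (sphere_subset_closedBall hz))).le
    rw [norm_mul, norm_pow, mem_sphere_zero_iff_norm.1 hz, ] at h1
    rwa [← one_div, le_div_iff₀' (by positivity)]

lemma one_sub_conj_mul_ne_zero {a b : ℂ} (ha : ‖a‖ < 1) (hb : ‖b‖ < 1) :
    1 - (starRingEnd ℂ) a * b ≠ 0 := by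
  intro h
  have h1 : ‖(starRingEnd ℂ) a * b‖ < 1 := by
    rw [norm_mul, RCLike.norm_conj]
    exact mul_lt_one_of_nonneg_of_lt_one_left (norm_nonneg _) ha hb.le
  rw [← sub_eq_zero.1 h, norm_one] at h1
  exact lt_irrefl _ h1

lemma norm_moebius_lt_one {a b : ℂ} (ha : ‖a‖ < 1) (hb : ‖b‖ < 1) :
    ‖(b - a) / (1 - (starRingEnd ℂ) a * b)‖ < 1 := by
  have h0 := norm_pos_iff.2 (one_sub_conj_mul_ne_zero ha hb)
  rw [norm_div, div_lt_one h0]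
  refine lt_of_pow_lt_pow_left₀ 2 h0.le ?_
  have ha2 : Complex.normSq a < 1 := by
    rw [Complex.normSq_eq_norm_sq]; nlinarith [norm_nonneg a]
  have hb2 : Complex.normSq b < 1 := by
    rw [Complex.normSq_eq_norm_sq]; nlinarith [norm_nonneg b]
  rw [← Complex.normSq_eq_norm_sq, ← Complex.normSq_eq_norm_sq]
  have key : Complex.normSq (1 - (starRingEnd ℂ) a * b) - Complex.normSq (b - a)
      = (1 - Complex.normSq a) * (1 - Complex.normSq b) := by
    simp only [Complex.normSq_apply, Complex.sub_re, Complex.sub_im, Complex.mul_re, Complex.mul_im,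
      Complex.conj_re, Complex.conj_im, Complex.one_re, Complex.one_im]
    ring
  nlinarith [mul_pos (sub_pos.2 ha2) (sub_pos.2 hb2)]

/-- If the image omits a point, the square root trick increases the derivative. -/
lemma exists_quotientMap_of_omits (hU : SymmPlaneDomain U) {H : ℂ → ℂ} (hH : QuotientMap U H)
    {a : ℂ} (ha : ‖a‖ < 1) (hom : ∀ z ∈ U, z ^ 2 * H z ≠ a) :
    ∃ H₁, QuotientMap U H₁ ∧ ∃ s : ℝ, 0 < s ∧ s ^ 2 = ‖a‖ ∧
      ‖H₁ 0‖ = ‖H 0‖ * ((1 + s ^ 2) / (2 * s)) := by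
  have hG : DifferentiableOn ℂ (fun z => z ^ 2 * H z) U :=
    (differentiable_id.pow 2).differentiableOn.mul hH.diff
  have hden : ∀ z ∈ U, 1 - (starRingEnd ℂ) a * (z ^ 2 * H z) ≠ 0 := fun z hz =>
    one_sub_conj_mul_ne_zero ha (hH.norm_lt z hz)
  have ha0 : a ≠ 0 := fun h => hom 0 hU.zero_mem (by simp [h])
  obtain ⟨q, hqd, hq, hq0, hqe⟩ := hU.exists_even_sqrt
    (φ := fun z => (z ^ 2 * H z - a) / (1 - (starRingEnd ℂ) a * (z ^ 2 * H z)))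
    ((hG.sub_const a).div ((hG.const_mul _).const_sub 1) hden)
    (fun z hz => div_ne_zero (sub_ne_zero.2 (hom z hz)) (hden z hz))
    (fun z hz => by rw [hH.even z hz, neg_sq])
  set b := q 0 with hb
  have hb2 : b ^ 2 = -a := by rw [hb, hq 0 hU.zero_mem]; simp
  have hbn : ‖b‖ ^ 2 = ‖a‖ := by rw [← norm_pow, hb2, norm_neg]
  have hb0 : b ≠ 0 := hq0 0 hU.zero_mem
  have hq1 : ∀ z ∈ U, ‖q z‖ < 1 := fun z hz => by
    have := norm_moebius_lt_one ha (hH.norm_lt z hz)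
    rw [← hq z hz, norm_pow] at this
    exact (pow_lt_one_iff_of_nonneg (norm_nonneg _) two_ne_zero).1 this
  have hb1 : ‖b‖ < 1 := hq1 0 hU.zero_mem
  have hcb : (starRingEnd ℂ) a = - (starRingEnd ℂ) b ^ 2 := by
    rw [← map_pow, hb2, map_neg, neg_neg]
  have hrel : ∀ z ∈ U, z ^ 2 * H z * (1 - (starRingEnd ℂ) b ^ 2 * q z ^ 2) = q z ^ 2 - b ^ 2 := by
    intro z hz
    have h1 := hq z hz
    rw [eq_div_iff (hden z hz), hcb] at h1
    rw [hb2]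
    linear_combination -h1
  have hm : ∀ z ∈ U, 1 - (starRingEnd ℂ) b * q z ≠ 0 := fun z hz =>
    one_sub_conj_mul_ne_zero hb1 (hq1 z hz)
  have hp : ∀ z ∈ U, 1 + (starRingEnd ℂ) b * q z ≠ 0 := fun z hz => by
    have := one_sub_conj_mul_ne_zero (a := b) (b := - q z) hb1 (by rw [norm_neg]; exact hq1 z hz)
    simpa using this
  have hqb : ∀ z ∈ U, q z + b ≠ 0 := by
    intro z hz h
    have h1 := hrel z hz
    have h2 : q z = -b := eq_neg_of_add_eq_zero_left h
    have h3 : q z ^ 2 - b ^ 2 = 0 := by rw [h2]; ring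
    have h4 : 1 - (starRingEnd ℂ) b ^ 2 * q z ^ 2 ≠ 0 := by
      have := mul_ne_zero (hm z hz) (hp z hz)
      intro h5; apply this; rw [← h5]; ring
    rw [h3, mul_eq_zero, or_iff_left h4, mul_eq_zero, or_iff_left (hH.ne_zero z hz)] at h1
    have h5 : z = 0 := by simpa using h1
    rw [h5, ← hb] at h2
    exact hb0 (self_eq_neg.1 h2)
  have hG1 : ∀ z ∈ U, z ^ 2 * (H z * ((1 + (starRingEnd ℂ) b * q z) / (q z + b)))
      = (q z - b) / (1 - (starRingEnd ℂ) b * q z) := by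
    intro z hz
    have h1 := hqb z hz
    have h2 := hm z hz
    rw [← mul_assoc, ← mul_div_assoc, div_eq_div_iff h1 h2]
    linear_combination hrel z hz
  refine ⟨fun z => H z * ((1 + (starRingEnd ℂ) b * q z) / (q z + b)), ⟨?_, ?_, ?_, ?_, ?_⟩,
    ‖b‖, norm_pos_iff.2 hb0, hbn, ?_⟩
  · exact hH.diff.mul (((hqd.const_mul _).const_add 1).div (hqd.add_const b) hqb)
  · intro z hz
    simp only [hH.even z hz, hqe z hz]
  · exact fun z hz => mul_ne_zero (hH.ne_zero z hz) (div_ne_zero (hp z hz) (hqb z hz))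
  · intro z hz
    rw [hG1 z hz]
    exact norm_moebius_lt_one hb1 (hq1 z hz)
  · intro z hz w hw h
    rw [hG1 z hz, hG1 w hw, div_eq_div_iff (hm z hz) (hm w hw)] at h
    have hbb : 1 - (starRingEnd ℂ) b * b ≠ 0 := one_sub_conj_mul_ne_zero hb1 hb1
    have h1 : (q z - q w) * (1 - (starRingEnd ℂ) b * b) = 0 := by linear_combination h
    have h2 : q z = q w := sub_eq_zero.1 ((mul_eq_zero.1 h1).resolve_right hbb)
    apply hH.inj z hz w hw
    have h4 : 1 - (starRingEnd ℂ) b ^ 2 * q z ^ 2 ≠ 0 := by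
      have := mul_ne_zero (hm z hz) (hp z hz)
      intro h5; apply this; rw [← h5]; ring
    apply mul_right_cancel₀ h4
    rw [hrel z hz, h2, hrel w hw]
  · have h1 : (1 + (starRingEnd ℂ) b * b) = ((1 + ‖b‖ ^ 2 : ℝ) : ℂ) := by
      rw [← Complex.normSq_eq_conj_mul_self, Complex.normSq_eq_norm_sq]; push_cast; ring
    simp only [← hb]
    rw [norm_mul, norm_div, h1, Complex.norm_real, Real.norm_of_nonneg (by positivity), ← two_mul,
      norm_mul]
    simp

lemma exists_quotientMap_surjOn (hU : SymmPlaneDomain U) {ρ : ℝ} (hρ0 : 0 < ρ) (hρ1 : ρ < 1) :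
    ∃ H, QuotientMap U H ∧ ∀ a : ℂ, ‖a‖ ≤ ρ → ∃ z ∈ U, z ^ 2 * H z = a := by
  obtain ⟨C, hC⟩ := hU.exists_norm_zero_le
  obtain ⟨H₀, hH₀⟩ := hU.exists_quotientMap
  let S : Set ℝ := {x | ∃ H, QuotientMap U H ∧ ‖H 0‖ = x}
  have hS : BddAbove S := ⟨C, by rintro _ ⟨H, hH, rfl⟩; exact hC H hH⟩
  have hSne : S.Nonempty := ⟨_, H₀, hH₀, rfl⟩
  have hpos : 0 < sSup S := lt_of_lt_of_le (norm_pos_iff.2 (hH₀.ne_zero 0 hU.zero_mem))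
    (le_csSup hS ⟨H₀, hH₀, rfl⟩)
  let r := √ρ
  have hr0 : 0 < r := Real.sqrt_pos.2 hρ0
  have hr2 : r ^ 2 = ρ := Real.sq_sqrt hρ0.le
  have hr1 : r < 1 := by nlinarith
  have hκ : 1 < (1 + r ^ 2) / (2 * r) := by
    rw [lt_div_iff₀ (by positivity)]; nlinarith [sq_pos_of_pos (sub_pos.2 hr1)]
  obtain ⟨_, ⟨H, hH, rfl⟩, hlt⟩ := exists_lt_of_lt_csSup hSne (div_lt_self hpos hκ)
  refine ⟨H, hH, fun a ha => ?_⟩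
  by_contra! hom
  obtain ⟨H₁, hH₁, s, hs0, hs2, hs⟩ := hU.exists_quotientMap_of_omits hH
    (ha.trans_lt hρ1) hom
  have hsr : s ≤ r := by
    refine le_of_sq_le_sq ?_ hr0.le
    rw [hs2, hr2]; exact ha
  have h1 : (1 + r ^ 2) / (2 * r) ≤ (1 + s ^ 2) / (2 * s) := by
    rw [div_le_div_iff₀ (by positivity) (by positivity)]
    nlinarith [mul_nonneg (sub_nonneg.2 hsr) (show 0 ≤ 1 - r * s by nlinarith)]
  have h2 : ‖H₁ 0‖ ≤ sSup S := le_csSup hS ⟨H₁, hH₁, rfl⟩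
  rw [div_lt_iff₀ (by linarith)] at hlt
  rw [hs] at h2
  have h3 := mul_le_mul_of_nonneg_left h1 (norm_nonneg (H 0))
  linarith

/-- A symmetric simply connected domain has odd injective holomorphic maps to the unit disc
whose images contain any given smaller disc. -/
lemma exists_odd_injOn (hU : SymmPlaneDomain U) {ρ : ℝ} (hρ0 : 0 < ρ) (hρ1 : ρ < 1) :
    ∃ F : ℂ → ℂ, DifferentiableOn ℂ F U ∧ (∀ z ∈ U, F (-z) = - F z) ∧ InjOn F U ∧
      MapsTo F U (ball 0 1) ∧ closedBall 0 ρ ⊆ F '' U := by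
  obtain ⟨H, hH, hsurj⟩ := hU.exists_quotientMap_surjOn hρ0 hρ1
  obtain ⟨g, hgd, hg, hg0, hge⟩ := hU.exists_even_sqrt hH.diff hH.ne_zero hH.even
  have hsq : ∀ z ∈ U, (z * g z) ^ 2 = z ^ 2 * H z := fun z hz => by rw [mul_pow, hg z hz]
  have hodd : ∀ z ∈ U, -z * g (-z) = - (z * g z) := fun z hz => by rw [hge z hz]; ring
  refine ⟨fun z => z * g z, differentiableOn_id.mul hgd, hodd, fun z hz w hw h => ?_,
    fun z hz => ?_, fun a ha => ?_⟩
  · have h : z * g z = w * g w := h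
    rcases hH.inj z hz w hw (by rw [← hsq z hz, ← hsq w hw, h]) with h1 | h1
    · exact h1.symm
    · rw [h1, hodd z hz, self_eq_neg, mul_eq_zero, or_iff_left (hg0 z hz)] at h
      rw [h1, h, neg_zero]
  · have h1 := hH.norm_lt z hz
    rw [← hsq z hz, norm_pow] at h1
    rw [mem_ball_zero_iff]
    exact (pow_lt_one_iff_of_nonneg (norm_nonneg _) two_ne_zero).1 h1
  · rw [mem_closedBall_zero_iff] at ha
    obtain ⟨z, hz, h⟩ := hsurj (a ^ 2) (by rw [norm_pow]; nlinarith [norm_nonneg a])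
    rw [← hsq z hz] at h
    rcases sq_eq_sq_iff_eq_or_eq_neg.1 h with h1 | h1
    · exact ⟨z, hz, h1⟩
    · exact ⟨-z, hU.neg_mem z hz, by simp only [hodd z hz, h1, neg_neg]⟩

end SymmPlaneDomain

/-! ### Weinstock's inequality for symmetric domains -/

/-- The standard isometry between the complex plane and the Euclidean plane. -/
abbrev planeE : ℂ ≃ₗᵢ[ℝ] E2 := Complex.orthonormalBasisOneI.repr

lemma det_smul_one (c : ℂ) : (c • (1 : ℂ →L[ℝ] ℂ)).det = Complex.normSq c := by
  rw [← Algebra.norm_complex_apply, Algebra.norm_apply, ContinuousLinearMap.det]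
  congr 1

/-- The Dirichlet integral of an injective holomorphic function is the area of its image. -/
lemma lintegral_deriv_sq_eq {U : Set ℂ} (hU : IsOpen U) {F : ℂ → ℂ} (hF : DifferentiableOn ℂ F U)
    (hinj : InjOn F U) : ∫⁻ z in U, (‖deriv F z‖₊ : ℝ≥0∞) ^ 2 = volume (F '' U) := by
  rw [← lintegral_abs_det_fderiv_eq_addHaar_image volume hU.measurableSet
    (fun z hz => ((hF.differentiableAt (hU.mem_nhds hz)).hasDerivAt.complexToReal_fderiv
      ).hasFDerivWithinAt) hinj]
  refine lintegral_congr fun z => ?_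
  rw [det_smul_one, Complex.normSq_eq_norm_sq, abs_of_nonneg (by positivity),
    ENNReal.ofReal_pow (norm_nonneg _), ofReal_norm]
  rfl

lemma isCompact_inter_preimage_closedBall {U : Set ℂ} (hU : IsOpen U) (hUc : IsPreconnected U)
    {F : ℂ → ℂ} (hF : DifferentiableOn ℂ F U) (hinj : InjOn F U) {ρ : ℝ} (hρ : 0 < ρ)
    (hsub : closedBall 0 ρ ⊆ F '' U) : IsCompact (U ∩ F ⁻¹' closedBall 0 ρ) := by
  have hopen : ∀ s ⊆ U, IsOpen s → IsOpen (F '' s) := by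
    refine ((hF.analyticOnNhd hU).is_constant_or_isOpen hUc).resolve_left ?_
    rintro ⟨w, hw⟩
    obtain ⟨z, hz, h0⟩ := hsub (mem_closedBall_self hρ.le)
    obtain ⟨z', hz', h1⟩ := hsub (show (ρ : ℂ) ∈ closedBall 0 ρ by
      simp [abs_of_pos hρ])
    rw [hw z hz] at h0
    rw [hw z' hz', h0] at h1
    exact hρ.ne (by exact_mod_cast h1)
  have hemb : Topology.IsOpenEmbedding (U.domRestrict F) := by
    refine .of_continuous_injective_isOpenMap hF.continuousOn.domRestrict
      (injOn_iff_injective.1 hinj)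
      fun s hs => ?_
    have h1 : U.domRestrict F '' s = F '' (Subtype.val '' s) := by
      rw [image_image]; rfl
    rw [h1]
    exact hopen _ (by rintro _ ⟨x, -, rfl⟩; exact x.2) (hU.isOpenMap_subtype_val s hs)
  have h2 := hemb.isInducing.isCompact_preimage' (isCompact_closedBall (0 : ℂ) ρ)
    (by rwa [range_domRestrict])
  have h3 := h2.image continuous_subtype_val
  rwa [domRestrict_eq, preimage_comp, Subtype.image_preimage_coe] at h3

/-- The Dirichlet energy of a real linear functional of norm at most one of a holomorphic
function. -/
lemma dirEnergy_comp_le {U : Set ℂ} (hU : IsOpen U) {F : ℂ → ℂ} (hF : DifferentiableOn ℂ F U)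
    (ℓ : ℂ →L[ℝ] ℝ) (hℓ : ‖ℓ‖ ≤ 1) :
    dirEnergy (planeE.symm ⁻¹' U) (fun x => ℓ (F (planeE.symm x)))
      ≤ ∫⁻ z in U, (‖deriv F z‖₊ : ℝ≥0∞) ^ 2 := by
  rw [← planeE.symm.measurePreserving.setLIntegral_comp_preimage_emb
    planeE.symm.toHomeomorph.measurableEmbedding]
  refine setLIntegral_mono' (hU.preimage planeE.symm.continuous).measurableSet fun x hx => ?_
  gcongr
  have h1 := (hF.differentiableAt (hU.mem_nhds hx)).hasDerivAt.complexToReal_fderiv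
  have h2 := (ℓ.hasFDerivAt.comp (planeE.symm x) h1).comp x
    planeE.symm.toContinuousLinearEquiv.hasFDerivAt
  have h3 : HasFDerivAt (fun x => ℓ (F (planeE.symm x))) _ x := h2
  rw [h3.fderiv, ← NNReal.coe_le_coe, coe_nnnorm, coe_nnnorm]
  refine ContinuousLinearMap.opNorm_le_bound _ (norm_nonneg _) fun v => ?_
  refine (ℓ.le_opNorm _).trans ?_
  refine (mul_le_of_le_one_left (norm_nonneg _) hℓ).trans_eq ?_
  change ‖deriv F (planeE.symm x) • planeE.symm v‖ = _
  rw [norm_smul, LinearIsometryEquiv.norm_map]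

namespace SymDomain
variable {Ω : Set E2} {X : E2 → E2} {K : ℝ≥0}

lemma symmPlaneDomain (h : SymDomain Ω) (hsc : IsSimplyConnected Ω) :
    SymmPlaneDomain (planeE ⁻¹' Ω) where
  isOpen := h.isOpen.preimage planeE.continuous
  isSimplyConnected := planeE.toHomeomorph.isSimplyConnected_preimage.2 hsc
  zero_mem := by simpa using h.zero_mem
  neg_mem z hz := by rw [mem_preimage, map_neg]; exact h.neg_mem.2 hz
  bdd := planeE.isometry.antilipschitz.isBounded_preimage h.bdd

lemma steklov_mul_le_push (h : SymDomain Ω) (hX : PushField Ω X K) {u : E2 → ℝ}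
    (hu : ContDiffOn ℝ ∞ u Ω) (hodd : ∀ x ∈ Ω, u (-x) = - u x) : ∀ᶠ t in 𝓝[>] (0 : ℝ),
    steklov Ω 1 * bdrySq (frontier Ω) (u ∘ push X t) ≤ pushFactor K t * dirEnergy Ω u := by
  filter_upwards [h.exists_push hX hu, hX.eventually_mapsTo h.bdd] with t ⟨v, hv, hvu, hvE, _⟩ ht
  have h1 : ∀ x ∈ frontier Ω, v x = u (push X t x) := fun x hx =>
    hvu.self_of_nhdsSet x (frontier_subset_closure hx)
  have h2 : ∫ x in frontier Ω, v x ∂μH[1] = 0 := by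
    refine h.integral_eq_zero_of_odd fun x hx => ?_
    have hx' : -x ∈ frontier Ω := by
      have h2 : ∀ y, rotE y ∈ frontier Ω ↔ y ∈ frontier Ω := fun y => by
        conv_rhs => rw [← h.rot_frontier]
        rfl
      rwa [← rotE_rotE, h2, h2]
    rw [h1 x hx, h1 _ hx', hX.push_neg, hodd _ (ht (frontier_subset_closure hx))]
  have h3 : bdrySq (frontier Ω) (u ∘ push X t) = bdrySq (frontier Ω) v :=
    bdrySq_congr h.finiteBdry.meas fun x hx => by rw [h1 x hx]; rfl
  rw [h3]
  exact (h.steklov_mul_le hv h2).trans hvE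

lemma steklov_mul_sq_mul_le (h : SymDomain Ω) (hX : PushField Ω X K)
    (hsc : IsSimplyConnected Ω) {ρ : ℝ} (hρ0 : 0 < ρ) (hρ1 : ρ < 1) :
    steklov Ω 1 * (ENNReal.ofReal (ρ ^ 2) * μH[1] (frontier Ω)) ≤ 2 * ENNReal.ofReal Real.pi := by
  have hU := h.symmPlaneDomain hsc
  obtain ⟨F, hF, hodd, hinj, hmap, hsub⟩ := hU.exists_odd_injOn hρ0 hρ1
  set U := planeE ⁻¹' Ω with hUdef
  have hmemU : ∀ x, planeE.symm x ∈ U ↔ x ∈ Ω := fun x => by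
    rw [hUdef, mem_preimage, LinearIsometryEquiv.apply_symm_apply]
  have hUΩ : planeE.symm ⁻¹' U = Ω := Set.ext hmemU
  have harea : ∫⁻ z in U, (‖deriv F z‖₊ : ℝ≥0∞) ^ 2 ≤ ENNReal.ofReal Real.pi := by
    rw [lintegral_deriv_sq_eq hU.isOpen hF hinj]
    refine (measure_mono hmap.image_subset).trans_eq ?_
    rw [Complex.volume_ball]
    simp [← NNReal.coe_real_pi]
  have hFc : ContDiffOn ℝ ∞ (fun x => F (planeE.symm x)) Ω :=
    ((hF.contDiffOn hU.isOpen).restrict_scalars ℝ).comp planeE.symm.contDiff.contDiffOn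
      fun x hx => (hmemU x).2 hx
  have hE : ∀ ℓ : ℂ →L[ℝ] ℝ, ‖ℓ‖ ≤ 1 →
      dirEnergy Ω (fun x => ℓ (F (planeE.symm x))) ≤ ENNReal.ofReal Real.pi := fun ℓ hℓ => by
    have := dirEnergy_comp_le hU.isOpen hF ℓ hℓ
    rw [hUΩ] at this
    exact this.trans harea
  have hle : ∀ ℓ : ℂ →L[ℝ] ℝ, ‖ℓ‖ ≤ 1 → ∀ᶠ t in 𝓝[>] (0 : ℝ), steklov Ω 1 *
      bdrySq (frontier Ω) ((fun x => ℓ (F (planeE.symm x))) ∘ push X t)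
        ≤ pushFactor K t * ENNReal.ofReal Real.pi := fun ℓ hℓ => by
    filter_upwards [h.steklov_mul_le_push hX (u := fun x => ℓ (F (planeE.symm x)))
      (ℓ.contDiff.comp_contDiffOn hFc)
      (fun x hx => by rw [map_neg, hodd _ ((hmemU x).2 hx), map_neg])] with t ht
    exact ht.trans (by gcongr; exact hE ℓ hℓ)
  have hcompact : IsCompact (planeE '' (U ∩ F ⁻¹' closedBall 0 ρ)) :=
    (isCompact_inter_preimage_closedBall hU.isOpen
      hU.isSimplyConnected.isPathConnected.isConnected.isPreconnected hF hinj hρ0 hsub).image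
      planeE.continuous
  have hlarge : ∀ x ∈ frontier Ω, ∀ᶠ t in 𝓝[>] (0 : ℝ), ρ < ‖F (planeE.symm (push X t x))‖ := by
    intro x hx
    have hx' : x ∈ (planeE '' (U ∩ F ⁻¹' closedBall 0 ρ))ᶜ := by
      rintro ⟨z, hz, rfl⟩
      rw [h.isOpen.frontier_eq] at hx
      exact hx.2 hz.1
    filter_upwards [hX.eventually_mapsTo h.bdd, (PushField.tendsto_push (X := X) x).eventually
      (hcompact.isClosed.isOpen_compl.mem_nhds hx')] with t h1 h2
    by_contra! h3
    refine h2 ⟨planeE.symm (push X t x), ⟨(hmemU _).2 (h1 (frontier_subset_closure hx)), ?_⟩,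
      planeE.apply_symm_apply _⟩
    exact mem_closedBall_zero_iff.2 h3
  have hmeas : ∀ ℓ : ℂ →L[ℝ] ℝ, ∀ᶠ t in 𝓝[>] (0 : ℝ), AEMeasurable (fun x =>
      ENNReal.ofReal (((fun x => ℓ (F (planeE.symm x))) ∘ push X t) x ^ 2))
      (μH[1].restrict (frontier Ω)) := fun ℓ => by
    filter_upwards [hX.eventually_mapsTo h.bdd] with t ht
    refine (ENNReal.continuous_ofReal.comp_continuousOn (ContinuousOn.pow ?_ 2)).aemeasurable
      h.finiteBdry.meas
    exact (ℓ.continuous.comp_continuousOn hFc.continuousOn).comp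
      (hX.contDiff_push t).continuous.continuousOn fun x hx => ht (frontier_subset_closure hx)
  have hre : ‖Complex.reCLM‖ ≤ 1 := Complex.reCLM_norm.le
  have him : ‖Complex.imCLM‖ ≤ 1 := Complex.imCLM_norm.le
  rw [← setLIntegral_const]
  refine mul_lintegral_le_of_liminf (u := 𝓝[>] (0 : ℝ))
    (F := fun t x =>
      ENNReal.ofReal (((fun x => Complex.reCLM (F (planeE.symm x))) ∘ push X t) x ^ 2) +
      ENNReal.ofReal (((fun x => Complex.imCLM (F (planeE.symm x))) ∘ push X t) x ^ 2))
    (M := fun t => pushFactor K t * (2 * ENNReal.ofReal Real.pi)) ?_ ?_ ?_ ?_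
  · filter_upwards [hmeas Complex.reCLM, hmeas Complex.imCLM] with t h1 h2 using h1.add h2
  · refine ae_restrict_of_forall_mem h.finiteBdry.meas fun x hx => ?_
    refine le_liminf_of_le (by isBoundedDefault) ?_
    filter_upwards [hlarge x hx] with t ht
    rw [← ENNReal.ofReal_add (by positivity) (by positivity)]
    apply ENNReal.ofReal_le_ofReal
    have h1 : ρ ^ 2 ≤ ‖F (planeE.symm (push X t x))‖ ^ 2 := by gcongr
    rw [← Complex.normSq_eq_norm_sq, Complex.normSq_apply] at h1
    simp only [Function.comp, Complex.reCLM_apply, Complex.imCLM_apply]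
    linarith
  · filter_upwards [hle _ hre, hle _ him, hmeas Complex.reCLM] with t h1 h2 h3
    rw [lintegral_add_left' h3, ← bdrySq_eq, ← bdrySq_eq, mul_add, two_mul, mul_add]
    exact add_le_add h1 h2
  · simpa using ENNReal.Tendsto.mul_const (tendsto_pushFactor K)
      (Or.inl one_ne_zero : (1 : ℝ≥0∞) ≠ 0 ∨ 2 * ENNReal.ofReal Real.pi ≠ ⊤)

/-- Weinstock's inequality. -/
lemma steklov_mul_perimeter_le (h : SymDomain Ω) (hX : PushField Ω X K)
    (hsc : IsSimplyConnected Ω) :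
    steklov Ω 1 * μH[1] (frontier Ω) ≤ 2 * ENNReal.ofReal Real.pi := by
  have h1 : Tendsto (fun ρ : ℝ => ENNReal.ofReal (ρ ^ 2) * (steklov Ω 1 * μH[1] (frontier Ω)))
      (𝓝[<] 1) (𝓝 (1 * (steklov Ω 1 * μH[1] (frontier Ω)))) := by
    refine ENNReal.Tendsto.mul_const ?_ (Or.inl one_ne_zero)
    have h2 : Continuous fun ρ : ℝ => ENNReal.ofReal (ρ ^ 2) :=
      ENNReal.continuous_ofReal.comp (by fun_prop)
    simpa using (h2.tendsto 1).mono_left nhdsWithin_le_nhds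
  rw [one_mul] at h1
  refine le_of_tendsto h1 ?_
  filter_upwards [Ioo_mem_nhdsLT zero_lt_one] with ρ hρ
  rw [mul_left_comm]
  exact h.steklov_mul_sq_mul_le hX hsc hρ.1 hρ.2

lemma steklov_mul_upper_perimeter_le (h : SymDomain Ω) (hX : PushField Ω X K)
    (hsc : IsSimplyConnected Ω) :
    steklov Ω 1 * μH[1] (upper (frontier Ω)) ≤ ENNReal.ofReal Real.pi := by
  have h1 := h.steklov_mul_perimeter_le hX hsc
  rw [h.hausdorff_frontier_eq, mul_left_comm] at h1
  exact (ENNReal.mul_le_mul_iff_right (by simp) (by simp)).1 h1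

end SymDomain

theorem statement5 (Ω : Set E2)
    (hΩ : IsLipschitzDomain Ω) (hsc : SimplyConnectedSpace Ω)
    (h0 : (0 : E2) ∈ Ω)
    (hrot : rotQuarter '' Ω = Ω) (hrefl : reflX '' Ω = Ω) :
    steklovN (Ω ∩ {x : E2 | 0 < x 1}) (frontier Ω ∩ {x : E2 | 0 < x 1}) 1
        = steklov Ω 1
    ∧ steklovD (Ω ∩ {x : E2 | 0 < x 1}) (frontier Ω ∩ {x : E2 | 0 < x 1})
        (Ω ∩ {x : E2 | x 1 = 0}) 0 = steklov Ω 1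
    ∧ steklovN (Ω ∩ {x : E2 | 0 < x 1}) (frontier Ω ∩ {x : E2 | 0 < x 1}) 1
        * μH[1] (frontier Ω ∩ {x : E2 | 0 < x 1}) ≤ ENNReal.ofReal Real.pi
    ∧ steklovD (Ω ∩ {x : E2 | 0 < x 1}) (frontier Ω ∩ {x : E2 | 0 < x 1})
        (Ω ∩ {x : E2 | x 1 = 0}) 0
        * μH[1] (frontier Ω ∩ {x : E2 | 0 < x 1}) ≤ ENNReal.ofReal Real.pi := by
  have h : SymDomain Ω := ⟨hΩ, h0, hrot, hrefl⟩
  obtain ⟨X, K, hX⟩ := exists_pushField hΩ hrot hrefl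
  have hD : steklovD (Ω ∩ {x : E2 | 0 < x 1}) (frontier Ω ∩ {x : E2 | 0 < x 1})
      (Ω ∩ {x : E2 | x 1 = 0}) 0 = steklov Ω 1 := h.lamD_eq_steklov hX hsc
  have hN : steklovN (Ω ∩ {x : E2 | 0 < x 1}) (frontier Ω ∩ {x : E2 | 0 < x 1}) 1
      = steklov Ω 1 :=
    ((h.steklovN_le_steklovD hX).trans_eq hD).antisymm h.steklov_le_steklovN
  have hπ := h.steklov_mul_upper_perimeter_le hX hsc
  exact ⟨hN, hD, hN ▸ hπ, hD ▸ hπ⟩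

end
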